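/- Fix integers r, 𝔙 ≥ 1, reals 0 < ε, λ < 1, and fix irreducible, pairwise coprime polynomials Q₁, …, Q_r ∈ ℤ[X] such that Q := ∏_{j=1}^r Q_j has no fixed prime divisor. There exists a constant C > 0 (depending on r, 𝔙, ε, λ and the polynomials Q₁, …, Q_r) such that: for all x ≥ 2 with x^ε < y ≤ x, setting z := exp((log x)^{1−λ}), and for all real-valued additive functions f₁, …, f_r satisfying #{f_j(n) : n ≤ t^u, P⁻(n) > t} ≤ 𝔙^u for every 1 ≤ j ≤ r, every real t ≥ z and every real u ≥ 1, one has for all k₁, …, k_r ∈ ℝ: #{n ∈ ℤ : x < n ≤ x + y, f_j(Q_j(n)) = k_j for all 1 ≤ j ≤ r} ≤ C · y / ∏_{j=1}^r √(E_{f_j}(x; ρ_j)). -/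

import Mathlib

open scoped Classical

/-- The finset of primes `p ≤ x` for a real `x`. -/
noncomputable def primesBelow (x : ℝ) : Finset ℕ :=
  (Finset.range (⌊x⌋₊ + 1)).filter Nat.Prime

/-- `E_f(x; r) := 1 + ∑_{p ≤ x, f(p) ≠ 0} r(p)/p`. -/
noncomputable def Ef (f : ℕ → ℝ) (x : ℝ) (r : ℕ → ℝ) : ℝ :=
  1 + ∑ p ∈ (primesBelow x).filter (fun p => f p ≠ 0), r p / p

/-- `ρ_Q(m) := #{0 ≤ n < m : m ∣ Q(n)}`. -/
noncomputable def rho (Q : Polynomial ℤ) (m : ℕ) : ℕ :=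
  ((Finset.range m).filter fun n => (m : ℤ) ∣ Q.eval (n : ℤ)).card

/-- Extension of `f : ℕ → ℝ` to `ℤ` by `f(−n) := f(n)` and `f(0) := 0`. -/
noncomputable def extZ (f : ℕ → ℝ) (n : ℤ) : ℝ := if n = 0 then 0 else f n.natAbs



lemma mem_primesBelow' {x : ℝ} {p : ℕ} : p ∈ primesBelow x ↔ p.Prime ∧ (p:ℝ) ≤ x := by
  unfold primesBelow
  rw [Finset.mem_filter, Finset.mem_range, Nat.lt_succ_iff]
  constructor
  · rintro ⟨h1, h2⟩
    exact ⟨h2, (Nat.le_floor_iff' h2.pos.ne').1 h1⟩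
  · rintro ⟨h1, h2⟩
    exact ⟨(Nat.le_floor_iff' h1.pos.ne').2 h2, h1⟩

lemma primesBelow_mono {x y : ℝ} (h : x ≤ y) : primesBelow x ⊆ primesBelow y := by
  intro p hp
  rw [mem_primesBelow'] at *
  exact ⟨hp.1, hp.2.trans h⟩

lemma pow_div_dvd_factorial (n p : ℕ) (hp : p.Prime) : p ^ (n / p) ∣ n.factorial := by
  have := Fact.mk hp
  rw [padicValNat_dvd_iff_le (Nat.factorial_ne_zero n)]
  rw [padicValNat_factorial (b := Nat.log p n + 2) (by omega)]
  calc n / p = n / p ^ 1 := by simp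
    _ ≤ _ := Finset.single_le_sum (f := fun i => n / p ^ i) (fun _ _ => Nat.zero_le _) (by simp)

/-- Mertens first theorem, upper bound. -/
lemma sum_log_div_le {x : ℝ} (hx : 1 ≤ x) :
    ∑ p ∈ primesBelow x, Real.log p / p ≤ 2 * Real.log x := by
  set n := ⌊x⌋₊ with hn
  have hn1 : 1 ≤ n := Nat.one_le_floor_iff x |>.2 hx
  have hdvd : ∏ p ∈ primesBelow x, p ^ (n / p) ∣ n.factorial := by
    apply Finset.prod_dvd_of_isRelPrime
    · intro p hp q hq hpq
      have hp' := (mem_primesBelow'.1 (Finset.mem_coe.1 hp)).1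
      have hq' := (mem_primesBelow'.1 (Finset.mem_coe.1 hq)).1
      exact Nat.coprime_iff_isRelPrime.1 (Nat.Coprime.pow _ _ ((Nat.coprime_primes hp' hq').2 hpq))
    · intro p hp
      exact pow_div_dvd_factorial n p (mem_primesBelow'.1 hp).1
  have hle : ∏ p ∈ primesBelow x, p ^ (n / p) ≤ n ^ n :=
    (Nat.le_of_dvd (Nat.factorial_pos n) hdvd).trans (Nat.factorial_le_pow n)
  have hlog : ∑ p ∈ primesBelow x, ((n / p : ℕ) : ℝ) * Real.log p ≤ n * Real.log n := by
    have h1 : Real.log ((∏ p ∈ primesBelow x, p ^ (n / p) : ℕ) : ℝ) ≤ Real.log ((n ^ n : ℕ) : ℝ) := by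
      apply Real.log_le_log
      · have : 0 < ∏ p ∈ primesBelow x, p ^ (n / p) :=
          Finset.prod_pos fun p hp => pow_pos (mem_primesBelow'.1 hp).1.pos _
        exact_mod_cast this
      · exact_mod_cast hle
    push_cast at h1
    rw [Real.log_prod, Real.log_pow] at h1
    · simpa [Real.log_pow] using h1
    · intro p hp
      have := (mem_primesBelow'.1 hp).1.pos
      positivity
  have hn0 : (0:ℝ) < n := by exact_mod_cast hn1
  have h2 : ∑ p ∈ primesBelow x, (n:ℝ) / 2 * (Real.log p / p) ≤ n * Real.log n := by
    refine le_trans (Finset.sum_le_sum ?_) hlog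
    intro p hp
    obtain ⟨hp1, hp2⟩ := mem_primesBelow'.1 hp
    have hpn : p ≤ n := (Nat.le_floor_iff' hp1.pos.ne').2 hp2
    have hp0 : (0:ℝ) < p := by exact_mod_cast hp1.pos
    have hq : 1 ≤ n / p := (Nat.one_le_div_iff hp1.pos).2 hpn
    have h3 : n < p * (n / p) + p := by
      have := Nat.lt_mul_div_succ n hp1.pos
      linarith
    have h4 : n ≤ 2 * (p * (n / p)) := by nlinarith
    have h5 : (n:ℝ) ≤ 2 * (p * ((n / p : ℕ):ℝ)) := by exact_mod_cast h4
    have hl : 0 ≤ Real.log p := Real.log_natCast_nonneg p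
    have : (n:ℝ) / 2 / p ≤ ((n / p : ℕ):ℝ) := by
      rw [div_le_iff₀ hp0]; linarith
    calc (n:ℝ) / 2 * (Real.log p / p) = (n:ℝ) / 2 / p * Real.log p := by ring
      _ ≤ _ := by gcongr
  rw [← Finset.mul_sum] at h2
  have h6 : ∑ p ∈ primesBelow x, Real.log p / p ≤ 2 * Real.log n := by
    have : (n:ℝ) / 2 * ∑ p ∈ primesBelow x, Real.log p / p ≤ n / 2 * (2 * Real.log n) := by linarith
    exact le_of_mul_le_mul_left this (by positivity)
  have : Real.log n ≤ Real.log x := Real.log_le_log hn0 (Nat.floor_le (by linarith))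
  linarith

/-- Sum of `1/p` over primes in `(t, x]`. -/
lemma sum_inv_le {t x : ℝ} (ht : 1 < t) (hx : 1 ≤ x) :
    ∑ p ∈ (primesBelow x).filter (fun p : ℕ => t < (p:ℝ)), (1:ℝ) / p ≤ 2 * (Real.log x / Real.log t) := by
  have hlt : 0 < Real.log t := Real.log_pos ht
  have : ∑ p ∈ (primesBelow x).filter (fun p : ℕ => t < (p:ℝ)), (1:ℝ) / p ≤
      ∑ p ∈ (primesBelow x).filter (fun p : ℕ => t < (p:ℝ)), (Real.log p / p) / Real.log t := by
    apply Finset.sum_le_sum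
    intro p hp
    obtain ⟨h1, h2⟩ := Finset.mem_filter.1 hp
    have hp0 : (0:ℝ) < p := by linarith
    have : Real.log t ≤ Real.log p := Real.log_le_log (by linarith) h2.le
    rw [div_div, div_le_div_iff₀ hp0 (by positivity)]
    nlinarith
  refine this.trans ?_
  rw [← Finset.sum_div, div_le_iff₀ hlt]
  have h3 : ∑ p ∈ (primesBelow x).filter (fun p : ℕ => t < (p:ℝ)), Real.log p / p ≤
      ∑ p ∈ primesBelow x, Real.log p / p :=
    Finset.sum_le_sum_of_subset_of_nonneg (Finset.filter_subset _ _)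
      fun p _ _ => div_nonneg (Real.log_natCast_nonneg p) (by positivity)
  have h4 := sum_log_div_le hx
  have : 2 * (Real.log x / Real.log t) * Real.log t = 2 * Real.log x := by field_simp
  linarith

lemma sum_inv_two_pow (k : ℕ) :
    ∑ p ∈ primesBelow ((2:ℝ) ^ (2 ^ k)), (1:ℝ) / p ≤ 1 + 4 * k := by
  induction k with
  | zero =>
    have : primesBelow ((2:ℝ) ^ (2 ^ 0)) = {2} := by
      ext p
      rw [mem_primesBelow', Finset.mem_singleton]
      constructor
      · rintro ⟨h1, h2⟩
        have h3 : p ≤ 2 := by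
          have : (p:ℝ) ≤ (2:ℕ) := by simpa using h2
          exact_mod_cast this
        exact le_antisymm h3 h1.two_le
      · rintro rfl
        exact ⟨Nat.prime_two, by norm_num⟩
    rw [this]; norm_num
  | succ k ih =>
    have h2 : (1:ℝ) < 2 ^ (2 ^ k) := one_lt_pow₀ (by norm_num) (by positivity)
    have h1 := sum_inv_le (t := (2:ℝ) ^ (2 ^ k)) (x := (2:ℝ) ^ (2 ^ (k+1))) h2
      (one_le_pow₀ (by norm_num))
    rw [Real.log_pow, Real.log_pow] at h1
    have h5 : 2 * ((((2 ^ (k+1) : ℕ):ℝ) * Real.log 2) / (((2 ^ k : ℕ):ℝ) * Real.log 2)) = 4 := by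
      have := Real.log_pos (by norm_num : (1:ℝ) < 2)
      push_cast
      rw [pow_succ]; field_simp; norm_num
    rw [h5] at h1
    rw [← Finset.sum_filter_add_sum_filter_not _ (fun p : ℕ => (2:ℝ) ^ (2 ^ k) < (p:ℝ))]
    have h6 : ∑ p ∈ (primesBelow ((2:ℝ) ^ (2 ^ (k+1)))).filter (fun p : ℕ => ¬ (2:ℝ) ^ (2 ^ k) < (p:ℝ)), (1:ℝ) / p
        ≤ ∑ p ∈ primesBelow ((2:ℝ) ^ (2 ^ k)), (1:ℝ) / p := by
      apply Finset.sum_le_sum_of_subset_of_nonneg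
      · intro p hp
        rw [Finset.mem_filter, mem_primesBelow', not_lt] at hp
        exact mem_primesBelow'.2 ⟨hp.1.1, hp.2⟩
      · intros; positivity
    push_cast
    linarith

/-- Mertens second theorem, weak upper bound. -/
lemma sum_inv_loglog {x : ℝ} (hx : 2 ≤ x) :
    ∑ p ∈ primesBelow x, (1:ℝ) / p ≤ 10 + 8 * Real.log (1 + Real.log x) := by
  -- k least with x ≤ 2^(2^k)
  have hl2 := Real.log_two_gt_d9
  have hlx : 0 < Real.log x := Real.log_pos (by linarith)
  set k := ⌈Real.log (1 + Real.log x) / Real.log 2⌉₊ + 1 with hk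
  have hk1 : Real.log (1 + Real.log x) ≤ (k - 1) * Real.log 2 := by
    have := Nat.le_ceil (Real.log (1 + Real.log x) / Real.log 2)
    rw [div_le_iff₀ (by linarith)] at this
    rw [hk]; push_cast; linarith
  have hk2 : (k:ℝ) ≤ Real.log (1 + Real.log x) / Real.log 2 + 2 := by
    have := Nat.ceil_lt_add_one (a := Real.log (1 + Real.log x) / Real.log 2)
      (div_nonneg (Real.log_nonneg (by linarith)) (by linarith))
    rw [hk]; push_cast; linarith
  have hxk : x ≤ (2:ℝ) ^ (2 ^ k) := by
    rw [← Real.log_le_log_iff (by linarith) (by positivity), Real.log_pow]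
    push_cast
    have h1 : 1 + Real.log x ≤ 2 ^ (k-1) := by
      rw [← Real.log_le_log_iff (by linarith) (by positivity), Real.log_pow]
      have : ((k - 1 : ℕ):ℝ) = (k:ℝ) - 1 := by
        rw [Nat.cast_sub (by omega)]; simp
      rw [this]; exact hk1
    have h2 : (2:ℝ) ^ k = 2 * 2 ^ (k-1) := by
      rw [← pow_succ']; congr 1
    rw [h2]
    nlinarith
  have h3 : ∑ p ∈ primesBelow x, (1:ℝ) / p ≤ ∑ p ∈ primesBelow ((2:ℝ) ^ (2 ^ k)), (1:ℝ) / p :=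
    Finset.sum_le_sum_of_subset_of_nonneg (primesBelow_mono hxk) (by intros; positivity)
  have h4 := sum_inv_two_pow k
  have h5 : Real.log (1 + Real.log x) / Real.log 2 ≤ 2 * Real.log (1 + Real.log x) := by
    rw [div_le_iff₀ (by linarith)]
    have : 0 ≤ Real.log (1 + Real.log x) := Real.log_nonneg (by linarith)
    nlinarith
  linarith

lemma exists_sum_rpow_bound : ∃ C : ℝ, 0 < C ∧ ∀ s : Finset ℕ, ∑ p ∈ s, (1:ℝ) / (p:ℝ) ^ (3/2 : ℝ) ≤ C := by
  have hs : Summable (fun n : ℕ => (1:ℝ) / (n:ℝ) ^ (3/2 : ℝ)) := Real.summable_one_div_nat_rpow.2 (by norm_num)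
  refine ⟨1 + ∑' n : ℕ, (1:ℝ) / (n:ℝ) ^ (3/2 : ℝ), ?_, ?_⟩
  · have : 0 ≤ ∑' n : ℕ, (1:ℝ) / (n:ℝ) ^ (3/2 : ℝ) := tsum_nonneg fun n => by positivity
    linarith
  · intro s
    have := hs.sum_le_tsum s (fun n _ => by positivity)
    linarith


lemma rho_eq (Q : Polynomial ℤ) (m : ℕ) :
    rho Q m = ((Finset.range m).filter fun n : ℕ => (m : ℤ) ∣ Q.eval (n : ℤ)).card := by
  unfold rho
  rw [← Finset.card_image_of_injective _ (Nat.cast_injective (R := ℤ))]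
  congr 1
  ext n
  simp only [Finset.bind_def, Finset.mem_filter, Finset.mem_image, Finset.mem_range,
    Finset.pure_def, Finset.mem_sup, Finset.mem_singleton]
  constructor
  · rintro ⟨⟨a, ha, rfl⟩, h⟩
    exact ⟨a, ⟨ha, h⟩, rfl⟩
  · rintro ⟨a, ⟨ha, h⟩, rfl⟩
    exact ⟨⟨a, ha, rfl⟩, h⟩

open Polynomial in
lemma clear_denoms (U : ℚ[X]) : ∃ (d : ℤ) (P : ℤ[X]), d ≠ 0 ∧ P.map (Int.castRingHom ℚ) = C (d:ℚ) * U := by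
  obtain ⟨b, hbm, hb⟩ := IsLocalization.integerNormalization_spec (nonZeroDivisors ℤ) U
  refine ⟨b, IsLocalization.integerNormalization (nonZeroDivisors ℤ) U, nonZeroDivisors.ne_zero hbm, ?_⟩
  have h : (Int.castRingHom ℚ) = algebraMap ℤ ℚ := rfl
  rw [h, hb]
  ext n
  simp

open Polynomial in
lemma bezout_int {A B : ℤ[X]} (h : IsCoprime (A.map (Int.castRingHom ℚ)) (B.map (Int.castRingHom ℚ))) :
    ∃ D : ℤ, D ≠ 0 ∧ ∃ U W : ℤ[X], ∀ n : ℤ, U.eval n * A.eval n + W.eval n * B.eval n = D := by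
  obtain ⟨u, w, huw⟩ := h
  obtain ⟨d, P, hd, hP⟩ := clear_denoms u
  obtain ⟨e, R, he, hR⟩ := clear_denoms w
  refine ⟨d * e, mul_ne_zero hd he, C e * P, C d * R, ?_⟩
  have key : (C e * P) * A + (C d * R) * B = C (d * e) := by
    apply Polynomial.map_injective (Int.castRingHom ℚ) Int.cast_injective
    simp only [Polynomial.map_add, Polynomial.map_mul, hP, hR, Polynomial.map_C]
    simp only [eq_intCast, Int.cast_mul, C_mul]
    linear_combination (C (d:ℚ) * C (e:ℚ)) * huw
  intro n
  have := congrArg (Polynomial.eval n) key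
  simpa using this

lemma prime_pow_dvd_of_mul {p : ℕ} (hp : p.Prime) {e ν : ℕ} {h u : ℤ}
    (hd : ((p ^ ν : ℕ) : ℤ) ∣ h * u) (hu : ¬ ((p ^ (e+1) : ℕ) : ℤ) ∣ u) :
    ((p ^ (ν - e) : ℕ) : ℤ) ∣ h := by
  rw [Int.natCast_dvd] at *
  rw [Int.natAbs_mul] at hd
  obtain ⟨d1, d2, h1, h2, h12⟩ := exists_dvd_and_dvd_of_dvd_mul hd
  obtain ⟨k1, hk1, rfl⟩ := (Nat.dvd_prime_pow hp).1 (Dvd.intro _ h12.symm)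
  obtain ⟨k2, hk2, rfl⟩ := (Nat.dvd_prime_pow hp).1 (Dvd.intro_left _ h12.symm)
  rw [← pow_add] at h12
  have h3 : ν = k1 + k2 := Nat.pow_right_injective hp.two_le h12
  have h4 : k2 ≤ e := by
    by_contra hcon
    exact hu ((pow_dvd_pow p (by omega)).trans h2)
  exact (pow_dvd_pow p (by omega)).trans h1

open Polynomial in
lemma rho_hensel {Q U W : ℤ[X]} {D : ℤ} (hD : D ≠ 0)
    (hUW : ∀ n : ℤ, U.eval n * Q.eval n + W.eval n * (derivative Q).eval n = D)
    {p : ℕ} (hp : p.Prime) (ν : ℕ) :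
    rho Q (p ^ ν) ≤ max 1 (rho Q p) + D.natAbs ^ 3 := by
  set e := padicValInt p D with he
  have := Fact.mk hp
  have hpe : ¬ ((p ^ (e+1) : ℕ) : ℤ) ∣ D := by
    push_cast
    rw [padicValInt_dvd_iff]
    simp [hD, he]
  have hped : ((p ^ e : ℕ) : ℤ) ∣ D := by
    push_cast
    rw [padicValInt_dvd_iff]
    right; rfl
  have hple : p ^ e ≤ D.natAbs := Nat.le_of_dvd (Int.natAbs_pos.2 hD) (Int.natCast_dvd.1 hped)
  rcases Nat.lt_or_ge e ν with hν | hν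
  · -- main case
    have key : ∀ a b : ℕ, ((p ^ ν : ℕ):ℤ) ∣ Q.eval (a:ℤ) → ((p ^ ν : ℕ):ℤ) ∣ Q.eval (b:ℤ) →
        a % p ^ (e+1) = b % p ^ (e+1) → ((p ^ (ν - e) : ℕ) : ℤ) ∣ (b:ℤ) - a := by
      intro a b ha hb hab
      obtain ⟨k, hk⟩ := Q.binomExpansion (a:ℤ) ((b:ℤ) - a)
      have h1 : ((p ^ (e+1) : ℕ) : ℤ) ∣ (b:ℤ) - a := (Nat.modEq_iff_dvd).1 hab
      have h2 : ¬ ((p ^ (e+1) : ℕ) : ℤ) ∣ (derivative Q).eval (a:ℤ) + k * ((b:ℤ) - a) := by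
        intro hcon
        have h3 : ((p ^ (e+1) : ℕ) : ℤ) ∣ (derivative Q).eval (a:ℤ) := by
          rwa [dvd_add_left (Dvd.dvd.mul_left h1 k)] at hcon
        apply hpe
        rw [← hUW a]
        refine dvd_add (Dvd.dvd.mul_left ?_ _) (Dvd.dvd.mul_left h3 _)
        refine dvd_trans ?_ ha
        exact_mod_cast pow_dvd_pow p hν
      refine prime_pow_dvd_of_mul hp (u := (derivative Q).eval (a:ℤ) + k * ((b:ℤ) - a)) ?_ h2
      have h4 : ((b:ℤ) - a) * ((derivative Q).eval (a:ℤ) + k * ((b:ℤ) - a)) = Q.eval (b:ℤ) - Q.eval (a:ℤ) := by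
        rw [add_sub_cancel] at hk
        rw [hk]; ring
      rw [h4]
      exact dvd_sub hb ha
    rcases Nat.eq_zero_or_pos e with he0 | he0
    · have : rho Q (p ^ ν) ≤ rho Q p := by
        rw [rho_eq]
        try rw [rho_eq]
        apply Finset.card_le_card_of_injOn (fun n => n % p)
        · intro n hn
          simp only [Finset.coe_filter, Finset.mem_range, Set.mem_ofPred_eq] at hn ⊢
          refine ⟨Nat.mod_lt _ hp.pos, ?_⟩
          have h1 : (p:ℤ) ∣ Q.eval (n:ℤ) := dvd_trans (by exact_mod_cast dvd_pow_self p (by omega)) hn.2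
          have h2 : (p:ℤ) ∣ (n:ℤ) - ((n % p : ℕ) : ℤ) := by
            rw [← Nat.modEq_iff_dvd]; exact Nat.mod_modEq n p
          have h3 : (p:ℤ) ∣ Q.eval (n:ℤ) - Q.eval ((n % p : ℕ):ℤ) := h2.trans (Polynomial.sub_dvd_eval_sub _ _ _)
          exact (dvd_sub_right h1).1 h3
        · intro a ha b hb hab
          simp only [Finset.coe_filter, Finset.mem_range, Set.mem_ofPred_eq] at ha hb
          have := key a b ha.2 hb.2 (by simpa [he0] using hab)
          rw [he0, Nat.sub_zero, ← Nat.modEq_iff_dvd] at this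
          unfold Nat.ModEq at this
          rwa [Nat.mod_eq_of_lt ha.1, Nat.mod_eq_of_lt hb.1] at this
      have := le_max_right 1 (rho Q p)
      omega
    · have h1 : rho Q (p ^ ν) ≤ (Finset.range (p ^ (e+1)) ×ˢ Finset.range (p ^ e)).card := by
        rw [rho_eq]
        try rw [rho_eq]
        apply Finset.card_le_card_of_injOn (fun n => (n % p ^ (e+1), n / p ^ (ν - e)))
        · intro n hn
          simp only [Finset.coe_filter, Finset.mem_range, Set.mem_ofPred_eq] at hn
          simp only [Finset.coe_product, Set.mem_prod, Finset.mem_coe, Finset.mem_range]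
          refine ⟨Nat.mod_lt _ (pow_pos hp.pos _), ?_⟩
          rw [Nat.div_lt_iff_lt_mul (pow_pos hp.pos _), ← pow_add]
          rw [show e + (ν - e) = ν by omega]; exact hn.1
        · intro a ha b hb hab
          simp only [Finset.coe_filter, Finset.mem_range, Set.mem_ofPred_eq] at ha hb
          simp only [Prod.mk.injEq] at hab
          have := key a b ha.2 hb.2 hab.1
          rw [← Nat.modEq_iff_dvd] at this
          unfold Nat.ModEq at this
          rw [← Nat.div_add_mod a (p ^ (ν - e)), ← Nat.div_add_mod b (p ^ (ν - e)), this, hab.2]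
      rw [Finset.card_product, Finset.card_range, Finset.card_range] at h1
      have h2 : p ≤ p ^ e := Nat.le_self_pow he0.ne' p
      have h3 : p ^ (e+1) * p ^ e ≤ D.natAbs ^ 3 := by
        calc p ^ (e+1) * p ^ e = p ^ e * p * p ^ e := by ring
          _ ≤ D.natAbs * D.natAbs * D.natAbs := by gcongr; exact h2.trans hple
          _ = _ := by ring
      omega
  · have h1 : rho Q (p ^ ν) ≤ p ^ ν := by
      rw [rho_eq]
      exact (Finset.card_filter_le _ _).trans (by simp)
    have h2 : p ^ ν ≤ p ^ e := Nat.pow_le_pow_right hp.pos hν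
    have h3 : D.natAbs ≤ D.natAbs ^ 3 := Nat.le_self_pow (by norm_num) _
    omega

open Polynomial in
lemma rho_prime_le {Q : ℤ[X]} (hQ : Q.IsPrimitive) {p : ℕ} (hp : p.Prime) : rho Q p ≤ Q.natDegree := by
  have := Fact.mk hp
  have hne : Q.map (Int.castRingHom (ZMod p)) ≠ 0 := by
    intro h0
    have h1 : C (p:ℤ) ∣ Q := by
      rw [Polynomial.C_dvd_iff_dvd_coeff]
      intro i
      have := congrArg (fun P => P.coeff i) h0
      simp only [coeff_map, eq_intCast, coeff_zero] at this
      exact (ZMod.intCast_zmod_eq_zero_iff_dvd _ _).1 this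
    have h2 := hQ _ h1
    exact hp.one_lt.ne' (by simpa [Int.isUnit_iff_natAbs_eq] using h2)
  calc rho Q p ≤ (Q.map (Int.castRingHom (ZMod p))).roots.toFinset.card := by
        rw [rho_eq]
        try rw [rho_eq]
        apply Finset.card_le_card_of_injOn (fun n : ℕ => (n : ZMod p))
        · intro n hn
          simp only [Finset.coe_filter, Finset.mem_range, Set.mem_ofPred_eq] at hn
          simp only [Finset.mem_coe, Multiset.mem_toFinset, mem_roots hne, IsRoot.def]
          have h1 : ((Q.eval (n:ℤ) : ℤ) : ZMod p) = 0 := (ZMod.intCast_zmod_eq_zero_iff_dvd _ _).2 hn.2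
          have h2 := Polynomial.eval_intCast_map (Int.castRingHom (ZMod p)) Q (n:ℤ)
          simp only [Int.cast_natCast, eq_intCast] at h2
          rw [h2, h1]
        · intro a ha b hb hab
          simp only [Finset.coe_filter, Finset.mem_range, Set.mem_ofPred_eq] at ha hb
          have := (ZMod.natCast_eq_natCast_iff' _ _ _).1 hab
          rwa [Nat.mod_eq_of_lt ha.1, Nat.mod_eq_of_lt hb.1] at this
    _ ≤ Multiset.card (Q.map (Int.castRingHom (ZMod p))).roots := Multiset.toFinset_card_le _
    _ ≤ (Q.map (Int.castRingHom (ZMod p))).natDegree := card_roots' _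
    _ ≤ _ := natDegree_map_le

open Polynomial in
lemma poly_data (r : ℕ) (Qs : Fin r → ℤ[X])
    (hirr : ∀ j, Irreducible (Qs j))
    (hcop : ∀ i j, i ≠ j → IsRelPrime (Qs i) (Qs j))
    (hnofix : ∀ p : ℕ, p.Prime → rho (∏ j, Qs j) p < p) :
    ∃ K P0 : ℕ, 1 ≤ K ∧
      (∀ j p ν, p.Prime → rho (Qs j) (p ^ ν) ≤ K) ∧
      (∀ p : ℕ, p.Prime → P0 < p → ∀ i j, i ≠ j → ∀ n : ℤ, (p:ℤ) ∣ (Qs i).eval n → ¬ (p:ℤ) ∣ (Qs j).eval n) ∧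
      (∀ j, ∀ c : ℤ, ∀ s : Finset ℤ, (∀ n ∈ s, (Qs j).eval n = c) → s.card ≤ K) ∧
      (∀ j, ∀ n : ℤ, 1 ≤ n → |(Qs j).eval n| ≤ K * n ^ K) := by
  have hdeg : ∀ j, (Qs j).natDegree ≠ 0 := by
    intro j h0
    obtain ⟨c, hc⟩ := natDegree_eq_zero.1 h0
    have hci : Irreducible (C c) := hc ▸ hirr j
    have hcp : Prime (C c) := hci.prime
    rw [prime_C_iff] at hcp
    have hp := Int.prime_iff_natAbs_prime.1 hcp
    have := hnofix _ hp
    rw [rho_eq] at this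
    rw [Finset.filter_true_of_mem, Finset.card_range] at this
    · exact lt_irrefl _ this
    · intro n _
      rw [eval_prod]
      refine dvd_trans ?_ (Finset.dvd_prod_of_mem _ (Finset.mem_univ j))
      rw [← hc, eval_C]
      simp
  have hprim : ∀ j, (Qs j).IsPrimitive := fun j => (hirr j).isPrimitive (hdeg j)
  have hirrQ : ∀ j, Irreducible ((Qs j).map (Int.castRingHom ℚ)) := fun j =>
    (IsPrimitive.Int.irreducible_iff_irreducible_map_cast (hprim j)).1 (hirr j)
  have h1 : ∀ j, ∃ K : ℕ, ∀ p ν, p.Prime → rho (Qs j) (p ^ ν) ≤ K := by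
    intro j
    have hsep := (hirrQ j).separable
    unfold Polynomial.Separable at hsep
    rw [derivative_map] at hsep
    obtain ⟨D, hD, U, W, hUW⟩ := bezout_int hsep
    refine ⟨max 1 (Qs j).natDegree + D.natAbs ^ 3, fun p ν hp => ?_⟩
    have := rho_hensel hD hUW hp ν
    have h2 := rho_prime_le (hprim j) hp
    have h3 := max_le_max (le_refl 1) h2
    omega
  choose K1 hK1 using h1
  have h2 : ∀ i j, ∃ P : ℕ, i ≠ j → ∀ p : ℕ, p.Prime → P < p → ∀ n : ℤ, (p:ℤ) ∣ (Qs i).eval n → ¬ (p:ℤ) ∣ (Qs j).eval n := by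
    intro i j
    by_cases hij : i = j
    · exact ⟨0, fun h => absurd hij h⟩
    have hc : IsCoprime ((Qs i).map (Int.castRingHom ℚ)) ((Qs j).map (Int.castRingHom ℚ)) := by
      rw [(hirrQ i).coprime_iff_not_dvd]
      intro hd
      have := (IsPrimitive.Int.dvd_iff_map_cast_dvd_map_cast _ _ (hprim i)).2 hd
      exact (hirr i).not_isUnit (hcop i j hij (dvd_refl _) this)
    obtain ⟨D, hD, U, W, hUW⟩ := bezout_int hc
    refine ⟨D.natAbs, fun _ p hp hpD n hi hj => ?_⟩
    have : (p:ℤ) ∣ D := by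
      rw [← hUW n]
      exact dvd_add (Dvd.dvd.mul_left hi _) (Dvd.dvd.mul_left hj _)
    have := Nat.le_of_dvd (Int.natAbs_pos.2 hD) (Int.natCast_dvd.1 this)
    omega
  choose P1 hP1 using h2
  have h3 : ∀ j, ∃ B : ℕ, ∀ n : ℤ, 1 ≤ n → |(Qs j).eval n| ≤ B * n ^ (Qs j).natDegree := by
    intro j
    refine ⟨∑ i ∈ Finset.range ((Qs j).natDegree + 1), ((Qs j).coeff i).natAbs, fun n hn => ?_⟩
    rw [eval_eq_sum_range]
    refine (Finset.abs_sum_le_sum_abs _ _).trans ?_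
    push_cast
    rw [Finset.sum_mul]
    apply Finset.sum_le_sum
    intro i hi
    rw [abs_mul, abs_pow, abs_of_pos (by omega : 0 < n)]
    gcongr
    · have := Finset.mem_range.1 hi; omega
  choose B hB using h3
  set K := 1 + ∑ j, (K1 j + (Qs j).natDegree + B j) with hK
  have hle : ∀ j, K1 j + (Qs j).natDegree + B j ≤ K := by
    intro j
    have := Finset.single_le_sum (f := fun j => K1 j + (Qs j).natDegree + B j) (fun _ _ => Nat.zero_le _) (Finset.mem_univ j)
    omega
  refine ⟨K, ∑ i, ∑ j, P1 i j, by omega, ?_, ?_, ?_, ?_⟩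
  · intro j p ν hp
    exact (hK1 j p ν hp).trans (by have := hle j; omega)
  · intro p hp hP i j hij n
    refine hP1 i j hij p hp (lt_of_le_of_lt ?_ hP) n
    calc P1 i j ≤ ∑ j, P1 i j := Finset.single_le_sum (f := fun j => P1 i j) (fun _ _ => Nat.zero_le _) (Finset.mem_univ j)
      _ ≤ _ := Finset.single_le_sum (f := fun i => ∑ j, P1 i j) (fun _ _ => Nat.zero_le _) (Finset.mem_univ i)
  · intro j c s hs
    have hne : Qs j - C c ≠ 0 := by
      intro h0
      have : Qs j = C c := sub_eq_zero.1 h0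
      exact hdeg j (by rw [this]; simp)
    have hsub : s ⊆ (Qs j - C c).roots.toFinset := by
      intro n hn
      rw [Multiset.mem_toFinset, mem_roots hne, IsRoot.def]
      simp [hs n hn]
    calc s.card ≤ _ := Finset.card_le_card hsub
      _ ≤ Multiset.card (Qs j - C c).roots := Multiset.toFinset_card_le _
      _ ≤ (Qs j - C c).natDegree := card_roots' _
      _ = (Qs j).natDegree := natDegree_sub_C
      _ ≤ K := by have := hle j; omega
  · intro j n hn
    refine (hB j n hn).trans ?_
    have := hle j
    gcongr
    · exact_mod_cast (by omega : B j ≤ K)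
    · omega


/-- `P` is periodic modulo `m`. -/
def Per (P : ℤ → Prop) (m : ℕ) : Prop := ∀ a b : ℤ, (m:ℤ) ∣ a - b → P a → P b

/-- number of residues mod `m` satisfying `P`. -/
noncomputable def cnt (P : ℤ → Prop) (m : ℕ) : ℕ := ((Finset.range m).filter fun n : ℕ => P (n:ℤ)).card

/-- integers in `(x, x+y]` -/
noncomputable def Iv (x y : ℝ) : Finset ℤ := Finset.Ioc ⌊x⌋ ⌊x + y⌋

lemma mem_Iv {x y : ℝ} {n : ℤ} : n ∈ Iv x y ↔ x < n ∧ (n:ℝ) ≤ x + y := by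
  unfold Iv
  rw [Finset.mem_Ioc, Int.floor_lt, Int.le_floor]

lemma card_Iv {x y : ℝ} (hy : 0 ≤ y) : |((Iv x y).card : ℝ) - y| ≤ 1 := by
  unfold Iv
  rw [Int.card_Ioc]
  have h1 : ⌊x⌋ ≤ ⌊x+y⌋ := Int.floor_le_floor (by linarith)
  have h2 : (((⌊x+y⌋ - ⌊x⌋).toNat : ℕ) : ℝ) = (⌊x+y⌋:ℝ) - ⌊x⌋ := by
    have : (((⌊x+y⌋ - ⌊x⌋).toNat : ℤ)) = ⌊x+y⌋ - ⌊x⌋ := Int.toNat_of_nonneg (by omega)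
    exact_mod_cast this
  rw [h2, abs_le]
  have a1 := Int.floor_le x
  have a2 := Int.lt_floor_add_one x
  have b1 := Int.floor_le (x+y)
  have b2 := Int.lt_floor_add_one (x+y)
  constructor <;> linarith

lemma Per.mono {P : ℤ → Prop} {m m' : ℕ} (h : Per P m) (hd : m ∣ m') : Per P m' :=
  fun a b hab => h a b (dvd_trans (by exact_mod_cast hd) hab)

lemma crt_two {P P' : ℤ → Prop} {m m' : ℕ} (hP : Per P m) (hP' : Per P' m') (hc : Nat.Coprime m m')
    (hm : 0 < m) (hm' : 0 < m') :
    cnt (fun n => P n ∧ P' n) (m * m') = cnt P m * cnt P' m' := by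
  unfold cnt
  rw [← Finset.card_product]
  apply Finset.card_nbij (fun n => (n % m, n % m'))
  · intro n hn
    simp only [Finset.mem_coe, Finset.mem_filter, Finset.mem_range] at hn
    simp only [Finset.mem_coe, Finset.mem_product, Finset.mem_filter, Finset.mem_range]
    refine ⟨⟨Nat.mod_lt _ hm, hP n _ ?_ hn.2.1⟩, ⟨Nat.mod_lt _ hm', hP' n _ ?_ hn.2.2⟩⟩
    · rw [← Nat.modEq_iff_dvd]; exact Nat.mod_modEq _ _
    · rw [← Nat.modEq_iff_dvd]; exact Nat.mod_modEq _ _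
  · intro a ha b hb hab
    simp only [Finset.coe_filter, Finset.mem_range, Set.mem_ofPred_eq] at ha hb
    simp only [Prod.mk.injEq] at hab
    have h1 : a ≡ b [MOD m * m'] := (Nat.modEq_and_modEq_iff_modEq_mul hc).1 ⟨hab.1, hab.2⟩
    unfold Nat.ModEq at h1
    rwa [Nat.mod_eq_of_lt ha.1, Nat.mod_eq_of_lt hb.1] at h1
  · rintro ⟨a, b⟩ hab
    simp only [Finset.coe_product, Set.mem_prod, Finset.coe_filter, Finset.mem_range, Set.mem_ofPred_eq] at hab
    obtain ⟨⟨ha, hPa⟩, hb, hPb⟩ := hab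
    set k := Nat.chineseRemainder hc a b with hk
    have hk1 := k.2.1
    have hk2 := k.2.2
    have hlt := Nat.chineseRemainder_lt_mul hc a b hm.ne' hm'.ne'
    refine ⟨k, ?_, ?_⟩
    · simp only [Finset.coe_filter, Finset.mem_range, Set.mem_ofPred_eq]
      refine ⟨hlt, hP a _ ?_ hPa, hP' b _ ?_ hPb⟩
      · exact Nat.modEq_iff_dvd.1 hk1
      · exact Nat.modEq_iff_dvd.1 hk2
    · simp only [Prod.mk.injEq]
      unfold Nat.ModEq at hk1 hk2
      rw [hk1, hk2, Nat.mod_eq_of_lt ha, Nat.mod_eq_of_lt hb]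
      exact ⟨rfl, rfl⟩

lemma crt_prod {ι : Type*} (S : Finset ι) (P : ι → ℤ → Prop) (m : ι → ℕ)
    (hper : ∀ i ∈ S, Per (P i) (m i)) (hpos : ∀ i ∈ S, 0 < m i)
    (hc : ∀ i ∈ S, ∀ j ∈ S, i ≠ j → Nat.Coprime (m i) (m j)) :
    Per (fun n => ∀ i ∈ S, P i n) (∏ i ∈ S, m i) ∧
    cnt (fun n => ∀ i ∈ S, P i n) (∏ i ∈ S, m i) = ∏ i ∈ S, cnt (P i) (m i) := by
  induction S using Finset.induction_on with
  | empty => simp [cnt, Per]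
  | insert a s ha ih =>
    obtain ⟨ih1, ih2⟩ := ih (fun i hi => hper i (Finset.mem_insert_of_mem hi))
      (fun i hi => hpos i (Finset.mem_insert_of_mem hi))
      (fun i hi j hj => hc i (Finset.mem_insert_of_mem hi) j (Finset.mem_insert_of_mem hj))
    simp only [Finset.forall_mem_insert, Finset.prod_insert ha]
    have hpa := hper a (Finset.mem_insert_self _ _)
    refine ⟨fun x y hxy h => ⟨hpa.mono (Dvd.intro _ rfl) x y hxy h.1, ih1.mono (Dvd.intro_left _ rfl) x y hxy h.2⟩, ?_⟩
    rw [← ih2]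
    apply crt_two hpa ih1
    · apply Nat.Coprime.prod_right
      intro i hi
      exact hc a (Finset.mem_insert_self _ _) i (Finset.mem_insert_of_mem hi) (fun h => ha (h ▸ hi))
    · exact hpos a (Finset.mem_insert_self _ _)
    · exact Finset.prod_pos fun i hi => hpos i (Finset.mem_insert_of_mem hi)

/-- integers of an interval in a residue class, with another condition -/
lemma card_class (x y : ℝ) (M : ℕ) (hM : 0 < M) (c : ℕ) (R : ℤ → Prop) :
    ((Iv x y).filter (fun n => (M:ℤ) ∣ n - c ∧ R n)).card =
    ((Iv ((x - c) / M) (y / M)).filter (fun m => R (c + M * m))).card := by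
  have hM' : (0:ℝ) < M := by exact_mod_cast hM
  symm
  apply Finset.card_nbij (fun m : ℤ => (c:ℤ) + M * m)
  · intro m hm
    simp only [Finset.mem_coe, Finset.mem_filter, mem_Iv] at *
    obtain ⟨⟨h1, h2⟩, h3⟩ := hm
    rw [div_lt_iff₀ hM'] at h1
    rw [← add_div, le_div_iff₀ hM'] at h2
    push_cast
    refine ⟨⟨by linarith, by linarith⟩, by simp, h3⟩
  · intro a _ b _ hab
    simpa [hM.ne'] using hab
  · intro n hn
    simp only [Finset.mem_coe, Finset.mem_filter, mem_Iv] at hn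
    obtain ⟨⟨h1, h2⟩, ⟨k, hk⟩, h4⟩ := hn
    have hn : n = c + M * k := by linarith
    subst hn
    push_cast at h1 h2
    refine ⟨k, ?_, rfl⟩
    simp only [Finset.mem_coe, Finset.mem_filter, mem_Iv]
    rw [div_lt_iff₀ hM', ← add_div, le_div_iff₀ hM']
    exact ⟨⟨by linarith, by linarith⟩, h4⟩

lemma card_split (x y : ℝ) (M : ℕ) (hM : 0 < M) (P : ℤ → Prop) (hP : Per P M) (R : ℤ → Prop) :
    ((Iv x y).filter (fun n => P n ∧ R n)).card =
    ∑ c ∈ (Finset.range M).filter (fun n : ℕ => P (n:ℤ)), ((Iv ((x - c) / M) (y / M)).filter (fun m => R (c + M * m))).card := by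
  have hM' : (M:ℤ) ≠ 0 := by exact_mod_cast hM.ne'
  have hdv : ∀ n : ℤ, (M:ℤ) ∣ n - ((n % M).toNat : ℕ) := by
    intro n
    rw [Int.toNat_of_nonneg (Int.emod_nonneg _ hM')]
    exact Int.dvd_self_sub_emod
  rw [Finset.card_eq_sum_card_fiberwise (f := fun n : ℤ => (n % M).toNat)
    (t := (Finset.range M).filter (fun n : ℕ => P (n:ℤ)))]
  · apply Finset.sum_congr rfl
    intro c hc
    rw [← card_class x y M hM c R, Finset.filter_filter]
    congr 1
    apply Finset.filter_congr
    intro n _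
    rw [Finset.mem_filter, Finset.mem_range] at hc
    constructor
    · rintro ⟨⟨h1, h2⟩, h3⟩
      refine ⟨?_, h2⟩
      rw [← h3]; exact hdv n
    · rintro ⟨h1, h2⟩
      refine ⟨⟨hP c n ?_ hc.2, h2⟩, ?_⟩
      · rw [← dvd_neg, neg_sub]; exact h1
      · have : n % M = (c:ℤ) % M := Int.emod_eq_emod_iff_emod_sub_eq_zero.2 (Int.emod_eq_zero_of_dvd h1)
        rw [this, Int.emod_eq_of_lt (by positivity) (by exact_mod_cast hc.1)]
        simp
  · intro n hn
    simp only [Finset.mem_coe, Finset.mem_filter] at hn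
    simp only [Finset.mem_coe, Finset.mem_filter, Finset.mem_range]
    refine ⟨?_, hP n _ (hdv n) hn.2.1⟩
    have h1 := Int.emod_nonneg n hM'
    have h2 := Int.emod_lt_of_pos n (by positivity : (0:ℤ) < M)
    omega

lemma card_per (x : ℝ) {y : ℝ} (hy : 0 ≤ y) (M : ℕ) (hM : 0 < M) (P : ℤ → Prop) (hP : Per P M) :
    |(((Iv x y).filter P).card : ℝ) - y * (cnt P M / M)| ≤ cnt P M := by
  have h := card_split x y M hM P hP (fun _ => True)
  simp only [and_true, Finset.filter_true] at h
  rw [h]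
  push_cast
  have h2 : y * ((cnt P M : ℝ) / M) = ∑ c ∈ (Finset.range M).filter (fun n : ℕ => P (n:ℤ)), y / M := by
    rw [Finset.sum_const, nsmul_eq_mul]; unfold cnt; ring
  rw [h2, ← Finset.sum_sub_distrib]
  refine (Finset.abs_sum_le_sum_abs _ _).trans ?_
  refine (Finset.sum_le_sum (fun c _ => card_Iv (by positivity))).trans ?_
  simp [cnt]


/-- truncated subset sum -/
noncomputable def TS (k : ℕ) (B : Finset ℕ) (w : ℕ → ℝ) : ℝ :=
  ∑ S ∈ B.powerset, (if S.card ≤ k then ∏ p ∈ S, w p else 0)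

/-- elementary symmetric sum -/
noncomputable def ES (k : ℕ) (B : Finset ℕ) (w : ℕ → ℝ) : ℝ :=
  ∑ S ∈ B.powerset, (if S.card = k then ∏ p ∈ S, w p else 0)

lemma TS_zero (B : Finset ℕ) (w : ℕ → ℝ) : TS 0 B w = 1 := by
  unfold TS
  rw [Finset.sum_eq_single ∅]
  · simp
  · intro S _ hS
    rw [if_neg]
    simpa using hS
  · simp

lemma TS_insert (k : ℕ) (B : Finset ℕ) (w : ℕ → ℝ) (p : ℕ) (hp : p ∉ B) :
    TS (k+1) (insert p B) w = TS (k+1) B w + w p * TS k B w := by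
  unfold TS
  rw [Finset.sum_powerset_insert hp, Finset.mul_sum]
  congr 1
  apply Finset.sum_congr rfl
  intro S hS
  have hpS : p ∉ S := fun h => hp (Finset.mem_powerset.1 hS h)
  rw [Finset.card_insert_of_notMem hpS, Finset.prod_insert hpS]
  simp only [Nat.add_le_add_iff_right]
  split_ifs <;> simp

lemma ES_insert (k : ℕ) (B : Finset ℕ) (w : ℕ → ℝ) (p : ℕ) (hp : p ∉ B) :
    ES (k+1) (insert p B) w = ES (k+1) B w + w p * ES k B w := by
  unfold ES
  rw [Finset.sum_powerset_insert hp, Finset.mul_sum]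
  congr 1
  apply Finset.sum_congr rfl
  intro S hS
  have hpS : p ∉ S := fun h => hp (Finset.mem_powerset.1 hS h)
  rw [Finset.card_insert_of_notMem hpS, Finset.prod_insert hpS]
  simp only [Nat.add_right_cancel_iff]
  split_ifs <;> simp

lemma ES_nonneg (k : ℕ) (B : Finset ℕ) (w : ℕ → ℝ) (h0 : ∀ p ∈ B, 0 ≤ w p) : 0 ≤ ES k B w := by
  unfold ES
  apply Finset.sum_nonneg
  intro S hS
  split_ifs
  · exact Finset.prod_nonneg fun p hp => h0 p (Finset.mem_powerset.1 hS hp)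
  · exact le_rfl

lemma bonferroni (B : Finset ℕ) (w : ℕ → ℝ) (h0 : ∀ p ∈ B, 0 ≤ w p) (h1 : ∀ p ∈ B, w p ≤ 1) :
    ∀ k, 0 ≤ (-1:ℝ)^k * (TS k B (fun p => - w p) - ∏ p ∈ B, (1 - w p)) ∧
      (-1:ℝ)^k * (TS k B (fun p => - w p) - ∏ p ∈ B, (1 - w p)) ≤ ES (k+1) B w := by
  induction B using Finset.induction_on with
  | empty =>
    intro k
    simp [TS, ES]
  | insert p B hp ih =>
    have ih := ih (fun q hq => h0 q (Finset.mem_insert_of_mem hq)) (fun q hq => h1 q (Finset.mem_insert_of_mem hq))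
    have hp0 := h0 p (Finset.mem_insert_self _ _)
    have hp1 := h1 p (Finset.mem_insert_self _ _)
    intro k
    rw [Finset.prod_insert hp, ES_insert _ _ _ _ hp]
    cases k with
    | zero =>
      rw [TS_zero]
      have h := ih 0
      rw [TS_zero] at h
      simp only [pow_zero, one_mul] at h ⊢
      have hE0 : ES 0 B w = 1 := by
        have : ES 0 B w = TS 0 B w := by unfold ES TS; simp
        rw [this, TS_zero]
      rw [hE0]
      have hP0 : 0 ≤ ∏ p ∈ B, (1 - w p) := Finset.prod_nonneg fun q hq => by
        have := h1 q (Finset.mem_insert_of_mem hq); linarith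
      have hP1 : ∏ p ∈ B, (1 - w p) ≤ 1 := by linarith [h.1]
      constructor <;> nlinarith [h.1, h.2]
    | succ k =>
      rw [TS_insert _ _ _ _ hp]
      have ha := ih k
      have hb := ih (k+1)
      have e : (-1:ℝ)^(k+1) * (TS (k+1) B (fun p => - w p) + -w p * TS k B (fun p => - w p) - (1 - w p) * ∏ p ∈ B, (1 - w p))
        = (-1:ℝ)^(k+1) * (TS (k+1) B (fun p => - w p) - ∏ p ∈ B, (1 - w p)) +
          w p * ((-1:ℝ)^k * (TS k B (fun p => - w p) - ∏ p ∈ B, (1 - w p))) := by ring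
      rw [e]
      refine ⟨add_nonneg hb.1 (mul_nonneg hp0 ha.1), add_le_add hb.2 (mul_le_mul_of_nonneg_left ha.2 hp0)⟩

lemma prod_one_add_le_exp (B : Finset ℕ) (w : ℕ → ℝ) (h0 : ∀ p ∈ B, 0 ≤ w p) :
    ∏ p ∈ B, (1 + w p) ≤ Real.exp (∑ p ∈ B, w p) := by
  rw [Real.exp_sum]
  apply Finset.prod_le_prod
  · intro p hp; linarith [h0 p hp]
  · intro p hp; linarith [Real.add_one_le_exp (w p)]

lemma ES_le (k : ℕ) (B : Finset ℕ) (w : ℕ → ℝ) (h0 : ∀ p ∈ B, 0 ≤ w p) :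
    ES k B w ≤ (1/2)^k * Real.exp (2 * ∑ p ∈ B, w p) := by
  have h : ES k B w ≤ (1/2)^k * ∏ p ∈ B, (1 + 2 * w p) := by
    rw [Finset.prod_one_add, Finset.mul_sum]
    unfold ES
    apply Finset.sum_le_sum
    intro S hS
    have hn : 0 ≤ ∏ p ∈ S, w p := Finset.prod_nonneg fun p hp => h0 p (Finset.mem_powerset.1 hS hp)
    rw [Finset.prod_mul_distrib, Finset.prod_const]
    split_ifs with h
    · rw [h, ← mul_assoc, ← mul_pow]; norm_num
    · positivity
  refine h.trans ?_
  rw [Finset.mul_sum]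
  gcongr
  apply prod_one_add_le_exp
  intro p hp
  linarith [h0 p hp]

lemma TS_le (k : ℕ) (B : Finset ℕ) (w : ℕ → ℝ) (h0 : ∀ p ∈ B, 0 ≤ w p) (l : ℝ) (hl : 1 ≤ l) :
    TS k B w ≤ l^k * Real.exp (∑ p ∈ B, w p / l) := by
  have hl0 : 0 < l := by linarith
  have h : TS k B w ≤ l^k * ∏ p ∈ B, (1 + w p / l) := by
    rw [Finset.prod_one_add, Finset.mul_sum]
    unfold TS
    apply Finset.sum_le_sum
    intro S hS
    have hn : 0 ≤ ∏ p ∈ S, w p := Finset.prod_nonneg fun p hp => h0 p (Finset.mem_powerset.1 hS hp)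
    rw [Finset.prod_div_distrib, Finset.prod_const]
    split_ifs with h
    · rw [mul_div_assoc', le_div_iff₀ (by positivity), mul_comm]
      exact mul_le_mul_of_nonneg_right (pow_le_pow_right₀ hl h) hn
    · positivity
  refine h.trans ?_
  gcongr
  apply prod_one_add_le_exp
  intro p hp
  exact div_nonneg (h0 p hp) hl0.le

lemma powerset_prod_two (s t : Finset ℕ) (hd : Disjoint s t) (f g : Finset ℕ → ℝ) :
    ∑ S ∈ (s ∪ t).powerset, f (S ∩ s) * g (S ∩ t) = (∑ S ∈ s.powerset, f S) * ∑ S ∈ t.powerset, g S := by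
  rw [Finset.sum_mul_sum, ← Finset.sum_product']
  apply Finset.sum_nbij' (fun S => (S ∩ s, S ∩ t)) (fun P => P.1 ∪ P.2)
  · intro S _
    simp
  · rintro ⟨a, b⟩ h
    simp only [Finset.mem_product, Finset.mem_powerset] at h ⊢
    exact Finset.union_subset_union h.1 h.2
  · intro S hS
    simp only [Finset.mem_powerset] at hS
    rw [← Finset.inter_union_distrib_left]
    exact Finset.inter_eq_left.2 hS
  · rintro ⟨a, b⟩ h
    simp only [Finset.mem_product, Finset.mem_powerset] at h
    rw [Finset.disjoint_left] at hd
    ext x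
    · simp only [Finset.mem_inter, Finset.mem_union]
      constructor
      · rintro ⟨h1 | h1, h2⟩
        · exact h1
        · exact absurd (h.2 h1) (hd h2)
      · exact fun h1 => ⟨Or.inl h1, h.1 h1⟩
    · simp only [Finset.mem_inter, Finset.mem_union]
      constructor
      · rintro ⟨h1 | h1, h2⟩
        · exact absurd h2 (hd (h.1 h1))
        · exact h1
      · exact fun h1 => ⟨Or.inr h1, h.2 h1⟩
  · intro S _
    rfl

lemma powerset_prod (J : Finset ℕ) (B : ℕ → Finset ℕ) (hd : ∀ i ∈ J, ∀ j ∈ J, i ≠ j → Disjoint (B i) (B j))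
    (φ : ℕ → Finset ℕ → ℝ) :
    ∑ S ∈ (J.biUnion B).powerset, ∏ i ∈ J, φ i (S ∩ B i) = ∏ i ∈ J, ∑ S ∈ (B i).powerset, φ i S := by
  induction J using Finset.induction_on with
  | empty => simp
  | insert a J ha ih =>
    have ih := ih (fun i hi j hj => hd i (Finset.mem_insert_of_mem hi) j (Finset.mem_insert_of_mem hj))
    rw [Finset.prod_insert ha, ← ih, Finset.biUnion_insert]
    rw [← powerset_prod_two]
    · apply Finset.sum_congr rfl
      intro S _
      rw [Finset.prod_insert ha]
      congr 1
      apply Finset.prod_congr rfl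
      intro i hi
      congr 1
      rw [Finset.inter_assoc]
      congr 1
      symm
      exact Finset.inter_eq_right.2 (Finset.subset_biUnion_of_mem B hi)
    · rw [Finset.disjoint_biUnion_right]
      intro i hi
      exact hd a (Finset.mem_insert_self _ _) i (Finset.mem_insert_of_mem hi) (fun h => ha (h ▸ hi))

/-- block-truncated sum factorizes -/
lemma TS_block (J : Finset ℕ) (B : ℕ → Finset ℕ) (hd : ∀ i ∈ J, ∀ j ∈ J, i ≠ j → Disjoint (B i) (B j))
    (w : ℕ → ℝ) :
    ∑ S ∈ (J.biUnion B).powerset, (if ∀ i ∈ J, (S ∩ B i).card ≤ 2 * i then ∏ p ∈ S, w p else 0)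
      = ∏ i ∈ J, TS (2*i) (B i) w := by
  unfold TS
  rw [← powerset_prod J B hd (fun i S => if S.card ≤ 2*i then ∏ p ∈ S, w p else 0)]
  apply Finset.sum_congr rfl
  intro S hS
  split_ifs with h
  · have hS' : S = J.biUnion (fun i => S ∩ B i) := by
      rw [← Finset.inter_biUnion]
      exact (Finset.inter_eq_left.2 (Finset.mem_powerset.1 hS)).symm
    conv_lhs => rw [hS']
    rw [Finset.prod_biUnion]
    · apply Finset.prod_congr rfl
      intro i hi
      rw [if_pos (h i hi)]
    · intro i hi j hj hij
      exact (hd i hi j hj hij).mono Finset.inter_subset_right Finset.inter_subset_right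
  · push Not at h
    obtain ⟨i, hi, h⟩ := h
    symm
    apply Finset.prod_eq_zero hi
    rw [if_neg (by omega)]


lemma sieve_block (J : Finset ℕ) (B : ℕ → Finset ℕ) (hd : ∀ i ∈ J, ∀ j ∈ J, i ≠ j → Disjoint (B i) (B j))
    (Ω : ℕ → ℤ → Prop) (hpr : ∀ p ∈ J.biUnion B, p.Prime) (hper : ∀ p ∈ J.biUnion B, Per (Ω p) p)
    (X H : ℝ) (hH : 0 ≤ H) :
    (((Iv X H).filter (fun n => ∀ p ∈ J.biUnion B, ¬ Ω p n)).card : ℝ) ≤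
      H * ∏ i ∈ J, TS (2*i) (B i) (fun p => -((cnt (Ω p) p : ℝ) / p)) +
      ∏ i ∈ J, TS (2*i) (B i) (fun p => (cnt (Ω p) p : ℝ)) := by
  set Ps := J.biUnion B with hPs
  have key : ∀ n : ℤ, (if ∀ p ∈ Ps, ¬ Ω p n then (1:ℝ) else 0) ≤
      ∏ i ∈ J, TS (2*i) (B i) (fun p => - (if Ω p n then (1:ℝ) else 0)) := by
    intro n
    have hb : ∀ i ∈ J, ∏ p ∈ B i, (1 - (if Ω p n then (1:ℝ) else 0)) ≤ TS (2*i) (B i) (fun p => - (if Ω p n then (1:ℝ) else 0)) := by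
      intro i hi
      have := (bonferroni (B i) (fun p => if Ω p n then (1:ℝ) else 0) (fun p _ => by positivity)
        (fun p _ => by split_ifs <;> norm_num) (2*i)).1
      rw [pow_mul] at this
      norm_num at this
      linarith
    have hnn : ∀ i ∈ J, 0 ≤ ∏ p ∈ B i, (1 - (if Ω p n then (1:ℝ) else 0)) := by
      intro i hi
      exact Finset.prod_nonneg fun p _ => by split_ifs <;> norm_num
    split_ifs with h
    · have : (1:ℝ) = ∏ i ∈ J, ∏ p ∈ B i, (1 - (if Ω p n then (1:ℝ) else 0)) := by
        symm
        apply Finset.prod_eq_one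
        intro i hi
        apply Finset.prod_eq_one
        intro p hp
        rw [if_neg (h p (Finset.mem_biUnion.2 ⟨i, hi, hp⟩))]
        norm_num
      exact this.le.trans (Finset.prod_le_prod hnn hb)
    · exact Finset.prod_nonneg fun i hi => (hnn i hi).trans (hb i hi)
  rw [Finset.card_filter]
  push_cast
  calc (∑ n ∈ Iv X H, if ∀ p ∈ Ps, ¬ Ω p n then (1:ℝ) else 0)
      ≤ ∑ n ∈ Iv X H, ∑ S ∈ Ps.powerset, (if ∀ i ∈ J, (S ∩ B i).card ≤ 2 * i then ∏ p ∈ S, (- (if Ω p n then (1:ℝ) else 0)) else 0) := by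
        apply Finset.sum_le_sum
        intro n _
        rw [TS_block J B hd]
        exact key n
    _ = ∑ S ∈ Ps.powerset, (if ∀ i ∈ J, (S ∩ B i).card ≤ 2 * i then ∑ n ∈ Iv X H, ∏ p ∈ S, (- (if Ω p n then (1:ℝ) else 0)) else 0) := by
        rw [Finset.sum_comm]
        apply Finset.sum_congr rfl
        intro S _
        split_ifs
        · rfl
        · simp
    _ ≤ ∑ S ∈ Ps.powerset, (if ∀ i ∈ J, (S ∩ B i).card ≤ 2 * i then
          (H * ∏ p ∈ S, (-((cnt (Ω p) p : ℝ) / p)) + ∏ p ∈ S, (cnt (Ω p) p : ℝ)) else 0) := by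
        apply Finset.sum_le_sum
        intro S hS
        have hS := Finset.mem_powerset.1 hS
        split_ifs
        swap
        · exact le_rfl
        have hcrt := crt_prod S Ω (fun p => p) (fun p hp => hper p (hS hp)) (fun p hp => (hpr p (hS hp)).pos)
          (fun p hp q hq hpq => (Nat.coprime_primes (hpr p (hS hp)) (hpr q (hS hq))).2 hpq)
        have hpos : 0 < ∏ p ∈ S, p := Finset.prod_pos fun p hp => (hpr p (hS hp)).pos
        have hc := card_per X hH (∏ p ∈ S, p) hpos _ hcrt.1
        rw [hcrt.2] at hc
        have e1 : ∀ n : ℤ, ∏ p ∈ S, (- (if Ω p n then (1:ℝ) else 0)) = (-1)^S.card * (if ∀ p ∈ S, Ω p n then 1 else 0) := by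
          intro n
          rw [Finset.prod_neg, ← Finset.prod_boole]
          
        have e2 : ∑ n ∈ Iv X H, ∏ p ∈ S, (- (if Ω p n then (1:ℝ) else 0)) = (-1)^S.card * ((Iv X H).filter (fun n => ∀ p ∈ S, Ω p n)).card := by
          simp_rw [e1]
          rw [← Finset.mul_sum, Finset.card_filter]
          push_cast
          congr!
        rw [e2, Finset.prod_neg, Finset.prod_div_distrib]
        push_cast at hc
        rw [abs_le] at hc
        have e3 : ((Iv X H).filter (fun n => ∀ p ∈ S, Ω p n)).card = (@Finset.filter ℤ (fun n => ∀ p ∈ S, Ω p n) (fun a => Classical.propDecidable _) (Iv X H)).card := by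
          congr!
        rw [← e3] at hc
        rcases neg_one_pow_eq_or ℝ S.card with h | h
        · rw [h]; linarith
        · rw [h]; linarith
    _ = _ := by
        rw [← TS_block J B hd, ← TS_block J B hd, Finset.mul_sum, ← Finset.sum_add_distrib]
        apply Finset.sum_congr rfl
        intro S _
        split_ifs <;> simp

lemma sum_i_half (I g : ℕ) : ∑ i ∈ Finset.range I, ((2*i+g : ℕ):ℝ) / 2^i ≤ 4 + 2*g := by
  have : ∑ i ∈ Finset.range I, ((2*i+g : ℕ):ℝ) / 2^i = 4 + 2*g - (4*I + 4 + 2*g) / 2^I := by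
    induction I with
    | zero => simp
    | succ n ih =>
      rw [Finset.sum_range_succ, ih, pow_succ]
      push_cast
      field_simp
      ring
  rw [this]
  have : (0:ℝ) ≤ (4*I + 4 + 2*g) / 2^I := by positivity
  linarith

lemma one_sub_ge_exp {a : ℝ} (h0 : 0 ≤ a) (h1 : a ≤ 1/2) : Real.exp (-(2*a)) ≤ 1 - a := by
  have h : 0 < 1 - a := by linarith
  rw [← Real.le_log_iff_exp_le h]
  have := Real.one_sub_inv_le_log_of_pos h
  have h2 : -(2*a) ≤ 1 - (1-a)⁻¹ := by
    have : 1 - (1-a)⁻¹ = -a / (1-a) := by field_simp; ring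
    rw [this, le_div_iff₀ h]
    nlinarith
  linarith

lemma sum_inv_prime_le {t : ℝ} (ht : 1 ≤ t) (Ps : Finset ℕ) (h : ∀ p ∈ Ps, p.Prime ∧ (p:ℝ) ≤ t) :
    ∑ p ∈ Ps, (1:ℝ)/p ≤ 1 + Real.log t := by
  have h1 : ∑ p ∈ Ps, (1:ℝ)/p ≤ ∑ p ∈ Finset.Icc 1 ⌊t⌋₊, (1:ℝ)/p := by
    apply Finset.sum_le_sum_of_subset_of_nonneg
    · intro p hp
      exact Finset.mem_Icc.2 ⟨(h p hp).1.pos, Nat.le_floor (h p hp).2⟩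
    · intros; positivity
  have h2 : ∑ p ∈ Finset.Icc 1 ⌊t⌋₊, (1:ℝ)/p = ((harmonic ⌊t⌋₊ : ℚ) : ℝ) := by
    rw [harmonic_eq_sum_Icc]
    push_cast
    simp
  rw [h2] at h1
  exact h1.trans (harmonic_floor_le_one_add_log t ht)

lemma sieve1 (g : ℕ) (hg : 1 ≤ g) : ∃ C : ℝ, 0 < C ∧ ∀ (t X H : ℝ) (Ps : Finset ℕ) (Ω : ℕ → ℤ → Prop),
    1 < t → t^(4+4*g) ≤ H →
    (∀ p ∈ Ps, p.Prime ∧ (p:ℝ) ≤ t ∧ 2*g+1 < p) → (∀ p ∈ Ps, Per (Ω p) p) → (∀ p ∈ Ps, cnt (Ω p) p ≤ g) →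
    (((Iv X H).filter (fun n => ∀ p ∈ Ps, ¬ Ω p n)).card : ℝ) ≤
      C * H * Real.exp (- ∑ p ∈ Ps, (cnt (Ω p) p : ℝ) / p) := by
  refine ⟨Real.exp (2*Real.exp (16*g)) + Real.exp (2*g), by positivity, ?_⟩
  intro t X H Ps Ω ht hHt hp hper hcnt
  have hL : 0 < Real.log t := Real.log_pos ht
  set L := Real.log t with hLdef
  have htL : t = Real.exp L := (Real.exp_log (by linarith)).symm
  set α : ℕ → ℝ := fun p => (cnt (Ω p) p : ℝ) / p with hα
  have hH : 0 ≤ H := le_trans (by positivity) hHt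
  set b : ℕ → ℕ := fun p => Nat.log 2 ⌊L / Real.log p⌋₊ with hb
  set J := Finset.range (Ps.sup b + 1) with hJ
  set B : ℕ → Finset ℕ := fun i => Ps.filter (fun p => b p = i) with hB
  have hBU : J.biUnion B = Ps := by
    ext p
    simp only [Finset.mem_biUnion, hB, Finset.mem_filter, hJ, Finset.mem_range]
    constructor
    · rintro ⟨i, _, h, _⟩; exact h
    · intro h; exact ⟨b p, Nat.lt_succ_of_le (Finset.le_sup h), h, rfl⟩
  have hd : ∀ i ∈ J, ∀ j ∈ J, i ≠ j → Disjoint (B i) (B j) := by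
    intro i _ j _ hij
    rw [Finset.disjoint_left]
    intro p h1 h2
    simp only [hB, Finset.mem_filter] at h1 h2
    exact hij (h1.2.symm.trans h2.2)
  have hlogp : ∀ p ∈ Ps, 0 < Real.log p := fun p h => Real.log_pos (by exact_mod_cast (hp p h).1.one_lt)
  have hblk : ∀ i, ∀ p ∈ B i, (p:ℝ) ≤ Real.exp (L/2^i) ∧ Real.exp (L/2^(i+1)) < p := by
    intro i p hpB
    simp only [hB, Finset.mem_filter] at hpB
    obtain ⟨hpP, hbi⟩ := hpB
    have hl := hlogp p hpP
    have hp0 : (0:ℝ) < p := by exact_mod_cast (hp p hpP).1.pos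
    have hle : Real.log p ≤ L := Real.log_le_log hp0 (hp p hpP).2.1
    have h1 : 1 ≤ L / Real.log p := (one_le_div hl).2 hle
    have hne : ⌊L / Real.log p⌋₊ ≠ 0 := by
      have := Nat.le_floor (α := ℝ) (n := 1) (a := L / Real.log p) (by simpa using h1)
      omega
    have a1 : 2^i ≤ ⌊L / Real.log p⌋₊ := by rw [← hbi]; exact Nat.pow_log_le_self 2 hne
    have a2 : ⌊L / Real.log p⌋₊ < 2^(i+1) := by rw [← hbi]; exact Nat.lt_pow_succ_log_self (by norm_num) _
    have a1' : (2:ℝ)^i ≤ L / Real.log p := by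
      have := (Nat.le_floor_iff (by linarith)).1 a1
      exact_mod_cast this
    have a2' : L / Real.log p < 2^(i+1) := by
      have := (Nat.floor_lt (by linarith)).1 a2
      exact_mod_cast this
    constructor
    · rw [← Real.log_le_iff_le_exp hp0, le_div_iff₀ (by positivity)]
      rw [le_div_iff₀ hl] at a1'
      linarith
    · rw [← Real.lt_log_iff_exp_lt hp0, div_lt_iff₀ (by positivity)]
      rw [div_lt_iff₀ hl] at a2'
      linarith
  have hg1 : (1:ℝ) ≤ g := by exact_mod_cast hg
  have hα0 : ∀ p, 0 ≤ α p := fun p => by positivity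
  have hαg : ∀ p ∈ Ps, α p ≤ g * (1/p) := by
    intro p h
    have := hcnt p h
    simp only [hα]
    rw [mul_one_div]
    gcongr
  have hα1 : ∀ p ∈ Ps, α p ≤ 1/2 := by
    intro p h
    have h1 := hcnt p h
    have h2 := (hp p h).2.2
    have hp0 : (0:ℝ) < p := by exact_mod_cast (hp p h).1.pos
    simp only [hα]
    rw [div_le_div_iff₀ hp0 (by norm_num)]
    have : cnt (Ω p) p * 2 ≤ 1 * p := by omega
    exact_mod_cast this
  have hBs : ∀ i, B i ⊆ Ps := fun i => Finset.filter_subset _ _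
  have hs : ∀ i, ∑ p ∈ B i, α p ≤ 4 * g := by
    intro i
    have h1 : ∑ p ∈ B i, α p ≤ g * ∑ p ∈ (primesBelow (Real.exp (L/2^i))).filter (fun p : ℕ => Real.exp (L/2^(i+1)) < (p:ℝ)), (1:ℝ)/p := by
      rw [Finset.mul_sum]
      calc ∑ p ∈ B i, α p ≤ ∑ p ∈ B i, g * ((1:ℝ)/p) := Finset.sum_le_sum fun p hpp => hαg p (hBs i hpp)
        _ ≤ _ := by
          apply Finset.sum_le_sum_of_subset_of_nonneg
          · intro p hpp
            rw [Finset.mem_filter, mem_primesBelow']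
            exact ⟨⟨(hp p (hBs i hpp)).1, (hblk i p hpp).1⟩, (hblk i p hpp).2⟩
          · intros; positivity
    have h2 := sum_inv_le (t := Real.exp (L/2^(i+1))) (x := Real.exp (L/2^i)) (by
      rw [Real.one_lt_exp_iff]; positivity) (by rw [Real.one_le_exp_iff]; positivity)
    rw [Real.log_exp, Real.log_exp] at h2
    have h3 : L / 2^i / (L/2^(i+1)) = 2 := by rw [pow_succ]; field_simp
    rw [h3] at h2
    nlinarith
  set Pr : ℕ → ℝ := fun i => ∏ p ∈ B i, (1 - α p) with hPr
  have hPrlow : ∀ i, Real.exp (-(2 * ∑ p ∈ B i, α p)) ≤ Pr i := by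
    intro i
    rw [Finset.mul_sum, ← Finset.sum_neg_distrib, Real.exp_sum]
    apply Finset.prod_le_prod
    · intros; positivity
    · intro p hpp
      exact one_sub_ge_exp (hα0 p) (hα1 p (hBs i hpp))
  have hPr0 : ∀ i, 0 < Pr i := fun i => lt_of_lt_of_le (Real.exp_pos _) (hPrlow i)
  have hA : ∀ i ∈ J, |TS (2*i) (B i) (fun p => - α p)| ≤ Pr i * Real.exp ((1/2)^i * Real.exp (16*g)) := by
    intro i _
    have hbf := bonferroni (B i) α (fun p _ => hα0 p) (fun p hpp => (hα1 p (hBs i hpp)).trans (by norm_num)) (2*i)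
    rw [pow_mul] at hbf
    norm_num at hbf
    have hE := ES_le (2*i+1) (B i) α (fun p _ => hα0 p)
    have h1 : 0 ≤ TS (2*i) (B i) (fun p => - α p) := by
      have := hPr0 i
      simp only [hPr] at this
      linarith [hbf.1]
    rw [abs_of_nonneg h1]
    have h2 : (1/2:ℝ)^(2*i+1) ≤ (1/2)^i := pow_le_pow_of_le_one (by norm_num) (by norm_num) (by omega)
    have h3 : Real.exp (2 * ∑ p ∈ B i, α p) ≤ Pr i * Real.exp (16 * g) := by
      calc Real.exp (2 * ∑ p ∈ B i, α p) ≤ Real.exp (-(2 * ∑ p ∈ B i, α p)) * Real.exp (16*g) := by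
            rw [← Real.exp_add, Real.exp_le_exp]
            linarith [hs i]
        _ ≤ _ := by gcongr; exact hPrlow i
    have h4 : ES (2*i+1) (B i) α ≤ Pr i * ((1/2)^i * Real.exp (16*g)) := by
      calc ES (2*i+1) (B i) α ≤ (1/2)^(2*i+1) * Real.exp (2 * ∑ p ∈ B i, α p) := hE
        _ ≤ (1/2)^i * (Pr i * Real.exp (16*g)) := by gcongr
        _ = _ := by ring
    have h5 := Real.add_one_le_exp ((1/2)^i * Real.exp (16*g))
    have h6 := mul_le_mul_of_nonneg_left h5 (hPr0 i).le
    have : TS (2*i) (B i) (fun p => - α p) ≤ Pr i + ES (2*i+1) (B i) α := by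
      simp only [hPr]
      linarith [hbf.2]
    linarith
  have hAprod : ∏ i ∈ J, TS (2*i) (B i) (fun p => - α p) ≤ Real.exp (2*Real.exp (16*g)) * ∏ p ∈ Ps, (1 - α p) := by
    calc ∏ i ∈ J, TS (2*i) (B i) (fun p => - α p) ≤ |∏ i ∈ J, TS (2*i) (B i) (fun p => - α p)| := le_abs_self _
      _ = ∏ i ∈ J, |TS (2*i) (B i) (fun p => - α p)| := Finset.abs_prod _ _
      _ ≤ ∏ i ∈ J, Pr i * Real.exp ((1/2)^i * Real.exp (16*g)) := Finset.prod_le_prod (fun _ _ => abs_nonneg _) hA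
      _ = (∏ i ∈ J, Pr i) * Real.exp ((∑ i ∈ J, (1/2:ℝ)^i) * Real.exp (16*g)) := by
          rw [Finset.prod_mul_distrib, ← Real.exp_sum, Finset.sum_mul]
      _ = (∏ p ∈ Ps, (1 - α p)) * Real.exp ((∑ i ∈ J, (1/2:ℝ)^i) * Real.exp (16*g)) := by
          congr 1
          conv_rhs => rw [← hBU]
          rw [Finset.prod_biUnion]
          intro i hi j hj hij
          exact hd i hi j hj hij
      _ ≤ (∏ p ∈ Ps, (1 - α p)) * Real.exp (2 * Real.exp (16*g)) := by
          have : 0 ≤ ∏ p ∈ Ps, (1 - α p) := Finset.prod_nonneg fun p h => by linarith [hα1 p h]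
          gcongr
          rw [hJ]
          exact sum_geometric_two_le _
      _ = _ := mul_comm _ _
  have hBd : ∀ i ∈ J, TS (2*i) (B i) (fun p => (cnt (Ω p) p : ℝ)) ≤ Real.exp (L * (((2*i+g : ℕ):ℝ) / 2^i)) := by
    intro i _
    rcases (B i).eq_empty_or_nonempty with h | ⟨q, hq⟩
    · rw [h]
      have : TS (2*i) ∅ (fun p => (cnt (Ω p) p : ℝ)) = 1 := by simp [TS]
      rw [this, Real.one_le_exp_iff]
      positivity
    · set T := Real.exp (L/2^i) with hT
      have hT1 : 1 ≤ T := by rw [hT, Real.one_le_exp_iff]; positivity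
      have h1 := TS_le (2*i) (B i) (fun p => (cnt (Ω p) p : ℝ)) (fun _ _ => by positivity) T hT1
      have hcard : ((B i).card : ℝ) ≤ T := by
        have : (B i).card ≤ (Finset.Icc 1 ⌊T⌋₊).card := by
          apply Finset.card_le_card
          intro p hpp
          exact Finset.mem_Icc.2 ⟨(hp p (hBs i hpp)).1.pos, Nat.le_floor (hblk i p hpp).1⟩
        rw [Nat.card_Icc] at this
        calc ((B i).card : ℝ) ≤ (⌊T⌋₊ : ℝ) := by exact_mod_cast (by omega)
          _ ≤ T := Nat.floor_le (by linarith)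
      have hsum : ∑ p ∈ B i, (cnt (Ω p) p : ℝ) / T ≤ g := by
        calc ∑ p ∈ B i, (cnt (Ω p) p : ℝ) / T ≤ ∑ p ∈ B i, (g:ℝ)/T := by
              apply Finset.sum_le_sum
              intro p hpp
              have := hcnt p (hBs i hpp)
              gcongr
          _ = (B i).card * (g/T) := by rw [Finset.sum_const, nsmul_eq_mul]
          _ ≤ T * (g/T) := by gcongr
          _ = g := by field_simp
      have hTl : 1 ≤ L / 2^i := by
        have hq3 : 3 < q := by have := (hp q (hBs i hq)).2.2; omega
        have : Real.exp 1 ≤ T := by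
          calc Real.exp 1 ≤ 3 := by linarith [Real.exp_one_lt_d9]
            _ ≤ (q:ℝ) := by exact_mod_cast hq3.le
            _ ≤ T := (hblk i q hq).1
        rwa [hT, Real.exp_le_exp] at this
      calc TS (2*i) (B i) (fun p => (cnt (Ω p) p : ℝ)) ≤ T^(2*i) * Real.exp (∑ p ∈ B i, (cnt (Ω p) p : ℝ) / T) := h1
        _ ≤ Real.exp ((2*i : ℕ) * (L/2^i)) * Real.exp (g * (L/2^i)) := by
            rw [Real.exp_nat_mul]
            gcongr
            nlinarith
        _ = _ := by
            rw [← Real.exp_add]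
            congr 1
            push_cast
            ring
  have hBprod : ∏ i ∈ J, TS (2*i) (B i) (fun p => (cnt (Ω p) p : ℝ)) ≤ t^(4+2*g) := by
    calc ∏ i ∈ J, TS (2*i) (B i) (fun p => (cnt (Ω p) p : ℝ)) ≤ ∏ i ∈ J, Real.exp (L * (((2*i+g : ℕ):ℝ) / 2^i)) := by
          apply Finset.prod_le_prod _ hBd
          intro i _
          unfold TS
          apply Finset.sum_nonneg
          intro S _
          positivity
      _ = Real.exp (L * ∑ i ∈ J, ((2*i+g : ℕ):ℝ) / 2^i) := by rw [← Real.exp_sum, Finset.mul_sum]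
      _ ≤ Real.exp (L * (4 + 2*g)) := by
          gcongr
          exact sum_i_half _ _
      _ = t^(4+2*g) := by
          rw [htL, ← Real.exp_nat_mul]
          congr 1
          push_cast; ring
  have hfin := sieve_block J B hd Ω (by rw [hBU]; exact fun p h => (hp p h).1) (by rw [hBU]; exact hper) X H hH
  rw [hBU] at hfin
  have hup : ∏ p ∈ Ps, (1 - α p) ≤ Real.exp (-∑ p ∈ Ps, α p) := by
    rw [← Finset.sum_neg_distrib, Real.exp_sum]
    apply Finset.prod_le_prod
    · intro p h; linarith [hα1 p h]
    · intro p h; linarith [Real.add_one_le_exp (-α p)]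
  have hlow : t^(4+2*g) ≤ Real.exp (2*g) * H * Real.exp (-∑ p ∈ Ps, α p) := by
    have h1 : ∑ p ∈ Ps, α p ≤ g * (1 + L) := by
      calc ∑ p ∈ Ps, α p ≤ ∑ p ∈ Ps, g * ((1:ℝ)/p) := Finset.sum_le_sum hαg
        _ = g * ∑ p ∈ Ps, (1:ℝ)/p := by rw [Finset.mul_sum]
        _ ≤ _ := by
          gcongr
          exact sum_inv_prime_le ht.le Ps (fun p h => ⟨(hp p h).1, (hp p h).2.1⟩)
    calc t^(4+2*g) = Real.exp (L * (4+2*g)) := by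
          rw [htL, ← Real.exp_nat_mul]
          congr 1
          push_cast; ring
      _ ≤ Real.exp (2*g + L*(4+4*g) + -∑ p ∈ Ps, α p) := by
          rw [Real.exp_le_exp]
          nlinarith
      _ = Real.exp (2*g) * t^(4+4*g) * Real.exp (-∑ p ∈ Ps, α p) := by
          rw [Real.exp_add, Real.exp_add, htL, ← Real.exp_nat_mul]
          congr 3
          push_cast; ring
      _ ≤ _ := by gcongr
  calc _ ≤ _ := hfin
    _ ≤ H * (Real.exp (2*Real.exp (16*g)) * Real.exp (-∑ p ∈ Ps, α p)) + Real.exp (2*g) * H * Real.exp (-∑ p ∈ Ps, α p) := by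
        refine add_le_add (mul_le_mul_of_nonneg_left (hAprod.trans ?_) hH) (hBprod.trans hlow)
        gcongr
    _ = _ := by ring


lemma cnt_shift {P : ℤ → Prop} {p M : ℕ} (hP : Per P p) (hp : 0 < p) (hc : Nat.Coprime M p) (c : ℤ) :
    cnt (fun m => P (c + M * m)) p = cnt P p := by
  have hp' : (p:ℤ) ≠ 0 := by exact_mod_cast hp.ne'
  have hdv : ∀ n : ℤ, (p:ℤ) ∣ n - ((n % p).toNat : ℕ) := by
    intro n
    rw [Int.toNat_of_nonneg (Int.emod_nonneg _ hp')]
    exact Int.dvd_self_sub_emod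
  have hlt : ∀ n : ℤ, (n % p).toNat < p := by
    intro n
    have h1 := Int.emod_nonneg n hp'
    have h2 := Int.emod_lt_of_pos n (by positivity : (0:ℤ) < p)
    omega
  have small : ∀ a b : ℕ, a < p → b < p → (p:ℤ) ∣ (a:ℤ) - b → a = b := by
    intro a b ha hb h
    have := Int.eq_zero_of_abs_lt_dvd h (by rw [abs_lt]; constructor <;> omega)
    omega
  obtain ⟨u, v, huv⟩ := Int.isCoprime_iff_gcd_eq_one.2 (by exact_mod_cast hc : Int.gcd (M:ℤ) (p:ℤ) = 1)
  unfold cnt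
  apply Finset.card_nbij (fun m : ℕ => ((c + M * m) % p).toNat)
  · intro m hm
    simp only [Finset.mem_coe, Finset.mem_filter, Finset.mem_range] at hm ⊢
    exact ⟨hlt _, hP _ _ (hdv _) hm.2⟩
  · intro a ha b hb hab
    simp only [Finset.coe_filter, Finset.mem_range, Set.mem_ofPred_eq] at ha hb hab
    apply small a b ha.1 hb.1
    have h1 := hdv (c + M * a)
    have h2 := hdv (c + M * b)
    rw [hab] at h1
    have h3 := dvd_sub h1 h2
    have h4 : (p:ℤ) ∣ M * ((a:ℤ) - b) := by
      have e : (M:ℤ) * ((a:ℤ) - b) = (c + M * a) - (((c + M * b) % p).toNat : ℕ) - ((c + M * b) - (((c + M * b) % p).toNat : ℕ)) := by ring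
      rw [e]; exact h3
    exact (IsCoprime.symm (⟨u, v, huv⟩ : IsCoprime (M:ℤ) p)).dvd_of_dvd_mul_left h4
  · intro n hn
    simp only [Finset.coe_filter, Finset.mem_range, Set.mem_ofPred_eq] at hn
    set m := (((n - c) * u) % p).toNat with hm
    have hm1 := hdv ((n-c)*u)
    rw [← hm] at hm1
    have key : (p:ℤ) ∣ (n:ℤ) - (c + M * m) := by
      have : (n:ℤ) - (c + M*m) = M * ((n-c)*u - m) + p * (v * (n - c)) := by
        linear_combination (-(n:ℤ) + c) * huv
      rw [this]
      exact dvd_add (Dvd.dvd.mul_left hm1 _) (Dvd.intro _ rfl)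
    refine ⟨m, ?_, ?_⟩
    · simp only [Finset.coe_filter, Finset.mem_range, Set.mem_ofPred_eq]
      exact ⟨hlt _, hP n _ key hn.2⟩
    · apply small _ _ (hlt _) hn.1
      have := dvd_add (hdv (c + M*m)) key
      rw [← dvd_neg]
      convert this using 1; ring

lemma sieve2 (g : ℕ) (hg : 1 ≤ g) : ∃ C : ℝ, 0 < C ∧ ∀ (t x y : ℝ) (Ps : Finset ℕ) (Ω : ℕ → ℤ → Prop)
    (M : ℕ) (P : ℤ → Prop),
    1 < t → 0 < M → t^(4+4*g) * M ≤ y → Per P M →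
    (∀ p ∈ Ps, p.Prime ∧ (p:ℝ) ≤ t ∧ 2*g+1 < p ∧ ¬ p ∣ M) → (∀ p ∈ Ps, Per (Ω p) p) → (∀ p ∈ Ps, cnt (Ω p) p ≤ g) →
    (((Iv x y).filter (fun n => P n ∧ ∀ p ∈ Ps, ¬ Ω p n)).card : ℝ) ≤
      C * y * (cnt P M / M) * Real.exp (- ∑ p ∈ Ps, (cnt (Ω p) p : ℝ) / p) := by
  obtain ⟨C, hC, h⟩ := sieve1 g hg
  refine ⟨C, hC, ?_⟩
  intro t x y Ps Ω M P ht hM hy hPer hPs hΩ hcnt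
  have hM' : (0:ℝ) < M := by exact_mod_cast hM
  have e0 : ((Iv x y).filter (fun n => P n ∧ ∀ p ∈ Ps, ¬ Ω p n)).card =
    ∑ c ∈ (Finset.range M).filter (fun n : ℕ => P (n:ℤ)), ((Iv ((x - c) / M) (y / M)).filter (fun m => ∀ p ∈ Ps, ¬ Ω p (c + M * m))).card := by
    convert card_split x y M hM P hPer (fun n => ∀ p ∈ Ps, ¬ Ω p n)
  rw [e0]
  push_cast
  have hcop : ∀ p ∈ Ps, Nat.Coprime M p := fun p hp =>
    ((Nat.Prime.coprime_iff_not_dvd (hPs p hp).1).2 (hPs p hp).2.2.2).symm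
  have key : ∀ c ∈ (Finset.range M).filter (fun n : ℕ => P (n:ℤ)),
    (((Iv ((x - c) / M) (y / M)).filter (fun m => ∀ p ∈ Ps, ¬ Ω p (c + M * m))).card : ℝ) ≤ C * (y/M) * Real.exp (- ∑ p ∈ Ps, (cnt (Ω p) p : ℝ) / p) := by
    intro c _
    have hs : ∀ p ∈ Ps, cnt (fun m => Ω p (c + M * m)) p = cnt (Ω p) p := fun p hp =>
      cnt_shift (hΩ p hp) (hPs p hp).1.pos (hcop p hp) c
    have := h t ((x-c)/M) (y/M) Ps (fun p m => Ω p (c + M * m)) ht (by rwa [le_div_iff₀ hM'])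
      (fun p hp => ⟨(hPs p hp).1, (hPs p hp).2.1, (hPs p hp).2.2.1⟩)
      (fun p hp a b hab hh => hΩ p hp _ _ (by
        have : ((c:ℤ) + M * a) - (c + M * b) = M * (a - b) := by ring
        rw [this]; exact Dvd.dvd.mul_left hab _) hh)
      (fun p hp => by rw [hs p hp]; exact hcnt p hp)
    refine this.trans (le_of_eq ?_)
    congr 3
    exact Finset.sum_congr rfl fun p hp => by rw [hs p hp]
  calc _ ≤ ∑ c ∈ (Finset.range M).filter (fun n : ℕ => P (n:ℤ)), C * (y/M) * Real.exp (- ∑ p ∈ Ps, (cnt (Ω p) p : ℝ) / p) :=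
        Finset.sum_le_sum key
    _ = _ := by
        rw [Finset.sum_const, nsmul_eq_mul]
        change (cnt P M : ℝ) * _ = _
        field_simp


lemma lym_aux (U : Finset ℕ) (w : ℕ → ℝ) (hw : ∀ p ∈ U, 0 ≤ w p) :
    ∀ (N : ℕ) (F : Finset (Finset ℕ)), (∀ S ∈ F, S ⊆ U ∧ S.card ≤ N) →
      (∀ S ∈ F, ∀ T ∈ F, S ⊆ T → S = T) →
      ∑ S ∈ F, (S.card.factorial : ℝ) * (∏ p ∈ S, w p) * (∑ p ∈ U, w p)^(N - S.card) ≤ (∑ p ∈ U, w p)^N := by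
  intro N
  induction N with
  | zero =>
    intro F hF hanti
    have : F ⊆ {∅} := by
      intro S hS
      have := (hF S hS).2
      simpa using this
    calc _ ≤ ∑ S ∈ ({∅} : Finset (Finset ℕ)), (S.card.factorial : ℝ) * (∏ p ∈ S, w p) * (∑ p ∈ U, w p)^(0 - S.card) := by
          apply Finset.sum_le_sum_of_subset_of_nonneg this
          intro S hS _
          simp only [Finset.mem_singleton] at hS
          subst hS
          simp
      _ ≤ _ := by simp
  | succ N ih =>
    intro F hF hanti
    have hW : 0 ≤ ∑ p ∈ U, w p := Finset.sum_nonneg hw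
    by_cases he : ∅ ∈ F
    · have : F = {∅} := by
        ext S
        simp only [Finset.mem_singleton]
        constructor
        · intro hS; exact (hanti ∅ he S hS (Finset.empty_subset _)).symm
        · rintro rfl; exact he
      rw [this]; simp
    · have e1 : ∀ S ∈ F, (S.card.factorial : ℝ) * (∏ p ∈ S, w p) * (∑ p ∈ U, w p)^(N + 1 - S.card) =
          ∑ p ∈ U, if p ∈ S then w p * (((S.erase p).card.factorial : ℝ) * (∏ q ∈ S.erase p, w q) * (∑ p ∈ U, w p)^(N - (S.erase p).card)) else 0 := by
        intro S hS
        have hne : S.Nonempty := Finset.nonempty_iff_ne_empty.2 (fun h => he (h ▸ hS))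
        have hc : 0 < S.card := hne.card_pos
        rw [← Finset.sum_filter]
        have : U.filter (fun p => p ∈ S) = S := by
          rw [Finset.filter_mem_eq_inter]; exact Finset.inter_eq_right.2 (hF S hS).1
        rw [this]
        have e2 : ∀ p ∈ S, w p * (((S.erase p).card.factorial : ℝ) * (∏ q ∈ S.erase p, w q) * (∑ p ∈ U, w p)^(N - (S.erase p).card))
          = ((S.card - 1).factorial : ℝ) * (∏ q ∈ S, w q) * (∑ p ∈ U, w p)^(N + 1 - S.card) := by
          intro p hp
          rw [Finset.card_erase_of_mem hp, ← Finset.mul_prod_erase S w hp]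
          have : N - (S.card - 1) = N + 1 - S.card := by omega
          rw [this]; ring
        rw [Finset.sum_congr rfl e2, Finset.sum_const, nsmul_eq_mul, ← Nat.mul_factorial_pred hc.ne']
        push_cast
        ring
      rw [Finset.sum_congr rfl e1, Finset.sum_comm, pow_succ, mul_comm, Finset.sum_mul]
      apply Finset.sum_le_sum
      intro p hp
      rw [← Finset.sum_filter, ← Finset.mul_sum]
      apply mul_le_mul_of_nonneg_left _ (hw p hp)
      have hinj : Set.InjOn (fun S : Finset ℕ => S.erase p) (F.filter (fun S => p ∈ S) : Set (Finset ℕ)) := by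
        intro S hS T hT hST
        simp only [Finset.coe_filter, Set.mem_ofPred_eq] at hS hT
        have := congrArg (insert p) hST
        simpa [Finset.insert_erase hS.2, Finset.insert_erase hT.2] using this
      have := ih ((F.filter (fun S => p ∈ S)).image (fun S => S.erase p)) ?_ ?_
      · rwa [Finset.sum_image hinj] at this
      · intro S hS
        simp only [Finset.mem_image, Finset.mem_filter] at hS
        obtain ⟨T, ⟨hT, hpT⟩, rfl⟩ := hS
        refine ⟨(Finset.erase_subset _ _).trans (hF T hT).1, ?_⟩
        rw [Finset.card_erase_of_mem hpT]
        have := (hF T hT).2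
        omega
      · intro S hS T hT hST
        simp only [Finset.mem_image, Finset.mem_filter] at hS hT
        obtain ⟨S', ⟨hS', hpS'⟩, rfl⟩ := hS
        obtain ⟨T', ⟨hT', hpT'⟩, rfl⟩ := hT
        have : S' ⊆ T' := by
          rw [← Finset.insert_erase hpS', ← Finset.insert_erase hpT']
          exact Finset.insert_subset_insert _ hST
        rw [hanti S' hS' T' hT' this]

lemma poisson_max (W : ℝ) (hW : 0 ≤ W) (k : ℕ) : W^k / k.factorial ≤ 2 * Real.exp W / Real.sqrt (1 + W) := by
  have hs : 0 < Real.sqrt (1+W) := Real.sqrt_pos.2 (by linarith)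
  rw [le_div_iff₀ hs]
  by_cases hk : (k:ℝ) ≤ W/4
  · have h1 : (W/2)^k / k.factorial ≤ Real.exp (W/2) := Real.pow_div_factorial_le_exp _ (by linarith) _
    have h2 : W^k / k.factorial = 2^k * ((W/2)^k / k.factorial) := by
      rw [div_pow]; field_simp
    have h3 : (2:ℝ)^k ≤ Real.exp (W/4) := by
      calc (2:ℝ)^k ≤ (Real.exp 1)^k := by
            gcongr
            linarith [Real.add_one_le_exp (1:ℝ)]
        _ = Real.exp k := by rw [← Real.exp_nat_mul, mul_one]
        _ ≤ _ := Real.exp_le_exp.2 hk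
    have h4 : Real.sqrt (1+W) ≤ 2 * Real.exp (W/4) := by
      rw [Real.sqrt_le_left (by positivity), mul_pow, ← Real.exp_nat_mul]
      have : ((2:ℕ):ℝ) * (W/4) = W/2 := by push_cast; ring
      rw [this]
      linarith [Real.add_one_le_exp (W/2)]
    calc W^k / k.factorial * Real.sqrt (1+W) ≤ (Real.exp (W/4) * Real.exp (W/2)) * (2 * Real.exp (W/4)) := by
          rw [h2]; gcongr
      _ = 2 * Real.exp W := by
          have : Real.exp W = Real.exp (W/4) * Real.exp (W/2) * Real.exp (W/4) := by
            rw [← Real.exp_add, ← Real.exp_add]; congr 1; ring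
          rw [this]; ring
  · push Not at hk
    have hk0 : 0 < k := by
      rcases Nat.eq_zero_or_pos k with h | h
      · subst h; simp at hk; linarith
      · exact h
    have hk1 : (1:ℝ) ≤ k := by exact_mod_cast hk0
    have hst := Stirling.le_factorial_stirling k
    have hmax : W^k ≤ (k / Real.exp 1)^k * Real.exp W := by
      have h := Real.add_one_le_exp (W/k - 1)
      have h' : W / k ≤ Real.exp (W/k - 1) := by linarith
      have h2 : (W/k)^k ≤ Real.exp (W - k) := by
        calc (W/k)^k ≤ (Real.exp (W/k-1))^k := by gcongr
          _ = Real.exp (W - k) := by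
            rw [← Real.exp_nat_mul]; congr 1; field_simp
      rw [div_pow, div_le_iff₀ (by positivity)] at h2
      rw [div_pow, ← Real.exp_nat_mul, mul_one]
      calc W^k ≤ _ := h2
        _ = _ := by rw [Real.exp_sub]; ring
    have hsq : Real.sqrt (1+W) ≤ 2 * Real.sqrt (2*Real.pi*k) := by
      have : (2:ℝ) = Real.sqrt 4 := by
        rw [show (4:ℝ) = 2^2 by norm_num, Real.sqrt_sq (by norm_num)]
      conv_rhs => lhs; rw [this]
      rw [← Real.sqrt_mul (by norm_num)]
      apply Real.sqrt_le_sqrt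
      nlinarith [Real.pi_gt_three]
    have hfac : (0:ℝ) < k.factorial := by positivity
    rw [div_mul_eq_mul_div, div_le_iff₀ hfac]
    calc W^k * Real.sqrt (1+W) ≤ ((k / Real.exp 1)^k * Real.exp W) * (2 * Real.sqrt (2*Real.pi*k)) := by gcongr
      _ = 2 * Real.exp W * (Real.sqrt (2*Real.pi*k) * (k / Real.exp 1)^k) := by ring
      _ ≤ _ := by gcongr

lemma antichain_sum (U : Finset ℕ) (w : ℕ → ℝ) (hw : ∀ p ∈ U, 0 ≤ w p) (F : Finset (Finset ℕ))
    (hF : ∀ S ∈ F, S ⊆ U) (hanti : ∀ S ∈ F, ∀ T ∈ F, S ⊆ T → S = T) :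
    ∑ S ∈ F, ∏ p ∈ S, w p ≤ 2 * Real.exp (∑ p ∈ U, w p) / Real.sqrt (1 + ∑ p ∈ U, w p) := by
  set W := ∑ p ∈ U, w p with hWd
  have hW : 0 ≤ W := Finset.sum_nonneg hw
  rcases hW.eq_or_lt with h0 | h0
  · rw [← h0]
    have h1 : ∑ S ∈ F, ∏ p ∈ S, w p ≤ ∑ S ∈ U.powerset, ∏ p ∈ S, w p := by
      apply Finset.sum_le_sum_of_subset_of_nonneg
      · intro S hS; exact Finset.mem_powerset.2 (hF S hS)
      · intro S hS _
        exact Finset.prod_nonneg fun p hp => hw p (Finset.mem_powerset.1 hS hp)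
    rw [← Finset.prod_one_add] at h1
    have h2 := h1.trans (prod_one_add_le_exp U w hw)
    rw [← hWd, ← h0, Real.exp_zero] at h2
    norm_num
    linarith
  · have h := lym_aux U w hw U.card F (fun S hS => ⟨hF S hS, Finset.card_le_card (hF S hS)⟩) hanti
    rw [← hWd] at h
    set D := 2 * Real.exp W / Real.sqrt (1 + W) with hD
    have key : ∀ S ∈ F, ∏ p ∈ S, w p ≤ (D / W^U.card) * ((S.card.factorial : ℝ) * (∏ p ∈ S, w p) * W^(U.card - S.card)) := by
      intro S hS
      have hn : 0 ≤ ∏ p ∈ S, w p := Finset.prod_nonneg fun p hp => hw p (hF S hS hp)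
      have hm := poisson_max W hW S.card
      rw [← hD, div_le_iff₀ (by positivity)] at hm
      have hc : W^U.card = W^S.card * W^(U.card - S.card) := by
        rw [← pow_add]; congr 1
        have := Finset.card_le_card (hF S hS)
        omega
      rw [hc]
      have e : (D / (W^S.card * W^(U.card - S.card))) * ((S.card.factorial : ℝ) * (∏ p ∈ S, w p) * W^(U.card - S.card))
        = (D * S.card.factorial / W^S.card) * ∏ p ∈ S, w p := by field_simp
      rw [e]
      apply le_mul_of_one_le_left hn
      rw [one_le_div (by positivity)]
      exact hm
    calc _ ≤ _ := Finset.sum_le_sum key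
      _ = (D / W^U.card) * ∑ S ∈ F, ((S.card.factorial : ℝ) * (∏ p ∈ S, w p) * W^(U.card - S.card)) := by rw [Finset.mul_sum]
      _ ≤ (D / W^U.card) * W^U.card := by gcongr
      _ = D := by field_simp


/-- multiplicative weight attached to `ω` -/
noncomputable def Wt (ω : ℕ → ℕ → ℝ) (a : ℕ) : ℝ := ∏ p ∈ a.primeFactors, ω p (a.factorization p)

lemma Wt_nonneg (ω : ℕ → ℕ → ℝ) (hω : ∀ p ν, 0 ≤ ω p ν) (a : ℕ) : 0 ≤ Wt ω a :=
  Finset.prod_nonneg fun _ _ => hω _ _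

lemma Wt_eq (ω : ℕ → ℕ → ℝ) (U : Finset ℕ) (a : ℕ) (ha : a ≠ 0) (hU : a.primeFactors ⊆ U) :
    Wt ω a = ∏ p ∈ U, (if a.factorization p = 0 then 1 else ω p (a.factorization p)) := by
  unfold Wt
  rw [← Finset.prod_subset hU]
  · apply Finset.prod_congr rfl
    intro p hp
    rw [if_neg]
    rw [← Nat.support_factorization] at hp
    exact Finsupp.mem_support_iff.1 hp
  · intro p _ hp
    rw [if_pos]
    rw [← Nat.support_factorization] at hp
    exact Finsupp.notMem_support_iff.1 hp

lemma euler_bound (ω : ℕ → ℕ → ℝ) (hω : ∀ p ν, 0 ≤ ω p ν) (U A : Finset ℕ) (N : ℕ)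
    (hA : ∀ a ∈ A, a ≠ 0 ∧ a.primeFactors ⊆ U ∧ ∀ p, a.factorization p ≤ N) :
    ∑ a ∈ A, Wt ω a ≤ ∏ p ∈ U, (1 + ∑ ν ∈ Finset.Icc 1 N, ω p ν) := by
  have e1 : ∀ p, 1 + ∑ ν ∈ Finset.Icc 1 N, ω p ν = ∑ ν ∈ Finset.range (N+1), (if ν = 0 then 1 else ω p ν) := by
    intro p
    rw [Finset.sum_range_succ', add_comm]
    congr 1
    rw [Finset.range_eq_Ico, Finset.sum_Ico_add' (fun ν => if ν = 0 then (1:ℝ) else ω p ν) 0 N 1]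
    apply Finset.sum_congr
    · ext; simp
    · intro ν hν
      rw [if_neg]
      simp at hν; omega
  simp_rw [e1]
  rw [Finset.prod_sum]
  set Φ : ℕ → (p : ℕ) → p ∈ U → ℕ := fun a p _ => a.factorization p with hΦ
  have hinj : Set.InjOn Φ (A : Set ℕ) := by
    intro a ha b hb hab
    obtain ⟨ha0, haU, _⟩ := hA a ha
    obtain ⟨hb0, hbU, _⟩ := hA b hb
    apply Nat.eq_of_factorization_eq ha0 hb0
    intro p
    by_cases hp : p ∈ U
    · exact congrFun (congrFun hab p) hp
    · rw [Finsupp.notMem_support_iff.1 (fun h => hp (haU (by rwa [← Nat.support_factorization]))),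
        Finsupp.notMem_support_iff.1 (fun h => hp (hbU (by rwa [← Nat.support_factorization])))]
  calc ∑ a ∈ A, Wt ω a = ∑ a ∈ A, ∏ x ∈ U.attach, (if Φ a x.1 x.2 = 0 then 1 else ω x.1 (Φ a x.1 x.2)) := by
        apply Finset.sum_congr rfl
        intro a ha
        rw [Wt_eq ω U a (hA a ha).1 (hA a ha).2.1, ← Finset.prod_attach]
    _ = ∑ φ ∈ A.image Φ, ∏ x ∈ U.attach, (if φ x.1 x.2 = 0 then 1 else ω x.1 (φ x.1 x.2)) := by
        rw [Finset.sum_image hinj]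
    _ ≤ _ := by
        apply Finset.sum_le_sum_of_subset_of_nonneg
        · intro φ hφ
          obtain ⟨a, ha, rfl⟩ := Finset.mem_image.1 hφ
          rw [Finset.mem_pi]
          intro p hp
          simp only [hΦ, Finset.mem_range]
          have := (hA a ha).2.2 p
          omega
        · intro φ _ _
          apply Finset.prod_nonneg
          intro x _
          split_ifs
          · norm_num
          · exact hω _ _

lemma f_one {f : ℕ → ℝ} (hf : ∀ m n : ℕ, Nat.Coprime m n → f (m * n) = f m + f n) : f 1 = 0 := by
  have := hf 1 1 (by norm_num)
  simp at this
  exact this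

lemma f_prod {f : ℕ → ℝ} (hf : ∀ m n : ℕ, Nat.Coprime m n → f (m * n) = f m + f n) (S : Finset ℕ)
    (hS : ∀ p ∈ S, p.Prime) : f (∏ p ∈ S, p) = ∑ p ∈ S, f p := by
  induction S using Finset.induction_on with
  | empty => simpa using f_one hf
  | insert p S hp ih =>
    rw [Finset.prod_insert hp, Finset.sum_insert hp, hf, ih (fun q hq => hS q (Finset.mem_insert_of_mem hq))]
    apply Nat.Coprime.prod_right
    intro q hq
    exact (Nat.coprime_primes (hS p (Finset.mem_insert_self _ _)) (hS q (Finset.mem_insert_of_mem hq))).2 (fun h => hp (h ▸ hq))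

lemma conc_pos (ω : ℕ → ℕ → ℝ) (hω : ∀ p ν, 0 ≤ ω p ν) (U A : Finset ℕ) (N : ℕ) (hU : ∀ p ∈ U, p.Prime)
    (hA : ∀ a ∈ A, a ≠ 0 ∧ a.primeFactors ⊆ U ∧ ∀ p, a.factorization p ≤ N) (hN : 1 ≤ N)
    (f : ℕ → ℝ) (hf : ∀ m n : ℕ, Nat.Coprime m n → f (m * n) = f m + f n) (h : ℝ) :
    ∑ a ∈ A.filter (fun a => f a = h), Wt ω a ≤
      2 * Real.exp (∑ p ∈ U, ∑ ν ∈ Finset.Icc 1 N, ω p ν) /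
        Real.sqrt (1 + ∑ p ∈ U.filter (fun p => 0 < f p), ω p 1) := by
  set U' := U.filter (fun p => 0 < f p) with hU'
  set s : ℕ → Finset ℕ := fun a => U'.filter (fun p => a.factorization p = 1) with hs
  set m : ℕ → ℕ := fun a => a / ∏ p ∈ s a, p with hm
  have hsprime : ∀ a, ∀ p ∈ s a, p.Prime := fun a p hp =>
    hU p (Finset.mem_filter.1 (Finset.mem_filter.1 hp).1).1
  have hsdvd : ∀ a, ∏ p ∈ s a, p ∣ a := by
    intro a
    apply Finset.prod_primes_dvd
    · intro p hp; exact (hsprime a p hp).prime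
    · intro p hp
      exact Nat.dvd_of_factorization_pos (by rw [(Finset.mem_filter.1 hp).2]; norm_num)
  have hmul : ∀ a, (∏ p ∈ s a, p) * m a = a := fun a => Nat.mul_div_cancel' (hsdvd a)
  have hPne : ∀ a, ∏ p ∈ s a, p ≠ 0 := fun a => (Finset.prod_pos fun p hp => (hsprime a p hp).pos).ne'
  have hmne : ∀ a, a ≠ 0 → m a ≠ 0 := by
    intro a ha h0
    apply ha
    rw [← hmul a, h0, mul_zero]
  have hPfac : ∀ a p, (∏ q ∈ s a, q).factorization p = if p ∈ s a then 1 else 0 := by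
    intro a p
    rw [Nat.factorization_prod (fun q hq => (hsprime a q hq).ne_zero)]
    rw [Finsupp.finsetSum_apply]
    rw [Finset.sum_congr rfl (fun q hq => by rw [(hsprime a q hq).factorization])]
    simp only [Finsupp.single_apply]
    rw [Finset.sum_ite_eq' (s a) p (fun _ => 1)]
  have hmfac : ∀ a p, a ≠ 0 → (m a).factorization p = if p ∈ s a then 0 else a.factorization p := by
    intro a p ha
    have h1 : a.factorization p = (∏ q ∈ s a, q).factorization p + (m a).factorization p := by
      conv_lhs => rw [← hmul a]
      rw [Nat.factorization_mul (hPne a) (hmne a ha)]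
      rfl
    rw [hPfac] at h1
    split_ifs at h1 ⊢ with hp
    · have := (Finset.mem_filter.1 hp).2
      omega
    · omega
  have hcop : ∀ a, a ≠ 0 → Nat.Coprime (∏ p ∈ s a, p) (m a) := by
    intro a ha
    apply Nat.Coprime.prod_left
    intro p hp
    rw [Nat.Prime.coprime_iff_not_dvd (hsprime a p hp)]
    intro hd
    have := (Nat.Prime.dvd_iff_one_le_factorization (hsprime a p hp) (hmne a ha)).1 hd
    rw [hmfac a p ha, if_pos hp] at this
    omega
  have hfa : ∀ a, a ≠ 0 → f a = ∑ p ∈ s a, f p + f (m a) := by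
    intro a ha
    conv_lhs => rw [← hmul a]
    rw [hf _ _ (hcop a ha), f_prod hf (s a) (hsprime a)]
  set ω' : ℕ → ℕ → ℝ := fun p ν => if p ∈ U' ∧ ν = 1 then 0 else ω p ν with hω'
  have hω'0 : ∀ p ν, 0 ≤ ω' p ν := by
    intro p ν; simp only [hω']; split_ifs
    · exact le_rfl
    · exact hω _ _
  have hWm : ∀ a ∈ A, Wt ω a = (∏ p ∈ s a, ω p 1) * Wt ω' (m a) := by
    intro a ha
    obtain ⟨ha0, haU, _⟩ := hA a ha
    have hmU : (m a).primeFactors ⊆ U := (Nat.primeFactors_mono ⟨_, by rw [mul_comm]; exact (hmul a).symm⟩ ha0).trans haU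
    rw [Wt_eq ω U a ha0 haU, Wt_eq ω' U (m a) (hmne a ha0) hmU]
    have hsU : s a ⊆ U := fun p hp => (Finset.mem_filter.1 (Finset.mem_filter.1 hp).1).1
    have e : ∏ p ∈ s a, ω p 1 = ∏ p ∈ U, (if p ∈ s a then ω p 1 else 1) := by
      rw [← Finset.prod_filter, Finset.filter_mem_eq_inter, Finset.inter_eq_right.2 hsU]
    rw [e, ← Finset.prod_mul_distrib]
    apply Finset.prod_congr rfl
    intro p hp
    rw [hmfac a p ha0]
    by_cases hps : p ∈ s a
    · have := (Finset.mem_filter.1 hps).2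
      simp [hps, this]
    · simp only [hps, if_false, one_mul]
      split_ifs with h0
      · rfl
      · simp only [hω']
        rw [if_neg]
        rintro ⟨h1, h2⟩
        exact hps (Finset.mem_filter.2 ⟨h1, h2⟩)
  set A' := A.image m with hA'
  set E := ∑ p ∈ U', ω p 1 with hE
  have hE0 : 0 ≤ E := Finset.sum_nonneg fun _ _ => hω _ _
  set D := 2 * Real.exp E / Real.sqrt (1 + E) with hD
  have step1 : ∑ a ∈ A.filter (fun a => f a = h), Wt ω a ≤ ∑ b ∈ A', Wt ω' b * D := by
    rw [← Finset.sum_fiberwise_of_maps_to (g := m) (t := A') (fun a ha => Finset.mem_image_of_mem _ (Finset.mem_filter.1 ha).1)]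
    apply Finset.sum_le_sum
    intro b _
    set G := (A.filter (fun a => f a = h)).filter (fun a => m a = b) with hG
    have hGm : ∀ a ∈ G, a ∈ A ∧ f a = h ∧ m a = b := fun a ha =>
      ⟨(Finset.mem_filter.1 (Finset.mem_filter.1 ha).1).1, (Finset.mem_filter.1 (Finset.mem_filter.1 ha).1).2, (Finset.mem_filter.1 ha).2⟩
    have e1 : ∑ a ∈ G, Wt ω a = Wt ω' b * ∑ a ∈ G, ∏ p ∈ s a, ω p 1 := by
      rw [Finset.mul_sum]
      apply Finset.sum_congr rfl
      intro a ha
      rw [hWm a (hGm a ha).1, (hGm a ha).2.2, mul_comm]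
    rw [e1]
    apply mul_le_mul_of_nonneg_left _ (Wt_nonneg _ hω'0 _)
    have hinj : Set.InjOn s (G : Set ℕ) := by
      intro a ha a' ha' haa
      rw [← hmul a, ← hmul a', (hGm a ha).2.2, (hGm a' ha').2.2, haa]
    have e2 : ∑ a ∈ G, ∏ p ∈ s a, ω p 1 = ∑ S ∈ G.image s, ∏ p ∈ S, ω p 1 := by
      rw [Finset.sum_image hinj]
    rw [e2]
    apply antichain_sum U' (fun p => ω p 1) (fun _ _ => hω _ _)
    · intro S hS
      obtain ⟨a, _, rfl⟩ := Finset.mem_image.1 hS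
      exact Finset.filter_subset _ _
    · intro S hS T hT hST
      obtain ⟨a, ha, rfl⟩ := Finset.mem_image.1 hS
      obtain ⟨a', ha', rfl⟩ := Finset.mem_image.1 hT
      by_contra hne
      have hlt : ∑ p ∈ s a, f p < ∑ p ∈ s a', f p := by
        obtain ⟨q, hq, hqn⟩ := Finset.exists_of_ssubset (hST.ssubset_of_ne hne)
        apply Finset.sum_lt_sum_of_subset hST hq hqn
        · exact (Finset.mem_filter.1 (Finset.mem_filter.1 hq).1).2
        · intro p hp _
          exact (Finset.mem_filter.1 (Finset.mem_filter.1 hp).1).2.le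
      have h1 := hfa a (hA a (hGm a ha).1).1
      have h2 := hfa a' (hA a' (hGm a' ha').1).1
      rw [(hGm a ha).2.1, (hGm a ha).2.2] at h1
      rw [(hGm a' ha').2.1, (hGm a' ha').2.2] at h2
      linarith
  have step2 : ∑ b ∈ A', Wt ω' b ≤ Real.exp (∑ p ∈ U, ∑ ν ∈ Finset.Icc 1 N, ω' p ν) := by
    refine (euler_bound ω' hω'0 U A' N ?_).trans ?_
    · intro b hb
      obtain ⟨a, ha, rfl⟩ := Finset.mem_image.1 hb
      obtain ⟨ha0, haU, haN⟩ := hA a ha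
      refine ⟨hmne a ha0, (Nat.primeFactors_mono ⟨_, by rw [mul_comm]; exact (hmul a).symm⟩ ha0).trans haU, ?_⟩
      intro p
      rw [hmfac a p ha0]
      split_ifs
      · omega
      · exact haN p
    · exact prod_one_add_le_exp U _ (fun p _ => Finset.sum_nonneg fun _ _ => hω'0 _ _)
  have step3 : ∑ p ∈ U, ∑ ν ∈ Finset.Icc 1 N, ω' p ν + E = ∑ p ∈ U, ∑ ν ∈ Finset.Icc 1 N, ω p ν := by
    rw [hE, hU', Finset.sum_filter, ← Finset.sum_add_distrib]
    apply Finset.sum_congr rfl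
    intro p hp
    rw [← Finset.add_sum_erase (Finset.Icc 1 N) (ω' p) (a := 1) (by simp [hN]),
      ← Finset.add_sum_erase (Finset.Icc 1 N) (ω p) (a := 1) (by simp [hN])]
    have e1 : ∑ ν ∈ (Finset.Icc 1 N).erase 1, ω' p ν = ∑ ν ∈ (Finset.Icc 1 N).erase 1, ω p ν := by
      apply Finset.sum_congr rfl
      intro ν hν
      simp only [hω']
      rw [if_neg]
      rintro ⟨_, h1⟩
      exact (Finset.mem_erase.1 hν).1 h1
    rw [e1]
    simp only [hω', hU', Finset.mem_filter, hp, true_and, and_true]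
    split_ifs <;> ring
  have hD0 : 0 ≤ D := by positivity
  calc _ ≤ _ := step1
    _ = (∑ b ∈ A', Wt ω' b) * D := by rw [Finset.sum_mul]
    _ ≤ Real.exp (∑ p ∈ U, ∑ ν ∈ Finset.Icc 1 N, ω' p ν) * D := by gcongr
    _ = _ := by
      rw [← step3, Real.exp_add, hD]
      ring

lemma conc (ω : ℕ → ℕ → ℝ) (hω : ∀ p ν, 0 ≤ ω p ν) (U A : Finset ℕ) (N : ℕ) (hU : ∀ p ∈ U, p.Prime)
    (hA : ∀ a ∈ A, a ≠ 0 ∧ a.primeFactors ⊆ U ∧ ∀ p, a.factorization p ≤ N) (hN : 1 ≤ N)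
    (f : ℕ → ℝ) (hf : ∀ m n : ℕ, Nat.Coprime m n → f (m * n) = f m + f n) (h : ℝ) :
    ∑ a ∈ A.filter (fun a => f a = h), Wt ω a ≤
      4 * Real.exp (∑ p ∈ U, ∑ ν ∈ Finset.Icc 1 N, ω p ν) /
        Real.sqrt (1 + ∑ p ∈ U.filter (fun p => f p ≠ 0), ω p 1) := by
  have h1 := conc_pos ω hω U A N hU hA hN f hf h
  have h2 := conc_pos ω hω U A N hU hA hN (fun n => - f n) (fun m n hmn => by simp only [hf m n hmn]; ring) (-h)
  simp only [neg_inj, Left.neg_pos_iff] at h2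
  set P := ∑ p ∈ U.filter (fun p => 0 < f p), ω p 1 with hP
  set Q := ∑ p ∈ U.filter (fun p => f p < 0), ω p 1 with hQ
  have hP0 : 0 ≤ P := Finset.sum_nonneg fun _ _ => hω _ _
  have hQ0 : 0 ≤ Q := Finset.sum_nonneg fun _ _ => hω _ _
  have hsum : ∑ p ∈ U.filter (fun p => f p ≠ 0), ω p 1 = P + Q := by
    rw [hP, hQ, ← Finset.sum_union]
    · apply Finset.sum_congr _ (fun _ _ => rfl)
      ext p
      simp only [Finset.mem_filter, Finset.mem_union]
      constructor
      · rintro ⟨a, b⟩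
        rcases lt_or_gt_of_ne b with b | b
        · right; exact ⟨a, b⟩
        · left; exact ⟨a, b⟩
      · rintro (⟨a, b⟩ | ⟨a, b⟩)
        · exact ⟨a, b.ne'⟩
        · exact ⟨a, b.ne⟩
    · rw [Finset.disjoint_left]
      intro p hp hq
      linarith [(Finset.mem_filter.1 hp).2, (Finset.mem_filter.1 hq).2]
  rw [hsum]
  set X := Real.exp (∑ p ∈ U, ∑ ν ∈ Finset.Icc 1 N, ω p ν) with hX
  have hX0 : 0 < X := Real.exp_pos _
  have key : ∀ R, 0 ≤ R → P + Q ≤ 2 * R → 2 * X / Real.sqrt (1 + R) ≤ 4 * X / Real.sqrt (1 + (P + Q)) := by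
    intro R hR hPQ
    have : Real.sqrt (1 + (P+Q)) ≤ 2 * Real.sqrt (1 + R) := by
      rw [Real.sqrt_le_left (by positivity), mul_pow, Real.sq_sqrt (by linarith)]
      linarith
    rw [div_le_div_iff₀ (Real.sqrt_pos.2 (by linarith)) (Real.sqrt_pos.2 (by linarith))]
    nlinarith
  rcases le_total P Q with hh | hh
  · exact h2.trans (key Q hQ0 (by linarith))
  · exact h1.trans (key P hP0 (by linarith))


/-- data extracted from the polynomials -/
structure PD (r : ℕ) (Qs : Fin r → Polynomial ℤ) (K P0 : ℕ) : Prop where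
  hr : 1 ≤ r
  hK : 1 ≤ K
  hP0 : 2 * (r * K) + 1 ≤ P0
  rho_le : ∀ j p ν, p.Prime → rho (Qs j) (p^ν) ≤ K
  disj : ∀ p : ℕ, p.Prime → P0 < p → ∀ i j, i ≠ j → ∀ n : ℤ, (p:ℤ) ∣ (Qs i).eval n → ¬ (p:ℤ) ∣ (Qs j).eval n
  fib : ∀ j c, ∀ s : Finset ℤ, (∀ n ∈ s, (Qs j).eval n = c) → s.card ≤ K
  size : ∀ j, ∀ n : ℤ, 1 ≤ n → |(Qs j).eval n| ≤ K * n^K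

lemma exists_PD (r : ℕ) (Qs : Fin r → Polynomial ℤ) (hr : 1 ≤ r) (hirr : ∀ j, Irreducible (Qs j))
    (hcop : ∀ i j, i ≠ j → IsRelPrime (Qs i) (Qs j))
    (hnofix : ∀ p : ℕ, p.Prime → rho (∏ j, Qs j) p < p) : ∃ K P0, PD r Qs K P0 := by
  obtain ⟨K, P0, h1, h2, h3, h4, h5⟩ := poly_data r Qs hirr hcop hnofix
  exact ⟨K, max P0 (2 * (r*K) + 1), hr, h1, le_max_right _ _, h2,
    fun p hp h => h3 p hp (lt_of_le_of_lt (le_max_left _ _) h), h4, h5⟩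

lemma per_dvd (Q : Polynomial ℤ) (m : ℕ) : Per (fun n => (m:ℤ) ∣ Q.eval n) m := by
  intro a b hab h
  have h1 : (m:ℤ) ∣ Q.eval a - Q.eval b := hab.trans (Polynomial.sub_dvd_eval_sub a b Q)
  have := dvd_sub h h1
  simpa using this

lemma cnt_dvd (Q : Polynomial ℤ) (m : ℕ) : cnt (fun n => (m:ℤ) ∣ Q.eval n) m = rho Q m := by
  rw [rho_eq]; unfold cnt; congr!

lemma cnt_mul {P : ℤ → Prop} {m : ℕ} (hP : Per P m) (k : ℕ) : cnt P (m * k) = k * cnt P m := by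
  have hper : Function.Periodic (fun n : ℕ => P (n:ℤ)) m := by
    intro n
    apply propext
    constructor
    · apply hP; push_cast; simp
    · apply hP; push_cast; simp
  induction k with
  | zero => simp [cnt]
  | succ k ih =>
    unfold cnt at *
    have h1 := Nat.filter_Ico_card_eq_of_periodic (m*k) m (fun n : ℕ => P (n:ℤ)) hper
    have h2 := Nat.count_eq_card_filter_range (fun n : ℕ => P (n:ℤ)) m
    have e : Finset.range (m * (k+1)) = Finset.range (m*k) ∪ Finset.Ico (m*k) (m*k+m) := by
      ext x; simp [mul_add]; omega
    rw [e, Finset.filter_union, Finset.card_union_of_disjoint, ih, h1, h2]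
    · ring
    · rw [Finset.disjoint_left]
      intro x hx hy
      simp at hx hy
      omega

lemma cnt_mono {P P' : ℤ → Prop} (h : ∀ n, P n → P' n) (m : ℕ) : cnt P m ≤ cnt P' m := by
  unfold cnt
  apply Finset.card_le_card
  intro n hn
  rw [Finset.mem_filter] at *
  exact ⟨hn.1, h _ hn.2⟩

lemma cnt_eq_zero {P : ℤ → Prop} (h : ∀ n, ¬ P n) (m : ℕ) : cnt P m = 0 := by
  unfold cnt
  rw [Finset.card_eq_zero]
  apply Finset.eq_empty_of_forall_notMem
  intro n hn
  exact h _ (Finset.mem_filter.1 hn).2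

/-- local weights bounding densities -/
noncomputable def om0 (r K P0 : ℕ) (Q : Polynomial ℤ) (p ν : ℕ) : ℝ :=
  if p ≤ P0 then K * (p:ℝ)^(-((ν:ℝ)/r)) else if ν = 1 then (rho Q p : ℝ)/p else K / (p:ℝ)^ν

lemma om0_nonneg (r K P0 : ℕ) (Q : Polynomial ℤ) (p ν : ℕ) : 0 ≤ om0 r K P0 Q p ν := by
  unfold om0; split_ifs <;> positivity

lemma local_density {r : ℕ} {Qs : Fin r → Polynomial ℤ} {K P0 : ℕ} (D : PD r Qs K P0) (p : ℕ) (hp : p.Prime)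
    (e : Fin r → ℕ) :
    (cnt (fun n => ∀ j, ((p^(e j) : ℕ):ℤ) ∣ (Qs j).eval n) (p^(∑ j, e j)) : ℝ) / ((p^(∑ j, e j) : ℕ) : ℝ) ≤
      ∏ j ∈ Finset.univ.filter (fun j => e j ≠ 0), om0 r K P0 (Qs j) p (e j) := by
  have hp0 : (0:ℝ) < p := by exact_mod_cast hp.pos
  have hp1 : (1:ℝ) ≤ p := by exact_mod_cast hp.one_lt.le
  have hKr : (1:ℝ) ≤ K := by exact_mod_cast D.hK
  have hrr : (0:ℝ) < r := by exact_mod_cast D.hr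
  have single : ∀ j, (cnt (fun n => ∀ j, ((p^(e j) : ℕ):ℤ) ∣ (Qs j).eval n) (p^(∑ j, e j)) : ℝ) / ((p^(∑ j, e j) : ℕ) : ℝ) ≤
      (rho (Qs j) (p^(e j)) : ℝ) / (p:ℝ)^(e j) := by
    intro j
    have hle : e j ≤ ∑ j, e j := Finset.single_le_sum (fun _ _ => Nat.zero_le _) (Finset.mem_univ j)
    have h1 : cnt (fun n => ∀ j, ((p^(e j) : ℕ):ℤ) ∣ (Qs j).eval n) (p^(∑ j, e j)) ≤
        p^(∑ j, e j - e j) * rho (Qs j) (p^(e j)) := by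
      have h2 := cnt_mul (per_dvd (Qs j) (p^(e j))) (p^(∑ j, e j - e j))
      rw [← pow_add, Nat.add_sub_cancel' hle, cnt_dvd] at h2
      rw [← h2]
      exact cnt_mono (fun n h => h j) _
    rw [div_le_div_iff₀ (by push_cast; positivity) (by positivity)]
    have h3 : ((p^(∑ j, e j) : ℕ):ℝ) = (p:ℝ)^(∑ j, e j - e j) * (p:ℝ)^(e j) := by
      push_cast
      rw [← pow_add, Nat.sub_add_cancel hle]
    rw [h3]
    have h4 : (cnt (fun n => ∀ j, ((p^(e j) : ℕ):ℤ) ∣ (Qs j).eval n) (p^(∑ j, e j)) : ℝ) ≤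
        (p:ℝ)^(∑ j, e j - e j) * rho (Qs j) (p^(e j)) := by exact_mod_cast h1
    have h5 := mul_le_mul_of_nonneg_right h4 (by positivity : (0:ℝ) ≤ (p:ℝ)^(e j))
    linarith
  by_cases hpP : p ≤ P0
  · obtain ⟨j0, _, hj0⟩ := Finset.exists_max_image (Finset.univ : Finset (Fin r)) e ⟨⟨0, D.hr⟩, Finset.mem_univ _⟩
    by_cases hz : e j0 = 0
    · have hall : ∀ j, e j = 0 := fun j => by have := hj0 j (Finset.mem_univ _); omega
      have : Finset.univ.filter (fun j => e j ≠ 0) = ∅ := by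
        apply Finset.filter_eq_empty_iff.2; intro j _; simp [hall j]
      rw [this]
      simp only [hall]
      simp [cnt]
    · have h1 : (rho (Qs j0) (p^(e j0)) : ℝ) / (p:ℝ)^(e j0) ≤ K * (p:ℝ)^(-(e j0:ℝ)) := by
        rw [Real.rpow_neg hp0.le, Real.rpow_natCast, ← div_eq_mul_inv]
        have := D.rho_le j0 p (e j0) hp
        gcongr
      refine (single j0).trans (h1.trans ?_)
      have h2 : ∏ j ∈ Finset.univ.filter (fun j => e j ≠ 0), om0 r K P0 (Qs j) p (e j)
          = (∏ j ∈ Finset.univ.filter (fun j => e j ≠ 0), (K:ℝ)) * (p:ℝ)^(-∑ j ∈ Finset.univ.filter (fun j => e j ≠ 0), (e j:ℝ)/r) := by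
        rw [← Finset.sum_neg_distrib, Real.rpow_sum_of_pos hp0, ← Finset.prod_mul_distrib]
        apply Finset.prod_congr rfl
        intro j _
        unfold om0
        rw [if_pos hpP]
      rw [h2]
      have h3 : (K:ℝ) ≤ ∏ j ∈ Finset.univ.filter (fun j => e j ≠ 0), (K:ℝ) := by
        rw [Finset.prod_const]
        apply le_self_pow₀ hKr
        have : j0 ∈ Finset.univ.filter (fun j => e j ≠ 0) := by simp [hz]
        exact (Finset.card_pos.2 ⟨j0, this⟩).ne'
      have h4 : ∑ j ∈ Finset.univ.filter (fun j => e j ≠ 0), (e j:ℝ)/r ≤ e j0 := by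
        calc ∑ j ∈ Finset.univ.filter (fun j => e j ≠ 0), (e j:ℝ)/r ≤ ∑ j : Fin r, (e j0:ℝ)/r := by
              refine (Finset.sum_le_sum_of_subset_of_nonneg (Finset.filter_subset _ _) (fun _ _ _ => by positivity)).trans ?_
              apply Finset.sum_le_sum
              intro j _
              have := hj0 j (Finset.mem_univ _)
              gcongr
          _ = e j0 := by
              rw [Finset.sum_const, Finset.card_univ, Fintype.card_fin, nsmul_eq_mul]
              field_simp
      have h5 : (p:ℝ)^(-(e j0:ℝ)) ≤ (p:ℝ)^(-∑ j ∈ Finset.univ.filter (fun j => e j ≠ 0), (e j:ℝ)/r) := by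
        apply Real.rpow_le_rpow_of_exponent_le hp1
        linarith
      gcongr
  · push Not at hpP
    by_cases h2 : ∃ i j, i ≠ j ∧ e i ≠ 0 ∧ e j ≠ 0
    · obtain ⟨i, j, hij, hi, hj⟩ := h2
      have : cnt (fun n => ∀ j, ((p^(e j) : ℕ):ℤ) ∣ (Qs j).eval n) (p^(∑ j, e j)) = 0 := by
        apply cnt_eq_zero
        intro n hn
        refine D.disj p hp hpP i j hij n ((dvd_trans ?_ (hn i))) (dvd_trans ?_ (hn j))
        · exact_mod_cast dvd_pow_self p hi
        · exact_mod_cast dvd_pow_self p hj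
      rw [this]
      simp only [Nat.cast_zero, zero_div]
      exact Finset.prod_nonneg fun _ _ => om0_nonneg _ _ _ _ _ _
    · push Not at h2
      by_cases h3 : ∃ j, e j ≠ 0
      · obtain ⟨j, hj⟩ := h3
        have : Finset.univ.filter (fun j => e j ≠ 0) = {j} := by
          ext i
          simp only [Finset.mem_filter, Finset.mem_univ, true_and, Finset.mem_singleton]
          constructor
          · intro hi
            by_contra hij
            exact hj (h2 i j hij hi)
          · rintro rfl; exact hj
        rw [this, Finset.prod_singleton]
        refine (single j).trans ?_
        unfold om0
        rw [if_neg (by omega)]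
        split_ifs with h1
        · rw [h1]; simp
        · have := D.rho_le j p (e j) hp
          gcongr
      · push Not at h3
        have : Finset.univ.filter (fun j => e j ≠ 0) = ∅ := by
          apply Finset.filter_eq_empty_iff.2; intro j _; simp [h3 j]
        rw [this]
        simp only [h3]
        simp [cnt]

lemma per_all {r : ℕ} (Qs : Fin r → Polynomial ℤ) (a : Fin r → ℕ) :
    Per (fun n => ∀ j, (a j:ℤ) ∣ (Qs j).eval n) (∏ j, a j) := by
  intro x y hxy h j
  exact (per_dvd (Qs j) (a j)).mono (Finset.dvd_prod_of_mem a (Finset.mem_univ j)) x y hxy (h j)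

lemma density {r : ℕ} {Qs : Fin r → Polynomial ℤ} {K P0 : ℕ} (D : PD r Qs K P0) (a : Fin r → ℕ) (ha : ∀ j, a j ≠ 0) :
    (cnt (fun n => ∀ j, (a j:ℤ) ∣ (Qs j).eval n) (∏ j, a j) : ℝ) / ((∏ j, a j : ℕ):ℝ) ≤
      ∏ j, Wt (om0 r K P0 (Qs j)) (a j) := by
  set M := ∏ j, a j with hM
  have hM0 : M ≠ 0 := Finset.prod_ne_zero_iff.2 fun j _ => ha j
  have hfac : ∀ p, M.factorization p = ∑ j, (a j).factorization p := by
    intro p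
    rw [hM, Nat.factorization_prod (fun j _ => ha j), Finsupp.finsetSum_apply]
  have hMprod : M = ∏ p ∈ M.primeFactors, p^(∑ j, (a j).factorization p) := by
    conv_lhs => rw [← Nat.prod_factorization_pow_eq_self hM0]
    rw [Finsupp.prod, Nat.support_factorization]
    exact Finset.prod_congr rfl fun p _ => by rw [hfac]
  have hiff : ∀ n : ℤ, (∀ j, (a j:ℤ) ∣ (Qs j).eval n) ↔
      ∀ p ∈ M.primeFactors, ∀ j, ((p^((a j).factorization p) : ℕ):ℤ) ∣ (Qs j).eval n := by
    intro n
    constructor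
    · intro h p _ j
      exact dvd_trans (by exact_mod_cast Nat.ordProj_dvd (a j) p) (h j)
    · intro h j
      have e : a j = ∏ p ∈ (a j).primeFactors, p^((a j).factorization p) := by
        conv_lhs => rw [← Nat.prod_factorization_pow_eq_self (ha j)]
        rw [Finsupp.prod, Nat.support_factorization]
      rw [e, Int.natCast_dvd]
      apply Finset.prod_dvd_of_isRelPrime
      · intro p hp q hq hpq
        change IsRelPrime (p^_) (q^_)
        rw [← Nat.coprime_iff_isRelPrime]
        apply Nat.Coprime.pow
        exact (Nat.coprime_primes (Nat.prime_of_mem_primeFactors hp) (Nat.prime_of_mem_primeFactors hq)).2 hpq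
      · intro p hp
        have hpM : p ∈ M.primeFactors := Nat.primeFactors_mono (Finset.dvd_prod_of_mem a (Finset.mem_univ j)) hM0 hp
        have := h p hpM j
        rwa [Int.natCast_dvd] at this
  have hcrt := crt_prod M.primeFactors (fun p n => ∀ j, ((p^((a j).factorization p) : ℕ):ℤ) ∣ (Qs j).eval n)
    (fun p => p^(∑ j, (a j).factorization p))
    (fun p _ => by
      have := per_all Qs (fun j => p^((a j).factorization p))
      rwa [Finset.prod_pow_eq_pow_sum] at this)
    (fun p hp => pow_pos (Nat.prime_of_mem_primeFactors hp).pos _)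
    (fun p hp q hq hpq => Nat.Coprime.pow _ _ ((Nat.coprime_primes (Nat.prime_of_mem_primeFactors hp) (Nat.prime_of_mem_primeFactors hq)).2 hpq))
  have e1 : (fun n : ℤ => ∀ j, (a j:ℤ) ∣ (Qs j).eval n) = (fun n : ℤ => ∀ p ∈ M.primeFactors, ∀ j, ((p^((a j).factorization p) : ℕ):ℤ) ∣ (Qs j).eval n) := by
    funext n; exact propext (hiff n)
  rw [e1]
  have h2 := hcrt.2
  rw [← hMprod] at h2
  rw [h2]
  have h3 : (M:ℝ) = ∏ p ∈ M.primeFactors, ((p^(∑ j, (a j).factorization p) : ℕ):ℝ) := by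
    conv_lhs => rw [hMprod]
    push_cast
    rfl
  rw [h3]
  push_cast [Nat.cast_prod]
  rw [← Finset.prod_div_distrib]
  calc _ ≤ ∏ p ∈ M.primeFactors, ∏ j ∈ Finset.univ.filter (fun j => (a j).factorization p ≠ 0), om0 r K P0 (Qs j) p ((a j).factorization p) := by
        apply Finset.prod_le_prod
        · intros; positivity
        · intro p hp
          have := local_density D p (Nat.prime_of_mem_primeFactors hp) (fun j => (a j).factorization p)
          push_cast at this
          exact this
    _ = ∏ p ∈ M.primeFactors, ∏ j, (if (a j).factorization p = 0 then 1 else om0 r K P0 (Qs j) p ((a j).factorization p)) := by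
        apply Finset.prod_congr rfl
        intro p _
        rw [Finset.prod_filter]
        apply Finset.prod_congr rfl
        intro j _
        by_cases h0 : (a j).factorization p = 0
        · rw [if_neg (fun h => h h0), if_pos h0]
        · rw [if_pos h0, if_neg h0]
    _ = _ := by
        rw [Finset.prod_comm]
        apply Finset.prod_congr rfl
        intro j _
        rw [Wt_eq _ M.primeFactors (a j) (ha j) (Nat.primeFactors_mono (Finset.dvd_prod_of_mem a (Finset.mem_univ j)) hM0)]


/-- `R(t) = ∑_{p ≤ t} ρ(p)/p` -/
noncomputable def Rr (Q : Polynomial ℤ) (t : ℝ) : ℝ := ∑ p ∈ primesBelow t, (rho Q p : ℝ) / p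

lemma rho_prime_le' {r : ℕ} {Qs : Fin r → Polynomial ℤ} {K P0 : ℕ} (D : PD r Qs K P0) (j : Fin r) {p : ℕ} (hp : p.Prime) :
    rho (Qs j) p ≤ K := by
  have := D.rho_le j p 1 hp
  simpa using this

/-- sieving event -/
def Om {r : ℕ} (Qs : Fin r → Polynomial ℤ) (p : ℕ) (n : ℤ) : Prop := ∃ j, (p:ℤ) ∣ (Qs j).eval n

lemma per_Om {r : ℕ} (Qs : Fin r → Polynomial ℤ) (p : ℕ) : Per (Om Qs p) p := by
  rintro a b hab ⟨j, hj⟩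
  exact ⟨j, per_dvd (Qs j) p a b hab hj⟩

lemma cnt_Om_le {r : ℕ} {Qs : Fin r → Polynomial ℤ} {K P0 : ℕ} (D : PD r Qs K P0) {p : ℕ} (hp : p.Prime) :
    cnt (Om Qs p) p ≤ r * K := by
  have h1 : cnt (Om Qs p) p ≤ ∑ j : Fin r, cnt (fun n => (p:ℤ) ∣ (Qs j).eval n) p := by
    unfold cnt
    refine le_trans (Finset.card_le_card ?_) (Finset.card_biUnion_le (s := Finset.univ)
      (t := fun j : Fin r => (Finset.range p).filter fun n : ℕ => (p:ℤ) ∣ (Qs j).eval (n:ℤ))) |>.trans (le_of_eq ?_)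
    · intro n hn
      obtain ⟨h1, j, hj⟩ := Finset.mem_filter.1 hn
      exact Finset.mem_biUnion.2 ⟨j, Finset.mem_univ _, Finset.mem_filter.2 ⟨h1, hj⟩⟩
    · apply Finset.sum_congr rfl
      intro j _
      congr!
  refine h1.trans ?_
  calc _ ≤ ∑ j : Fin r, K := Finset.sum_le_sum fun j _ => by rw [cnt_dvd]; exact rho_prime_le' D j hp
    _ = r * K := by simp

lemma cnt_Om_ge {r : ℕ} {Qs : Fin r → Polynomial ℤ} {K P0 : ℕ} (D : PD r Qs K P0) {p : ℕ} (hp : p.Prime) (h : P0 < p) :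
    ∑ j, rho (Qs j) p ≤ cnt (Om Qs p) p := by
  simp_rw [rho_eq]
  rw [← Finset.card_biUnion]
  · unfold cnt
    apply Finset.card_le_card
    intro n hn
    obtain ⟨j, _, hj⟩ := Finset.mem_biUnion.1 hn
    obtain ⟨h1, h2⟩ := Finset.mem_filter.1 hj
    exact Finset.mem_filter.2 ⟨h1, j, h2⟩
  · intro i _ j _ hij
    simp only [Function.onFun]
    rw [Finset.disjoint_left]
    intro n hn hn'
    exact D.disj p hp h i j hij n (Finset.mem_filter.1 hn).2 (Finset.mem_filter.1 hn').2

lemma sum_biUnion_le_aux {ι : Type*} (s : Finset ι) (t : ι → Finset ℕ) (g : ℕ → ℝ) (hg : ∀ p, 0 ≤ g p) :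
    ∑ p ∈ s.biUnion t, g p ≤ ∑ i ∈ s, ∑ p ∈ t i, g p := by
  induction s using Finset.induction_on with
  | empty => simp
  | insert i s hi ih =>
    rw [Finset.biUnion_insert, Finset.sum_insert hi]
    have h1 := Finset.sum_union_inter (s₁ := t i) (s₂ := s.biUnion t) (f := g)
    have h2 : 0 ≤ ∑ p ∈ t i ∩ s.biUnion t, g p := Finset.sum_nonneg fun p _ => hg p
    linarith

lemma sieve_a {r : ℕ} {Qs : Fin r → Polynomial ℤ} {K P0 : ℕ} (D : PD r Qs K P0) :
    ∃ C : ℝ, 0 < C ∧ ∀ (t x y : ℝ) (a : Fin r → ℕ), 1 < t → (∀ j, a j ≠ 0) →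
      t^(4+4*(r*K)) * ((∏ j, a j : ℕ):ℝ) ≤ y →
      (((Iv x y).filter (fun n => (∀ j, (a j:ℤ) ∣ (Qs j).eval n) ∧
        ∀ p : ℕ, p.Prime → (p:ℝ) ≤ t → (∀ j, ¬ p ∣ a j) → ∀ j, ¬ (p:ℤ) ∣ (Qs j).eval n)).card : ℝ) ≤
      C * y * Real.exp (- ∑ j, Rr (Qs j) t) *
        ∏ j, Wt (fun p ν => om0 r K P0 (Qs j) p ν * Real.exp ((r*K:ℕ)/p)) (a j) := by
  set g := r * K with hg
  have hg1 : 1 ≤ g := Nat.mul_pos D.hr D.hK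
  obtain ⟨C, hC, hs⟩ := sieve2 g hg1
  refine ⟨C * Real.exp (g * (P0+1)), by positivity, ?_⟩
  intro t x y a ht ha hy
  set M := ∏ j, a j with hM
  have hM0 : M ≠ 0 := Finset.prod_ne_zero_iff.2 fun j _ => ha j
  have hM' : (0:ℝ) < M := by exact_mod_cast Nat.pos_of_ne_zero hM0
  have hy0 : 0 ≤ y := le_trans (by positivity) hy
  set Ps := (primesBelow t).filter (fun p => P0 < p ∧ ¬ p ∣ M) with hPs
  have hmem : ∀ p ∈ Ps, p.Prime ∧ (p:ℝ) ≤ t ∧ P0 < p ∧ ¬ p ∣ M := by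
    intro p hp
    obtain ⟨h1, h2, h3⟩ := Finset.mem_filter.1 hp
    rw [mem_primesBelow'] at h1
    exact ⟨h1.1, h1.2, h2, h3⟩
  have h1 := hs t x y Ps (Om Qs) M (fun n => ∀ j, (a j:ℤ) ∣ (Qs j).eval n) ht (Nat.pos_of_ne_zero hM0) hy (per_all Qs a)
    (fun p hp => ⟨(hmem p hp).1, (hmem p hp).2.1, by have := D.hP0; have := (hmem p hp).2.2.1; omega, (hmem p hp).2.2.2⟩)
    (fun p _ => per_Om Qs p) (fun p hp => cnt_Om_le D (hmem p hp).1)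
  have h2 : (((Iv x y).filter (fun n => (∀ j, (a j:ℤ) ∣ (Qs j).eval n) ∧
        ∀ p : ℕ, p.Prime → (p:ℝ) ≤ t → (∀ j, ¬ p ∣ a j) → ∀ j, ¬ (p:ℤ) ∣ (Qs j).eval n)).card : ℝ) ≤
      (((Iv x y).filter (fun n => (∀ j, (a j:ℤ) ∣ (Qs j).eval n) ∧ ∀ p ∈ Ps, ¬ Om Qs p n)).card : ℝ) := by
    have : ((Iv x y).filter (fun n => (∀ j, (a j:ℤ) ∣ (Qs j).eval n) ∧
        ∀ p : ℕ, p.Prime → (p:ℝ) ≤ t → (∀ j, ¬ p ∣ a j) → ∀ j, ¬ (p:ℤ) ∣ (Qs j).eval n)) ⊆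
      ((Iv x y).filter (fun n => (∀ j, (a j:ℤ) ∣ (Qs j).eval n) ∧ ∀ p ∈ Ps, ¬ Om Qs p n)) := by
      intro n hn
      simp only [Finset.mem_filter] at hn ⊢
      refine ⟨hn.1, hn.2.1, ?_⟩
      rintro p hp ⟨j, hj⟩
      obtain ⟨hp1, hp2, _, hp4⟩ := hmem p hp
      exact hn.2.2 p hp1 hp2 (fun i hi => hp4 (hi.trans (Finset.dvd_prod_of_mem a (Finset.mem_univ i)))) j hj
    exact_mod_cast Finset.card_le_card this
  refine h2.trans ?_
  have h1' : (((Iv x y).filter (fun n => (∀ j, (a j:ℤ) ∣ (Qs j).eval n) ∧ ∀ p ∈ Ps, ¬ Om Qs p n)).card : ℝ) ≤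
      C * y * (cnt (fun n => ∀ j, (a j:ℤ) ∣ (Qs j).eval n) M / M) * Real.exp (- ∑ p ∈ Ps, (cnt (Om Qs p) p : ℝ) / p) := by
    convert h1
  refine h1'.trans ?_
  have hden := density D a ha
  have hexp : - ∑ p ∈ Ps, (cnt (Om Qs p) p : ℝ) / p ≤ g * (P0+1) + (-∑ j, Rr (Qs j) t) + ∑ j, ∑ p ∈ (a j).primeFactors, (g:ℝ)/p := by
    set S : ℕ → ℝ := fun p => ∑ j, (rho (Qs j) p : ℝ)/p with hS
    have hS0 : ∀ p, 0 ≤ S p := fun p => Finset.sum_nonneg fun _ _ => by positivity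
    have hSg : ∀ p, p.Prime → S p ≤ g/p := by
      intro p hp
      calc S p ≤ ∑ j : Fin r, (K:ℝ)/p := Finset.sum_le_sum fun j _ => by
            have := rho_prime_le' D j hp
            gcongr
        _ = g/p := by rw [Finset.sum_const, Finset.card_univ, Fintype.card_fin, nsmul_eq_mul, hg]; push_cast; ring
    have e1 : ∑ j, Rr (Qs j) t = ∑ p ∈ primesBelow t, S p := by
      unfold Rr; rw [Finset.sum_comm]
    have e2 : ∑ p ∈ Ps, S p ≤ ∑ p ∈ Ps, (cnt (Om Qs p) p : ℝ) / p := by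
      apply Finset.sum_le_sum
      intro p hp
      simp only [hS]
      rw [← Finset.sum_div]
      have := cnt_Om_ge D (hmem p hp).1 (hmem p hp).2.2.1
      gcongr
      exact_mod_cast this
    have e3 : ∑ p ∈ primesBelow t, S p ≤ ∑ p ∈ Ps, S p + (∑ p ∈ Finset.range (P0+1), (g:ℝ) + ∑ p ∈ M.primeFactors, (g:ℝ)/p) := by
      have : ∑ p ∈ primesBelow t, S p = ∑ p ∈ Ps, S p + ∑ p ∈ (primesBelow t).filter (fun p => ¬ (P0 < p ∧ ¬ p ∣ M)), S p :=
        (Finset.sum_filter_add_sum_filter_not _ _ _).symm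
      rw [this]
      gcongr
      have h4 : (primesBelow t).filter (fun p => ¬ (P0 < p ∧ ¬ p ∣ M)) ⊆
        (primesBelow t).filter (fun p => p ≤ P0) ∪ M.primeFactors := by
        intro p hp
        obtain ⟨ha, hb⟩ := Finset.mem_filter.1 hp
        rw [Finset.mem_union]
        by_cases hpp : p ≤ P0
        · left; exact Finset.mem_filter.2 ⟨ha, hpp⟩
        · right
          push Not at hpp
          rw [Nat.mem_primeFactors]
          refine ⟨(mem_primesBelow'.1 ha).1, ?_, hM0⟩
          by_contra hc
          exact hb ⟨hpp, hc⟩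
      calc _ ≤ ∑ p ∈ (primesBelow t).filter (fun p => p ≤ P0) ∪ M.primeFactors, S p :=
            Finset.sum_le_sum_of_subset_of_nonneg h4 (fun p _ _ => hS0 p)
        _ ≤ ∑ p ∈ (primesBelow t).filter (fun p => p ≤ P0), S p + ∑ p ∈ M.primeFactors, S p := by
            rw [← Finset.sum_union_inter]
            have : 0 ≤ ∑ p ∈ (primesBelow t).filter (fun p => p ≤ P0) ∩ M.primeFactors, S p := Finset.sum_nonneg fun p _ => hS0 p
            linarith
        _ ≤ _ := by
            apply add_le_add
            · calc _ ≤ ∑ p ∈ (primesBelow t).filter (fun p => p ≤ P0), (g:ℝ) := by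
                    apply Finset.sum_le_sum
                    intro p hp
                    have hpp := (mem_primesBelow'.1 (Finset.mem_filter.1 hp).1).1
                    refine (hSg p hpp).trans (div_le_self (by positivity) ?_)
                    exact_mod_cast hpp.one_lt.le
                _ ≤ _ := by
                    apply Finset.sum_le_sum_of_subset_of_nonneg
                    · intro p hp
                      have := (Finset.mem_filter.1 hp).2
                      rw [Finset.mem_range]; omega
                    · intros; positivity
            · exact Finset.sum_le_sum fun p hp => hSg p (Nat.prime_of_mem_primeFactors hp)
    have e4 : ∑ p ∈ M.primeFactors, (g:ℝ)/p ≤ ∑ j, ∑ p ∈ (a j).primeFactors, (g:ℝ)/p := by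
      have : M.primeFactors = Finset.univ.biUnion (fun j => (a j).primeFactors) := by
        ext p
        simp only [Nat.mem_primeFactors, Finset.mem_biUnion, Finset.mem_univ, true_and]
        constructor
        · rintro ⟨hp, hd, _⟩
          obtain ⟨j, _, hj⟩ := (Nat.Prime.prime hp).exists_mem_finset_dvd hd
          exact ⟨j, hp, hj, ha j⟩
        · rintro ⟨j, hp, hd, _⟩
          exact ⟨hp, hd.trans (Finset.dvd_prod_of_mem a (Finset.mem_univ j)), hM0⟩
      rw [this]
      apply sum_biUnion_le_aux
      intros; positivity
    rw [Finset.sum_const, Finset.card_range, nsmul_eq_mul] at e3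
    push_cast at e3
    rw [e1]
    linarith
  have hW : ∏ j, Wt (fun p ν => om0 r K P0 (Qs j) p ν * Real.exp ((g:ℕ)/p)) (a j) =
      (∏ j, Wt (om0 r K P0 (Qs j)) (a j)) * Real.exp (∑ j, ∑ p ∈ (a j).primeFactors, (g:ℝ)/p) := by
    rw [Real.exp_sum, ← Finset.prod_mul_distrib]
    apply Finset.prod_congr rfl
    intro j _
    unfold Wt
    rw [Finset.prod_mul_distrib, Real.exp_sum]
  rw [hW]
  have hden0 : 0 ≤ ∏ j, Wt (om0 r K P0 (Qs j)) (a j) := Finset.prod_nonneg fun j _ => Wt_nonneg _ (om0_nonneg _ _ _ _) _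
  calc C * y * (cnt (fun n => ∀ j, (a j:ℤ) ∣ (Qs j).eval n) M / M) * Real.exp (- ∑ p ∈ Ps, (cnt (Om Qs p) p : ℝ) / p)
      ≤ C * y * (∏ j, Wt (om0 r K P0 (Qs j)) (a j)) * Real.exp (g * (P0+1) + (-∑ j, Rr (Qs j) t) + ∑ j, ∑ p ∈ (a j).primeFactors, (g:ℝ)/p) := by
        gcongr
    _ = _ := by
        rw [Real.exp_add, Real.exp_add]
        ring


/-- the tilted weights -/
noncomputable def om (r K P0 : ℕ) (Q : Polynomial ℤ) (σ : ℝ) (p ν : ℕ) : ℝ :=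
  om0 r K P0 Q p ν * Real.exp ((r*K:ℕ)/p) * (p:ℝ)^((ν:ℝ)*σ)

lemma om_nonneg (r K P0 : ℕ) (Q : Polynomial ℤ) (σ : ℝ) (p ν : ℕ) : 0 ≤ om r K P0 Q σ p ν := by
  have := om0_nonneg r K P0 Q p ν
  unfold om
  positivity

lemma Wt_om (r K P0 : ℕ) (Q : Polynomial ℤ) (σ : ℝ) (a : ℕ) (ha : a ≠ 0) :
    Wt (om r K P0 Q σ) a = Wt (fun p ν => om0 r K P0 Q p ν * Real.exp ((r*K:ℕ)/p)) a * (a:ℝ)^σ := by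
  have h1 : (a:ℝ)^σ = ∏ p ∈ a.primeFactors, (p:ℝ)^(((a.factorization p : ℕ):ℝ)*σ) := by
    have h2 : (a:ℝ) = ∏ p ∈ a.primeFactors, (p:ℝ)^(a.factorization p) := by
      conv_lhs => rw [← Nat.prod_factorization_pow_eq_self ha]
      rw [Finsupp.prod, Nat.support_factorization]
      push_cast
      rfl
    conv_lhs => rw [h2]
    rw [← Real.finsetProd_rpow _ _ (fun p _ => by positivity)]
    apply Finset.prod_congr rfl
    intro p _
    rw [Real.rpow_mul (by positivity), Real.rpow_natCast]
  rw [h1]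
  unfold Wt om
  rw [← Finset.prod_mul_distrib]

lemma geo_le (q : ℝ) (h0 : 0 ≤ q) (h1 : q < 1) (m N : ℕ) : ∑ ν ∈ Finset.Icc m N, q^ν ≤ q^m/(1-q) := by
  rw [le_div_iff₀ (by linarith)]
  have : Finset.Icc m N ⊆ Finset.Ico m (m + N + 1) := by
    intro v hv
    rw [Finset.mem_Icc] at hv
    rw [Finset.mem_Ico]; omega
  have h2 : ∑ ν ∈ Finset.Icc m N, q^ν ≤ ∑ ν ∈ Finset.Ico m (m+N+1), q^ν :=
    Finset.sum_le_sum_of_subset_of_nonneg this fun _ _ _ => by positivity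
  rw [Finset.sum_Ico_eq_sum_range] at h2
  simp_rw [pow_add] at h2
  rw [← Finset.mul_sum] at h2
  have h3 := geom_sum_mul_neg q (m+N+1-m)
  have h4 : 0 ≤ q^(m+N+1-m) := by positivity
  calc _ ≤ (q^m * ∑ i ∈ Finset.range (m+N+1-m), q^i) * (1-q) := by gcongr
    _ = q^m * (1 - q^(m+N+1-m)) := by rw [mul_assoc, h3]
    _ ≤ q^m * 1 := by gcongr; linarith
    _ = _ := by ring

lemma exp_le_one_add (u b : ℝ) (hu : 0 ≤ u) (hb : u ≤ b) : Real.exp u ≤ 1 + u * Real.exp b := by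
  have h1 : Real.exp u * (1 - u) ≤ 1 := by
    have := Real.add_one_le_exp (-u)
    calc _ ≤ Real.exp u * Real.exp (-u) := by gcongr; linarith
      _ = 1 := by rw [← Real.exp_add]; simp
  have h2 : Real.exp u ≤ Real.exp b := Real.exp_le_exp.2 hb
  nlinarith

lemma pow_sum_bad (K g r : ℕ) (hr : 1 ≤ r) (p : ℕ) (hp : p.Prime) (σ : ℝ) (hσ : σ ≤ 1/(4*r)) (N : ℕ) :
    ∑ ν ∈ Finset.Icc 1 N, (K*(p:ℝ)^(-((ν:ℝ)/r)) * Real.exp ((g:ℕ)/p) * (p:ℝ)^((ν:ℝ)*σ)) ≤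
      K * Real.exp g * (1/(1 - (2:ℝ)^(-(1/(2*r):ℝ)))) := by
  have hr' : (1:ℝ) ≤ r := by exact_mod_cast hr
  have hp2 : (2:ℝ) ≤ p := by exact_mod_cast hp.two_le
  set q : ℝ := (2:ℝ)^(-(1/(2*r):ℝ)) with hq
  have hq0 : 0 ≤ q := by positivity
  have hq1 : q < 1 := Real.rpow_lt_one_of_one_lt_of_neg (by norm_num) (by simp; linarith)
  calc _ ≤ ∑ ν ∈ Finset.Icc 1 N, K * Real.exp g * q^ν := by
        apply Finset.sum_le_sum
        intro ν hν
        have e1 : Real.exp ((g:ℕ)/p) ≤ Real.exp g := Real.exp_le_exp.2 (div_le_self (by positivity) (by linarith))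
        have e2 : (p:ℝ)^(-((ν:ℝ)/r)) * (p:ℝ)^((ν:ℝ)*σ) ≤ q^ν := by
          rw [← Real.rpow_add (by linarith), hq, ← Real.rpow_natCast, ← Real.rpow_mul (by norm_num)]
          have hle : -((ν:ℝ)/r) + ν*σ ≤ -(1/(2*r):ℝ) * ν := by
            have : (ν:ℝ)*σ ≤ ν * (1/(4*r)) := by gcongr
            have h0 : 0 ≤ (ν:ℝ)/r := by positivity
            have h5 : (ν:ℝ) * (1/(4*r)) = (ν:ℝ)/r/4 := by field_simp
            have h6 : -(1/(2*r):ℝ) * ν = -((ν:ℝ)/r/2) := by field_simp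
            rw [h6]; rw [h5] at this; linarith
          calc (p:ℝ)^(-((ν:ℝ)/r) + ν*σ) ≤ (p:ℝ)^(-(1/(2*r):ℝ) * ν) :=
                Real.rpow_le_rpow_of_exponent_le (by linarith) hle
            _ ≤ _ := by
                apply Real.rpow_le_rpow_of_nonpos (by norm_num) hp2
                have : 0 ≤ (1/(2*r):ℝ) * ν := by positivity
                linarith
        calc _ = K * Real.exp ((g:ℕ)/p) * ((p:ℝ)^(-((ν:ℝ)/r)) * (p:ℝ)^((ν:ℝ)*σ)) := by ring
          _ ≤ _ := by gcongr
    _ = K * Real.exp g * ∑ ν ∈ Finset.Icc 1 N, q^ν := by rw [Finset.mul_sum]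
    _ ≤ _ := by
        gcongr
        refine (geo_le q hq0 hq1 1 N).trans ?_
        have : 0 < 1 - q := by linarith
        gcongr
        simpa using hq1.le

lemma pow_sum_good (K g : ℕ) (p : ℕ) (hp : p.Prime) (σ : ℝ) (hσ : σ ≤ 1/4) (N : ℕ) :
    ∑ ν ∈ Finset.Icc 2 N, (K/(p:ℝ)^ν * Real.exp ((g:ℕ)/p) * (p:ℝ)^((ν:ℝ)*σ)) ≤
      K * Real.exp g * (1/(1 - (2:ℝ)^(-(3/4):ℝ))) * (1/(p:ℝ)^(3/2:ℝ)) := by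
  have hp2 : (2:ℝ) ≤ p := by exact_mod_cast hp.two_le
  have hp0 : (0:ℝ) < p := by linarith
  set q : ℝ := (p:ℝ)^(-(3/4):ℝ) with hq
  have hq0 : 0 ≤ q := by positivity
  have hqq : q ≤ (2:ℝ)^(-(3/4):ℝ) := Real.rpow_le_rpow_of_nonpos (by norm_num) hp2 (by norm_num)
  have hq2 : (2:ℝ)^(-(3/4):ℝ) < 1 := Real.rpow_lt_one_of_one_lt_of_neg (by norm_num) (by norm_num)
  have hq1 : q < 1 := lt_of_le_of_lt hqq hq2
  calc _ ≤ ∑ ν ∈ Finset.Icc 2 N, K * Real.exp g * q^ν := by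
        apply Finset.sum_le_sum
        intro ν hν
        have e1 : Real.exp ((g:ℕ)/p) ≤ Real.exp g := Real.exp_le_exp.2 (div_le_self (by positivity) (by linarith))
        have e2 : (1/(p:ℝ)^ν) * (p:ℝ)^((ν:ℝ)*σ) ≤ q^ν := by
          rw [hq, ← Real.rpow_natCast, ← Real.rpow_natCast, ← Real.rpow_mul hp0.le, one_div, ← Real.rpow_neg hp0.le, ← Real.rpow_add hp0]
          apply Real.rpow_le_rpow_of_exponent_le (by linarith)
          have : (ν:ℝ)*σ ≤ ν * (1/4) := by gcongr
          linarith
        calc _ = K * Real.exp ((g:ℕ)/p) * ((1/(p:ℝ)^ν) * (p:ℝ)^((ν:ℝ)*σ)) := by ring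
          _ ≤ _ := by gcongr
    _ = K * Real.exp g * ∑ ν ∈ Finset.Icc 2 N, q^ν := by rw [Finset.mul_sum]
    _ ≤ K * Real.exp g * (q^2/(1-q)) := by gcongr; exact geo_le q hq0 hq1 2 N
    _ ≤ K * Real.exp g * (q^2/(1-(2:ℝ)^(-(3/4):ℝ))) := by
        have : 0 < 1 - (2:ℝ)^(-(3/4):ℝ) := by linarith
        gcongr
    _ = _ := by
        have : q^2 = 1/(p:ℝ)^(3/2:ℝ) := by
          rw [hq, ← Real.rpow_natCast, ← Real.rpow_mul hp0.le, one_div, ← Real.rpow_neg hp0.le]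
          norm_num
        rw [this]; ring

lemma weight_sum {r : ℕ} {Qs : Fin r → Polynomial ℤ} {K P0 : ℕ} (D : PD r Qs K P0) (c : ℝ) (hc : 0 ≤ c) :
    ∃ C : ℝ, 0 < C ∧ ∀ (ℓ : ℝ) (j : Fin r) (N : ℕ), 0 < ℓ → c/ℓ ≤ 1/(4*r) →
      ∑ p ∈ primesBelow (Real.exp (4*r*ℓ)), ∑ ν ∈ Finset.Icc 1 N, om r K P0 (Qs j) (c/ℓ) p ν ≤
        Rr (Qs j) (Real.exp ℓ) + C := by
  obtain ⟨C0, hC0, hC0'⟩ := exists_sum_rpow_bound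
  set g := r * K with hg
  have hr := D.hr
  have hr' : (1:ℝ) ≤ r := by exact_mod_cast hr
  set G : ℝ := K * Real.exp g * (1/(1 - (2:ℝ)^(-(1/(2*r):ℝ)))) with hG
  have hG0 : 0 ≤ G := by
    have : (2:ℝ)^(-(1/(2*r):ℝ)) < 1 := Real.rpow_lt_one_of_one_lt_of_neg (by norm_num) (by simp; linarith)
    have : 0 < 1 - (2:ℝ)^(-(1/(2*r):ℝ)) := by linarith
    positivity
  set H : ℝ := K * Real.exp g * (1/(1 - (2:ℝ)^(-(3/4):ℝ))) with hH
  have hH0 : 0 ≤ H := by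
    have : (2:ℝ)^(-(3/4):ℝ) < 1 := Real.rpow_lt_one_of_one_lt_of_neg (by norm_num) (by norm_num)
    have : 0 < 1 - (2:ℝ)^(-(3/4):ℝ) := by linarith
    positivity
  set A : ℝ := K * Real.exp (4*r*c) with hA
  set B : ℝ := K * g * Real.exp (g + 4*r*c) with hB
  have hA0 : 0 ≤ A := by positivity
  have hB0 : 0 ≤ B := by positivity
  refine ⟨8*r*K + (P0+1)*G + A * (8*r*c) + (B+H)*C0 + 1, by positivity, ?_⟩
  intro ℓ j N hℓ hσ
  set σ := c/ℓ with hσd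
  have hσ0 : 0 ≤ σ := by positivity
  have hσ4 : σ ≤ 1/4 := hσ.trans (by apply one_div_le_one_div_of_le <;> linarith)
  set S := primesBelow (Real.exp (4*r*ℓ)) with hS
  have hpt : ∀ p ∈ S, ∑ ν ∈ Finset.Icc 1 N, om r K P0 (Qs j) σ p ν ≤
      (rho (Qs j) p : ℝ)/p + (if p ≤ P0 then G else 0) + A * σ * (Real.log p/p) + (B+H) * (1/(p:ℝ)^(3/2:ℝ)) := by
    intro p hpS
    obtain ⟨hp, hple⟩ := mem_primesBelow'.1 hpS
    have hp2 : (2:ℝ) ≤ p := by exact_mod_cast hp.two_le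
    have hp0 : (0:ℝ) < p := by linarith
    have hlog : 0 ≤ Real.log p := Real.log_nonneg (by linarith)
    have hlog2 : Real.log p ≤ 4*r*ℓ := (Real.log_le_iff_le_exp hp0).2 hple
    by_cases hpP : p ≤ P0
    · rw [if_pos hpP]
      have h1 : ∑ ν ∈ Finset.Icc 1 N, om r K P0 (Qs j) σ p ν ≤ G := by
        refine le_trans (le_of_eq ?_) (pow_sum_bad K g r hr p hp σ hσ N)
        apply Finset.sum_congr rfl
        intro ν _
        unfold om om0
        rw [if_pos hpP]
      have h2 : 0 ≤ (rho (Qs j) p : ℝ)/p := by positivity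
      have h3 : 0 ≤ A * σ * (Real.log p/p) := by positivity
      have h4 : 0 ≤ (B+H) * (1/(p:ℝ)^(3/2:ℝ)) := by positivity
      linarith
    · rw [if_neg hpP]
      have h1 : ∑ ν ∈ Finset.Icc 1 N, om r K P0 (Qs j) σ p ν ≤
          om r K P0 (Qs j) σ p 1 + ∑ ν ∈ Finset.Icc 2 N, om r K P0 (Qs j) σ p ν := by
        have : Finset.Icc 1 N ⊆ insert 1 (Finset.Icc 2 N) := by
          intro v hv
          rw [Finset.mem_Icc] at hv
          rw [Finset.mem_insert, Finset.mem_Icc]; omega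
        rw [← Finset.sum_insert (by simp)]
        exact Finset.sum_le_sum_of_subset_of_nonneg this fun _ _ _ => om_nonneg _ _ _ _ _ _ _
      have h2 : ∑ ν ∈ Finset.Icc 2 N, om r K P0 (Qs j) σ p ν ≤ H * (1/(p:ℝ)^(3/2:ℝ)) := by
        refine le_trans (le_of_eq ?_) (pow_sum_good K g p hp σ hσ4 N)
        apply Finset.sum_congr rfl
        intro ν hν
        rw [Finset.mem_Icc] at hν
        unfold om om0
        rw [if_neg hpP, if_neg (by omega)]
      have hrho : (rho (Qs j) p : ℝ) ≤ K := by exact_mod_cast rho_prime_le' D j hp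
      have hsl : σ * Real.log p ≤ 4*r*c := by
        calc σ * Real.log p ≤ σ * (4*r*ℓ) := by gcongr
          _ = 4*r*c := by rw [hσd]; field_simp
      have e1 : Real.exp ((g:ℕ)/p) ≤ 1 + (g/p) * Real.exp g :=
        exp_le_one_add _ _ (by positivity) (div_le_self (by positivity) (by linarith))
      have e2 : (p:ℝ)^σ = Real.exp (σ * Real.log p) := by rw [Real.rpow_def_of_pos hp0, mul_comm]
      have e3 : Real.exp (σ * Real.log p) ≤ 1 + σ * Real.log p * Real.exp (4*r*c) :=
        exp_le_one_add _ _ (by positivity) hsl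
      have e4 : Real.exp (σ * Real.log p) ≤ Real.exp (4*r*c) := Real.exp_le_exp.2 hsl
      have e5 : Real.exp ((g:ℕ)/p) * (p:ℝ)^σ ≤ 1 + σ * Real.log p * Real.exp (4*r*c) + (g/p) * Real.exp (g+4*r*c) := by
        rw [e2, Real.exp_add]
        calc _ ≤ (1 + (g/p) * Real.exp g) * Real.exp (σ * Real.log p) := by gcongr
          _ = Real.exp (σ * Real.log p) + (g/p) * Real.exp g * Real.exp (σ * Real.log p) := by ring
          _ ≤ (1 + σ * Real.log p * Real.exp (4*r*c)) + (g/p) * Real.exp g * Real.exp (4*r*c) := by gcongr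
          _ = _ := by ring
      have h3 : om r K P0 (Qs j) σ p 1 ≤ (rho (Qs j) p : ℝ)/p + A * σ * (Real.log p/p) + B * (1/(p:ℝ)^(3/2:ℝ)) := by
        have : om r K P0 (Qs j) σ p 1 = (rho (Qs j) p : ℝ)/p * (Real.exp ((g:ℕ)/p) * (p:ℝ)^σ) := by
          unfold om om0
          rw [if_neg hpP, if_pos rfl]
          push_cast
          rw [one_mul, hg]; push_cast; ring
        rw [this]
        calc _ ≤ (rho (Qs j) p : ℝ)/p * (1 + σ * Real.log p * Real.exp (4*r*c) + (g/p) * Real.exp (g+4*r*c)) := by gcongr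
          _ = (rho (Qs j) p : ℝ)/p + (rho (Qs j) p : ℝ)/p * (σ * Real.log p * Real.exp (4*r*c)) + (rho (Qs j) p : ℝ)/p * ((g/p) * Real.exp (g+4*r*c)) := by ring
          _ ≤ (rho (Qs j) p : ℝ)/p + (K : ℝ)/p * (σ * Real.log p * Real.exp (4*r*c)) + (K : ℝ)/p * ((g/p) * Real.exp (g+4*r*c)) := by gcongr
          _ = (rho (Qs j) p : ℝ)/p + A * σ * (Real.log p/p) + B * (1/(p:ℝ)^2) := by rw [hA, hB]; field_simp
          _ ≤ _ := by
              gcongr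
              rw [← Real.rpow_natCast]
              exact Real.rpow_le_rpow_of_exponent_le (by linarith) (by norm_num)
      linarith
  have hsum := Finset.sum_le_sum hpt
  refine hsum.trans ?_
  simp only [Finset.sum_add_distrib, ← Finset.mul_sum]
  have hx1 : (1:ℝ) ≤ Real.exp (4*r*ℓ) := Real.one_le_exp (by positivity)
  have s1 : ∑ p ∈ S, (rho (Qs j) p : ℝ)/p ≤ Rr (Qs j) (Real.exp ℓ) + 8*r*K := by
    have hsub : ∑ p ∈ S, (rho (Qs j) p : ℝ)/p ≤ Rr (Qs j) (Real.exp ℓ) + ∑ p ∈ S.filter (fun p : ℕ => Real.exp ℓ < (p:ℝ)), (rho (Qs j) p : ℝ)/p := by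
      rw [← Finset.sum_filter_add_sum_filter_not S (fun p : ℕ => Real.exp ℓ < (p:ℝ)), add_comm]
      gcongr
      unfold Rr
      apply Finset.sum_le_sum_of_subset_of_nonneg
      · intro p hp
        obtain ⟨h1, h2⟩ := Finset.mem_filter.1 hp
        exact mem_primesBelow'.2 ⟨(mem_primesBelow'.1 h1).1, not_lt.1 h2⟩
      · intros; positivity
    have h2 := sum_inv_le (t := Real.exp ℓ) (x := Real.exp (4*r*ℓ)) (Real.one_lt_exp_iff.2 hℓ) hx1
    rw [Real.log_exp, Real.log_exp] at h2
    have h3 : ∑ p ∈ S.filter (fun p : ℕ => Real.exp ℓ < (p:ℝ)), (rho (Qs j) p : ℝ)/p ≤ K * ∑ p ∈ S.filter (fun p : ℕ => Real.exp ℓ < (p:ℝ)), (1:ℝ)/p := by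
      rw [Finset.mul_sum]
      apply Finset.sum_le_sum
      intro p hp
      have hpp := (mem_primesBelow'.1 (Finset.mem_filter.1 hp).1).1
      have hrho : (rho (Qs j) p : ℝ) ≤ K := by exact_mod_cast rho_prime_le' D j hpp
      rw [mul_one_div]
      gcongr
    have h4 : 4*(r:ℝ)*ℓ/ℓ = 4*r := by field_simp
    rw [h4] at h2
    have h5 : (K:ℝ) * ∑ p ∈ S.filter (fun p : ℕ => Real.exp ℓ < (p:ℝ)), (1:ℝ)/p ≤ K * (2 * (4*r)) := by gcongr
    linarith
  have s2 : ∑ p ∈ S, (if p ≤ P0 then G else 0) ≤ (P0+1)*G := by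
    rw [← Finset.sum_filter, Finset.sum_const, nsmul_eq_mul]
    gcongr
    have : (S.filter (fun p => p ≤ P0)) ⊆ Finset.range (P0+1) := by
      intro p hp
      have := (Finset.mem_filter.1 hp).2
      rw [Finset.mem_range]; omega
    have := Finset.card_le_card this
    rw [Finset.card_range] at this
    exact_mod_cast this
  have s3 : A * σ * ∑ p ∈ S, Real.log p/p ≤ A * (8*r*c) := by
    have h := sum_log_div_le hx1
    rw [Real.log_exp] at h
    calc _ ≤ A * σ * (2 * (4*r*ℓ)) := by gcongr
      _ = _ := by rw [hσd]; field_simp; ring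
  have s4 : (B+H) * ∑ p ∈ S, (1/(p:ℝ)^(3/2:ℝ)) ≤ (B+H) * C0 := by
    gcongr
    exact hC0' S
  linarith


lemma om_one_ge {r : ℕ} {Qs : Fin r → Polynomial ℤ} {K P0 : ℕ} (D : PD r Qs K P0) (j : Fin r) (σ : ℝ) (hσ : 0 ≤ σ)
    (p : ℕ) (hp : p.Prime) : (rho (Qs j) p : ℝ)/p ≤ om r K P0 (Qs j) σ p 1 := by
  have hr' : (1:ℝ) ≤ r := by exact_mod_cast D.hr
  have hp2 : (2:ℝ) ≤ p := by exact_mod_cast hp.two_le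
  have hp0 : (0:ℝ) < p := by linarith
  have hrho : (rho (Qs j) p : ℝ) ≤ K := by exact_mod_cast rho_prime_le' D j hp
  have h0 : (rho (Qs j) p : ℝ)/p ≤ om0 r K P0 (Qs j) p 1 := by
    unfold om0
    rw [if_pos rfl]
    split_ifs with h1
    · calc (rho (Qs j) p : ℝ)/p ≤ K/p := by gcongr
        _ = K * (p:ℝ)^(-1:ℝ) := by rw [Real.rpow_neg_one]; rfl
        _ ≤ _ := by
            gcongr
            · linarith
            · push_cast
              rw [div_le_one (by linarith)]
              exact hr'
    · exact le_refl _
  have h1 : 1 ≤ Real.exp ((r*K:ℕ)/p) := Real.one_le_exp (by positivity)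
  have h2 : 1 ≤ (p:ℝ)^(((1:ℕ):ℝ)*σ) := Real.one_le_rpow (by linarith) (by positivity)
  have h3 := om0_nonneg r K P0 (Qs j) p 1
  unfold om
  calc (rho (Qs j) p : ℝ)/p ≤ om0 r K P0 (Qs j) p 1 * 1 * 1 := by linarith
    _ ≤ _ := by gcongr

lemma Ef_ge_one (f : ℕ → ℝ) (x : ℝ) (Q : Polynomial ℤ) : 1 ≤ Ef f x (fun p => (rho Q p : ℝ)) := by
  unfold Ef
  have : 0 ≤ ∑ p ∈ (primesBelow x).filter (fun p => f p ≠ 0), (rho Q p : ℝ) / p :=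
    Finset.sum_nonneg fun p _ => by positivity
  linarith

lemma Ef_cmp {r : ℕ} {Qs : Fin r → Polynomial ℤ} {K P0 : ℕ} (D : PD r Qs K P0) (j : Fin r) (f : ℕ → ℝ) (t x : ℝ)
    (ht : 1 < t) (hx : 1 ≤ x) :
    Ef f x (fun p => (rho (Qs j) p : ℝ)) ≤ (1 + 2 * K * (Real.log x/Real.log t)) * Ef f t (fun p => (rho (Qs j) p : ℝ)) := by
  have h1 := Ef_ge_one f t (Qs j)
  have hl : 0 ≤ Real.log x/Real.log t := div_nonneg (Real.log_nonneg hx) (Real.log_nonneg ht.le)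
  have h2 := sum_inv_le (t := t) (x := x) ht hx
  have h3 : Ef f x (fun p => (rho (Qs j) p : ℝ)) ≤ Ef f t (fun p => (rho (Qs j) p : ℝ)) +
      K * ∑ p ∈ (primesBelow x).filter (fun p : ℕ => t < (p:ℝ)), (1:ℝ)/p := by
    unfold Ef
    rw [← Finset.sum_filter_add_sum_filter_not ((primesBelow x).filter (fun p => f p ≠ 0)) (fun p : ℕ => t < (p:ℝ)), Finset.mul_sum]
    have e1 : ∑ p ∈ ((primesBelow x).filter (fun p => f p ≠ 0)).filter (fun p : ℕ => t < (p:ℝ)), (rho (Qs j) p : ℝ)/p ≤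
        ∑ p ∈ (primesBelow x).filter (fun p : ℕ => t < (p:ℝ)), (K:ℝ) * (1/p) := by
      calc _ ≤ ∑ p ∈ ((primesBelow x).filter (fun p => f p ≠ 0)).filter (fun p : ℕ => t < (p:ℝ)), (K:ℝ) * (1/p) := by
            apply Finset.sum_le_sum
            intro p hp
            have hpp := (mem_primesBelow'.1 (Finset.mem_filter.1 (Finset.mem_filter.1 hp).1).1).1
            have hrho : (rho (Qs j) p : ℝ) ≤ K := by exact_mod_cast rho_prime_le' D j hpp
            rw [mul_one_div]
            gcongr
        _ ≤ _ := by
            apply Finset.sum_le_sum_of_subset_of_nonneg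
            · intro p hp
              simp only [Finset.mem_filter] at hp ⊢
              exact ⟨hp.1.1, hp.2⟩
            · intros; positivity
    have e2 : ∑ p ∈ ((primesBelow x).filter (fun p => f p ≠ 0)).filter (fun p : ℕ => ¬ t < (p:ℝ)), (rho (Qs j) p : ℝ)/p ≤
        ∑ p ∈ (primesBelow t).filter (fun p => f p ≠ 0), (rho (Qs j) p : ℝ)/p := by
      apply Finset.sum_le_sum_of_subset_of_nonneg
      · intro p hp
        simp only [Finset.mem_filter, mem_primesBelow'] at hp ⊢
        exact ⟨⟨hp.1.1.1, not_lt.1 hp.2⟩, hp.1.2⟩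
      · intros; positivity
    linarith
  have h4 : (K:ℝ) * ∑ p ∈ (primesBelow x).filter (fun p : ℕ => t < (p:ℝ)), (1:ℝ)/p ≤ K * (2 * (Real.log x/Real.log t)) := by
    gcongr
  have h5 : 0 ≤ 2 * K * (Real.log x/Real.log t) := by positivity
  nlinarith

lemma conc_weight {r : ℕ} {Qs : Fin r → Polynomial ℤ} {K P0 : ℕ} (D : PD r Qs K P0) (c : ℝ) (hc : 0 ≤ c) :
    ∃ C : ℝ, 0 < C ∧ ∀ (ℓ : ℝ) (j : Fin r) (A : Finset ℕ) (f : ℕ → ℝ) (h : ℝ), 0 < ℓ → c/ℓ ≤ 1/(4*r) →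
      (∀ a ∈ A, a ≠ 0 ∧ ∀ p : ℕ, p.Prime → p ∣ a → (p:ℝ) ≤ Real.exp (4*r*ℓ)) →
      (∀ m n : ℕ, Nat.Coprime m n → f (m * n) = f m + f n) →
      ∑ a ∈ A.filter (fun a => f a = h), Wt (om r K P0 (Qs j) (c/ℓ)) a ≤
        C * Real.exp (Rr (Qs j) (Real.exp ℓ)) / Real.sqrt (Ef f (Real.exp ℓ) (fun p => (rho (Qs j) p : ℝ))) := by
  obtain ⟨C, hC, hw⟩ := weight_sum D c hc
  refine ⟨4 * Real.exp C, by positivity, ?_⟩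
  intro ℓ j A f h hℓ hσ hA hf
  set N := 1 + A.sup id with hN
  set U := primesBelow (Real.exp (4*r*ℓ)) with hU
  have h1 := conc (om r K P0 (Qs j) (c/ℓ)) (om_nonneg _ _ _ _ _) U A N (fun p hp => (mem_primesBelow'.1 hp).1)
    (by
      intro a ha
      obtain ⟨h1, h2⟩ := hA a ha
      refine ⟨h1, ?_, ?_⟩
      · intro p hp
        exact mem_primesBelow'.2 ⟨Nat.prime_of_mem_primeFactors hp, h2 p (Nat.prime_of_mem_primeFactors hp) (Nat.dvd_of_mem_primeFactors hp)⟩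
      · intro p
        have e1 : a.factorization p < a := Nat.factorization_lt p h1
        have e2 : a ≤ A.sup id := Finset.le_sup (f := id) ha
        omega) (by omega) f hf h
  refine h1.trans ?_
  have h2 := hw ℓ j N hℓ hσ
  have hr' : (1:ℝ) ≤ r := by exact_mod_cast D.hr
  have h3 : Ef f (Real.exp ℓ) (fun p => (rho (Qs j) p : ℝ)) ≤ 1 + ∑ p ∈ U.filter (fun p => f p ≠ 0), om r K P0 (Qs j) (c/ℓ) p 1 := by
    unfold Ef
    gcongr 1 + ?_
    calc _ ≤ ∑ p ∈ (primesBelow (Real.exp ℓ)).filter (fun p => f p ≠ 0), om r K P0 (Qs j) (c/ℓ) p 1 := by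
          apply Finset.sum_le_sum
          intro p hp
          exact om_one_ge D j _ (by positivity) p (mem_primesBelow'.1 (Finset.mem_filter.1 hp).1).1
      _ ≤ _ := by
          apply Finset.sum_le_sum_of_subset_of_nonneg
          · apply Finset.filter_subset_filter
            apply primesBelow_mono
            apply Real.exp_le_exp.2
            nlinarith
          · intros; exact om_nonneg _ _ _ _ _ _ _
  have h4 := Ef_ge_one f (Real.exp ℓ) (Qs j)
  have h5 : 0 < Real.sqrt (Ef f (Real.exp ℓ) (fun p => (rho (Qs j) p : ℝ))) := Real.sqrt_pos.2 (by linarith)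
  calc _ ≤ 4 * Real.exp (Rr (Qs j) (Real.exp ℓ) + C) / Real.sqrt (Ef f (Real.exp ℓ) (fun p => (rho (Qs j) p : ℝ))) := by
        gcongr
    _ = _ := by rw [Real.exp_add]; ring


lemma val_finite (f : ℕ → ℝ) (t s : ℝ) : ({v : ℝ | ∃ n : ℕ, 0 < n ∧ (n : ℝ) ≤ s ∧
              (∀ p : ℕ, p.Prime → p ∣ n → t < (p : ℝ)) ∧ f n = v}).Finite := by
  apply Set.Finite.subset ((Set.finite_Iic ⌊s⌋₊).image f)
  rintro v ⟨n, _, hn, _, rfl⟩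
  exact ⟨n, Nat.le_floor hn, rfl⟩

lemma event {r : ℕ} {Qs : Fin r → Polynomial ℤ} {K P0 : ℕ} (D : PD r Qs K P0) (c : ℝ) (hc : 0 ≤ c) :
    ∃ C : ℝ, 0 < C ∧ ∀ (ℓ x y s B W Z : ℝ) (f : Fin r → ℕ → ℝ) (k : Fin r → ℝ) (N : Finset ℤ),
      0 < ℓ → c/ℓ ≤ 1/(4*r) → 0 < B → 0 ≤ W → 0 ≤ y →
      (Real.exp ℓ)^(4+4*(r*K)) * Z ≤ y → N ⊆ Iv x y →
      (∀ j, ∀ m n : ℕ, Nat.Coprime m n → f j (m * n) = f j m + f j n) →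
      (∀ j, (({v : ℝ | ∃ n : ℕ, 0 < n ∧ (n : ℝ) ≤ s ∧
              (∀ p : ℕ, p.Prime → p ∣ n → Real.exp ℓ < (p : ℝ)) ∧ f j n = v}).ncard : ℝ) ≤ W) →
      (∀ n ∈ N, ∃ a b : Fin r → ℕ, (∀ j, ((Qs j).eval n).natAbs = a j * b j ∧ Nat.Coprime (a j) (b j) ∧
        a j ≠ 0 ∧ 0 < b j ∧ (b j : ℝ) ≤ s ∧ (∀ p : ℕ, p.Prime → p ∣ b j → Real.exp ℓ < (p:ℝ)) ∧
        (∀ p : ℕ, p.Prime → p ∣ a j → (p:ℝ) ≤ Real.exp (4*r*ℓ)) ∧ f j ((Qs j).eval n).natAbs = k j) ∧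
        ((∏ j, a j : ℕ):ℝ) ≤ Z ∧ B ≤ ((∏ j, a j : ℕ):ℝ)) →
      (N.card : ℝ) ≤ C * y * B^(-(c/ℓ)) * W^r / ∏ j, Real.sqrt (Ef (f j) (Real.exp ℓ) (fun p => (rho (Qs j) p : ℝ))) := by
  obtain ⟨C1, hC1, hs⟩ := sieve_a D
  obtain ⟨C2, hC2, hw⟩ := conc_weight D c hc
  refine ⟨C1 * C2^r, by positivity, ?_⟩
  intro ℓ x y s B W Z f k N hℓ hσ hB hW hy hZy hN hf hval hn
  choose! a b hab using hn
  set σ := c/ℓ with hσd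
  have hσ0 : 0 ≤ σ := by positivity
  set t := Real.exp ℓ with ht
  have ht1 : 1 < t := Real.one_lt_exp_iff.2 hℓ
  set Val : Fin r → Finset ℝ := fun j => (val_finite (f j) t s).toFinset with hVal
  have hValc : ∀ j, ((Val j).card : ℝ) ≤ W := by
    intro j
    have := hval j
    rw [Set.ncard_eq_toFinset_card _ (val_finite (f j) t s)] at this
    exact this
  set Aj : Fin r → Finset ℕ := fun j => N.image (fun n => a n j) with hAj
  set Aj' : Fin r → Finset ℕ := fun j => (Val j).biUnion (fun v => (Aj j).filter (fun m => f j m = k j - v)) with hAj'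
  have hAjp : ∀ j, ∀ m ∈ Aj j, m ≠ 0 ∧ ∀ p : ℕ, p.Prime → p ∣ m → (p:ℝ) ≤ Real.exp (4*r*ℓ) := by
    intro j m hm
    obtain ⟨n, hn, rfl⟩ := Finset.mem_image.1 hm
    obtain ⟨_, _, h3, _, _, _, h7, _⟩ := (hab n hn).1 j
    exact ⟨h3, h7⟩
  set Im := N.image a with hIm
  have hsub : Im ⊆ Fintype.piFinset Aj' := by
    intro α hα
    obtain ⟨n, hn, rfl⟩ := Finset.mem_image.1 hα
    rw [Fintype.mem_piFinset]
    intro j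
    obtain ⟨h1, h2, h3, h4, h5, h6, h7, h8⟩ := (hab n hn).1 j
    refine Finset.mem_biUnion.2 ⟨f j (b n j), ?_, ?_⟩
    · rw [hVal]
      rw [Set.Finite.mem_toFinset]
      exact ⟨b n j, h4, h5, h6, rfl⟩
    · refine Finset.mem_filter.2 ⟨Finset.mem_image.2 ⟨n, hn, rfl⟩, ?_⟩
      rw [h1, hf j _ _ h2] at h8
      linarith
  have hWn : ∀ (j : Fin r) (m : ℕ), 0 ≤ Wt (om r K P0 (Qs j) σ) m := fun j m => Wt_nonneg _ (om_nonneg _ _ _ _ _) _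
  -- bound for each fibre
  have hfib : ∀ α ∈ Im, ((N.filter (fun n => a n = α)).card : ℝ) ≤
      C1 * y * Real.exp (- ∑ j, Rr (Qs j) t) * B^(-σ) * ∏ j, Wt (om r K P0 (Qs j) σ) (α j) := by
    intro α hα
    obtain ⟨n0, hn0, rfl⟩ := Finset.mem_image.1 hα
    obtain ⟨h0, hZ, hBn⟩ := hab n0 hn0
    have ha0 : ∀ j, a n0 j ≠ 0 := fun j => (h0 j).2.2.1
    have h1 := hs t x y (a n0) ht1 ha0 (le_trans (by gcongr) hZy)
    have h2 : ((N.filter (fun n => a n = a n0)).card : ℝ) ≤ C1 * y * Real.exp (- ∑ j, Rr (Qs j) t) *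
        ∏ j, Wt (fun p ν => om0 r K P0 (Qs j) p ν * Real.exp ((r*K:ℕ)/p)) (a n0 j) := by
      refine le_trans ?_ h1
      have : N.filter (fun n => a n = a n0) ⊆ (Iv x y).filter (fun n => (∀ j, (a n0 j:ℤ) ∣ (Qs j).eval n) ∧
        ∀ p : ℕ, p.Prime → (p:ℝ) ≤ t → (∀ j, ¬ p ∣ a n0 j) → ∀ j, ¬ (p:ℤ) ∣ (Qs j).eval n) := by
        intro n hn
        obtain ⟨hnN, hna⟩ := Finset.mem_filter.1 hn
        have h3 := (hab n hnN).1
        refine Finset.mem_filter.2 ⟨hN hnN, ?_, ?_⟩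
        · intro j
          rw [← hna, Int.natCast_dvd, (h3 j).1]
          exact dvd_mul_right _ _
        · intro p hp hpt hpa j hpj
          rw [Int.natCast_dvd, (h3 j).1, hna, hp.dvd_mul] at hpj
          rcases hpj with h | h
          · exact hpa j h
          · have := (h3 j).2.2.2.2.2.1 p hp h
            linarith
      exact_mod_cast Finset.card_le_card this
    refine h2.trans ?_
    have e1 : ∏ j, Wt (om r K P0 (Qs j) σ) (a n0 j) =
        (∏ j, Wt (fun p ν => om0 r K P0 (Qs j) p ν * Real.exp ((r*K:ℕ)/p)) (a n0 j)) * ((∏ j, a n0 j : ℕ):ℝ)^σ := by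
      rw [Nat.cast_prod, ← Real.finsetProd_rpow _ _ (fun p _ => by positivity), ← Finset.prod_mul_distrib]
      exact Finset.prod_congr rfl fun j _ => Wt_om _ _ _ _ _ _ (ha0 j)
    rw [e1]
    set X := ∏ j, Wt (fun p ν => om0 r K P0 (Qs j) p ν * Real.exp ((r*K:ℕ)/p)) (a n0 j) with hX
    have hX0 : 0 ≤ X := Finset.prod_nonneg fun j _ => Wt_nonneg _ (fun p ν => mul_nonneg (om0_nonneg _ _ _ _ _ _) (Real.exp_pos _).le) _
    have e2 : 1 ≤ B^(-σ) * ((∏ j, a n0 j : ℕ):ℝ)^σ := by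
      calc (1:ℝ) = B^(-σ) * B^σ := by rw [← Real.rpow_add hB]; simp
        _ ≤ _ := by gcongr
    calc C1 * y * Real.exp (- ∑ j, Rr (Qs j) t) * X = C1 * y * Real.exp (- ∑ j, Rr (Qs j) t) * X * 1 := by ring
      _ ≤ C1 * y * Real.exp (- ∑ j, Rr (Qs j) t) * X * (B^(-σ) * ((∏ j, a n0 j : ℕ):ℝ)^σ) := by gcongr
      _ = _ := by ring
  have hcard : (N.card : ℝ) = ∑ α ∈ Im, ((N.filter (fun n => a n = α)).card : ℝ) := by
    rw [Finset.card_eq_sum_card_image a N]; push_cast; rfl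
  have hB' : 0 ≤ B^(-σ) := by positivity
  rw [hcard]
  calc _ ≤ ∑ α ∈ Im, C1 * y * Real.exp (- ∑ j, Rr (Qs j) t) * B^(-σ) * ∏ j, Wt (om r K P0 (Qs j) σ) (α j) := Finset.sum_le_sum hfib
    _ = C1 * y * Real.exp (- ∑ j, Rr (Qs j) t) * B^(-σ) * ∑ α ∈ Im, ∏ j, Wt (om r K P0 (Qs j) σ) (α j) := by rw [Finset.mul_sum]
    _ ≤ C1 * y * Real.exp (- ∑ j, Rr (Qs j) t) * B^(-σ) * ∑ α ∈ Fintype.piFinset Aj', ∏ j, Wt (om r K P0 (Qs j) σ) (α j) := by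
        gcongr
        intro α _ _
        exact Finset.prod_nonneg fun j _ => hWn _ _
    _ = C1 * y * Real.exp (- ∑ j, Rr (Qs j) t) * B^(-σ) * ∏ j, ∑ m ∈ Aj' j, Wt (om r K P0 (Qs j) σ) m := by
        rw [Finset.prod_univ_sum]
    _ ≤ C1 * y * Real.exp (- ∑ j, Rr (Qs j) t) * B^(-σ) *
        ∏ j, (W * (C2 * Real.exp (Rr (Qs j) t) / Real.sqrt (Ef (f j) t (fun p => (rho (Qs j) p : ℝ))))) := by
        gcongr with j
        · intro j _
          exact Finset.sum_nonneg fun m _ => hWn _ _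
        · refine (sum_biUnion_le_aux (Val j) _ _ (hWn j)).trans ?_
          calc _ ≤ ∑ v ∈ Val j, (C2 * Real.exp (Rr (Qs j) t) / Real.sqrt (Ef (f j) t (fun p => (rho (Qs j) p : ℝ)))) :=
                Finset.sum_le_sum fun v _ => hw ℓ j (Aj j) (f j) (k j - v) hℓ hσ (hAjp j) (hf j)
            _ ≤ _ := by
                rw [Finset.sum_const, nsmul_eq_mul]
                gcongr
                exact hValc j
    _ = _ := by
        rw [Finset.prod_mul_distrib, Finset.prod_div_distrib, Finset.prod_mul_distrib, ← Real.exp_sum, Finset.prod_const,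
          Finset.prod_const, Finset.card_univ, Fintype.card_fin]
        have : Real.exp (- ∑ j, Rr (Qs j) t) * Real.exp (∑ j, Rr (Qs j) t) = 1 := by
          rw [← Real.exp_add]; simp
        generalize (∏ j, Real.sqrt (Ef (f j) t (fun p => (rho (Qs j) p : ℝ)))) = Pd
        calc _ = C1 * C2^r * y * B^(-σ) * W^r / Pd * (Real.exp (- ∑ j, Rr (Qs j) t) * Real.exp (∑ j, Rr (Qs j) t)) := by ring
          _ = _ := by rw [this, mul_one]

lemma event_final {r : ℕ} {Qs : Fin r → Polynomial ℤ} {K P0 : ℕ} (D : PD r Qs K P0) (c : ℝ) (hc : 0 ≤ c) :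
    ∃ C : ℝ, 0 < C ∧ ∀ (ℓ x y B : ℝ) (N : Finset ℤ),
      0 < ℓ → c/ℓ ≤ 1/(4*r) → 0 < B → 0 ≤ y → N ⊆ Iv x y →
      (∀ n ∈ N, ∃ a : Fin r → ℕ, (∀ j, (a j : ℤ) ∣ (Qs j).eval n ∧ a j ≠ 0 ∧
        (∀ p : ℕ, p.Prime → p ∣ a j → (p:ℝ) ≤ Real.exp (4*r*ℓ))) ∧
        ((∏ j, a j : ℕ):ℝ) ≤ y ∧ B ≤ ((∏ j, a j : ℕ):ℝ)) →
      (N.card : ℝ) ≤ C * y * B^(-(c/ℓ)) * Real.exp (∑ j, Rr (Qs j) (Real.exp ℓ)) := by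
  obtain ⟨C2, hC2, hw⟩ := conc_weight D c hc
  refine ⟨2 * C2^r, by positivity, ?_⟩
  intro ℓ x y B N hℓ hσ hB hy hN hn
  choose! a hab using hn
  set σ := c/ℓ with hσd
  have hσ0 : 0 ≤ σ := by positivity
  set t := Real.exp ℓ with ht
  set Aj : Fin r → Finset ℕ := fun j => N.image (fun n => a n j) with hAj
  have hAjp : ∀ j, ∀ m ∈ Aj j, m ≠ 0 ∧ ∀ p : ℕ, p.Prime → p ∣ m → (p:ℝ) ≤ Real.exp (4*r*ℓ) := by
    intro j m hm
    obtain ⟨n, hn, rfl⟩ := Finset.mem_image.1 hm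
    exact ((hab n hn).1 j).2
  set Im := N.image a with hIm
  have hsub : Im ⊆ Fintype.piFinset Aj := by
    intro α hα
    obtain ⟨n, hn, rfl⟩ := Finset.mem_image.1 hα
    rw [Fintype.mem_piFinset]
    intro j
    exact Finset.mem_image.2 ⟨n, hn, rfl⟩
  have hWn : ∀ (j : Fin r) (m : ℕ), 0 ≤ Wt (om r K P0 (Qs j) σ) m := fun j m => Wt_nonneg _ (om_nonneg _ _ _ _ _) _
  have hfib : ∀ α ∈ Im, ((N.filter (fun n => a n = α)).card : ℝ) ≤
      2 * y * B^(-σ) * ∏ j, Wt (om r K P0 (Qs j) σ) (α j) := by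
    intro α hα
    obtain ⟨n0, hn0, rfl⟩ := Finset.mem_image.1 hα
    obtain ⟨h0, hZ, hBn⟩ := hab n0 hn0
    have ha0 : ∀ j, a n0 j ≠ 0 := fun j => (h0 j).2.1
    set M := ∏ j, a n0 j with hM
    have hM0 : M ≠ 0 := Finset.prod_ne_zero_iff.2 fun j _ => ha0 j
    have hM' : (0:ℝ) < M := by exact_mod_cast Nat.pos_of_ne_zero hM0
    have h1 := card_per x hy M (Nat.pos_of_ne_zero hM0) (fun n => ∀ j, (a n0 j:ℤ) ∣ (Qs j).eval n) (per_all Qs (a n0))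
    have h1' := (abs_le.1 h1).2
    have hden := density D (a n0) ha0
    rw [← hM] at hden
    set d : ℝ := (cnt (fun n => ∀ j, (a n0 j:ℤ) ∣ (Qs j).eval n) M : ℝ) with hd
    have hd0 : 0 ≤ d := by positivity
    have h2 : ((N.filter (fun n => a n = a n0)).card : ℝ) ≤ 2 * y * (d/M) := by
      have h3 : N.filter (fun n => a n = a n0) ⊆ (Iv x y).filter (fun n => ∀ j, (a n0 j:ℤ) ∣ (Qs j).eval n) := by
        intro n hn
        obtain ⟨hnN, hna⟩ := Finset.mem_filter.1 hn
        refine Finset.mem_filter.2 ⟨hN hnN, ?_⟩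
        intro j
        rw [← hna]
        exact ((hab n hnN).1 j).1
      have h4 : ((N.filter (fun n => a n = a n0)).card : ℝ) ≤ ((Iv x y).filter (fun n => ∀ j, (a n0 j:ℤ) ∣ (Qs j).eval n)).card := by
        exact_mod_cast Finset.card_le_card h3
      have h5 : d ≤ y * (d/M) := by
        rw [mul_div_assoc', le_div_iff₀ hM', mul_comm]
        gcongr
      have h6 : (((Iv x y).filter (fun n => ∀ j, (a n0 j:ℤ) ∣ (Qs j).eval n)).card : ℝ) - y * (d/M) ≤ d := by
        refine le_trans (le_of_eq ?_) h1'
        congr!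
      linarith
    refine h2.trans ?_
    set X := ∏ j, Wt (om0 r K P0 (Qs j)) (a n0 j) with hX
    have hX0 : 0 ≤ X := Finset.prod_nonneg fun j _ => Wt_nonneg _ (om0_nonneg _ _ _ _) _
    have e1 : X * (M:ℝ)^σ ≤ ∏ j, Wt (om r K P0 (Qs j) σ) (a n0 j) := by
      have hh : (M:ℝ) = ∏ j, (a n0 j : ℝ) := by rw [hM]; push_cast; rfl
      rw [hh, ← Real.finsetProd_rpow _ _ (fun p _ => by positivity), hX, ← Finset.prod_mul_distrib]
      apply Finset.prod_le_prod
      · intro j _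
        have := Wt_nonneg _ (om0_nonneg r K P0 (Qs j)) (a n0 j)
        positivity
      intro j _
      rw [Wt_om _ _ _ _ _ _ (ha0 j)]
      gcongr
      unfold Wt
      apply Finset.prod_le_prod
      · intro p _; exact om0_nonneg _ _ _ _ _ _
      · intro p _
        have := om0_nonneg r K P0 (Qs j) p ((a n0 j).factorization p)
        have h1 : 1 ≤ Real.exp ((r*K:ℕ)/p) := Real.one_le_exp (by positivity)
        exact le_mul_of_one_le_right this h1
    have e2 : 1 ≤ B^(-σ) * (M:ℝ)^σ := by
      calc (1:ℝ) = B^(-σ) * B^σ := by rw [← Real.rpow_add hB]; simp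
        _ ≤ _ := by gcongr
    calc 2 * y * (d/M) ≤ 2 * y * X * 1 := by rw [mul_one]; gcongr
      _ ≤ 2 * y * X * (B^(-σ) * (M:ℝ)^σ) := by gcongr
      _ = 2 * y * B^(-σ) * (X * (M:ℝ)^σ) := by ring
      _ ≤ _ := by gcongr
  have hcard : (N.card : ℝ) = ∑ α ∈ Im, ((N.filter (fun n => a n = α)).card : ℝ) := by
    rw [Finset.card_eq_sum_card_image a N]; push_cast; rfl
  rw [hcard]
  calc _ ≤ ∑ α ∈ Im, 2 * y * B^(-σ) * ∏ j, Wt (om r K P0 (Qs j) σ) (α j) := Finset.sum_le_sum hfib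
    _ = 2 * y * B^(-σ) * ∑ α ∈ Im, ∏ j, Wt (om r K P0 (Qs j) σ) (α j) := by rw [Finset.mul_sum]
    _ ≤ 2 * y * B^(-σ) * ∑ α ∈ Fintype.piFinset Aj, ∏ j, Wt (om r K P0 (Qs j) σ) (α j) := by
        gcongr
        intro α _ _
        exact Finset.prod_nonneg fun j _ => hWn _ _
    _ = 2 * y * B^(-σ) * ∏ j, ∑ m ∈ Aj j, Wt (om r K P0 (Qs j) σ) m := by
        rw [Finset.prod_univ_sum]
    _ ≤ 2 * y * B^(-σ) * ∏ j, (C2 * Real.exp (Rr (Qs j) t)) := by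
        gcongr with j
        · intro j _
          exact Finset.sum_nonneg fun m _ => hWn _ _
        · have h1 := hw ℓ j (Aj j) (fun _ => 0) 0 hℓ hσ (hAjp j) (by simp)
          rw [Finset.filter_true_of_mem (by simp)] at h1
          refine h1.trans ?_
          apply div_le_self (by positivity)
          rw [Real.one_le_sqrt]
          exact Ef_ge_one _ _ _
    _ = _ := by
        rw [Finset.prod_mul_distrib, ← Real.exp_sum, Finset.prod_const, Finset.card_univ, Fintype.card_fin]
        ring


/-- the part of `q` composed of primes `< m` -/
noncomputable def sm (m q : ℕ) : ℕ := ∏ p ∈ q.primeFactors.filter (fun p => p < m), p ^ q.factorization p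
/-- the complementary part -/
noncomputable def co (m q : ℕ) : ℕ := ∏ p ∈ q.primeFactors.filter (fun p => ¬ p < m), p ^ q.factorization p

lemma sm_mul_co (m q : ℕ) (hq : q ≠ 0) : q = sm m q * co m q := by
  unfold sm co
  rw [Finset.prod_filter_mul_prod_filter_not]
  exact (Nat.prod_factorization_pow_eq_self hq).symm

lemma dvd_sm {m q p : ℕ} (hp : p.Prime) (h : p ∣ sm m q) : p < m := by
  obtain ⟨s, hs, hd⟩ := (Nat.Prime.prime hp).exists_mem_finset_dvd h
  obtain ⟨h1, h2⟩ := Finset.mem_filter.1 hs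
  have := (Nat.prime_dvd_prime_iff_eq hp (Nat.prime_of_mem_primeFactors h1)).1 (hp.dvd_of_dvd_pow hd)
  omega

lemma dvd_co {m q p : ℕ} (hp : p.Prime) (h : p ∣ co m q) : m ≤ p := by
  obtain ⟨s, hs, hd⟩ := (Nat.Prime.prime hp).exists_mem_finset_dvd h
  obtain ⟨h1, h2⟩ := Finset.mem_filter.1 hs
  have := (Nat.prime_dvd_prime_iff_eq hp (Nat.prime_of_mem_primeFactors h1)).1 (hp.dvd_of_dvd_pow hd)
  omega

lemma sm_ne_zero (m q : ℕ) (hq : q ≠ 0) : sm m q ≠ 0 := fun h => hq (by rw [sm_mul_co m q hq, h, zero_mul])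
lemma co_ne_zero (m q : ℕ) (hq : q ≠ 0) : co m q ≠ 0 := fun h => hq (by rw [sm_mul_co m q hq, h, mul_zero])

lemma sm_co_coprime (m q : ℕ) : Nat.Coprime (sm m q) (co m q) := by
  apply Nat.coprime_of_dvd
  intro p hp h1 h2
  have := dvd_sm hp h1
  have := dvd_co hp h2
  omega

lemma sm_succ (m q : ℕ) : sm (m+1) q = sm m q * m ^ q.factorization m := by
  unfold sm
  by_cases hm : m ∈ q.primeFactors
  · have : q.primeFactors.filter (fun p => p < m+1) = insert m (q.primeFactors.filter (fun p => p < m)) := by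
      ext p
      simp only [Finset.mem_filter, Finset.mem_insert]
      constructor
      · rintro ⟨h1, h2⟩
        by_cases h : p = m
        · exact Or.inl h
        · exact Or.inr ⟨h1, by omega⟩
      · rintro (rfl | ⟨h1, h2⟩)
        · exact ⟨hm, by omega⟩
        · exact ⟨h1, by omega⟩
    rw [this, Finset.prod_insert (by simp), mul_comm]
  · have h0 : q.factorization m = 0 := by
      rw [← Finsupp.notMem_support_iff, Nat.support_factorization]
      exact hm
    rw [h0, pow_zero, mul_one]
    congr 1
    ext p
    simp only [Finset.mem_filter]
    constructor
    · rintro ⟨h1, h2⟩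
      refine ⟨h1, ?_⟩
      have : p ≠ m := fun h => hm (h ▸ h1)
      omega
    · rintro ⟨h1, h2⟩
      exact ⟨h1, by omega⟩

lemma sm_big (m q : ℕ) (hq : q ≠ 0) (h : q < m) : sm m q = q := by
  unfold sm
  rw [Finset.filter_true_of_mem]
  · exact Nat.prod_factorization_pow_eq_self hq
  · intro p hp
    exact lt_of_le_of_lt (Nat.le_of_dvd (Nat.pos_of_ne_zero hq) (Nat.dvd_of_mem_primeFactors hp)) h

lemma classify {r : ℕ} (hr : 1 ≤ r) (q : Fin r → ℕ) (T : ℝ) (hT : 1 ≤ T) (h0 : ∀ j, T^(4*r) < (q j : ℝ))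
    (hB : ∀ j, ∀ p : ℕ, p.Prime → (p:ℝ) ≤ T → (p:ℝ)^((q j).factorization p) ≤ T^2) :
    ∃ p : ℕ, p.Prime ∧ ((∏ j, sm p (q j) : ℕ):ℝ) ≤ T^(4*r) ∧
      ((p:ℝ) ≤ T → T^(2*r) ≤ ((∏ j, sm p (q j) : ℕ):ℝ)) := by
  have hq : ∀ j, q j ≠ 0 := by
    intro j hj
    have := h0 j
    rw [hj] at this
    have h2 : 0 ≤ T^(4*r) := by positivity
    push_cast at this
    linarith
  have hex : ∃ m : ℕ, T^(4*r) < ((∏ j, sm (m+1) (q j) : ℕ):ℝ) := by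
    refine ⟨Finset.univ.sup q, ?_⟩
    have : ∏ j, sm (Finset.univ.sup q + 1) (q j) = ∏ j, q j := by
      apply Finset.prod_congr rfl
      intro j _
      apply sm_big _ _ (hq j)
      have : q j ≤ Finset.univ.sup q := Finset.le_sup (f := q) (Finset.mem_univ j)
      omega
    rw [this]
    refine lt_of_lt_of_le (h0 ⟨0, hr⟩) ?_
    have : q ⟨0, hr⟩ ≤ ∏ j, q j := by
      apply Nat.le_of_dvd (Nat.pos_of_ne_zero (Finset.prod_ne_zero_iff.2 fun j _ => hq j))
      exact Finset.dvd_prod_of_mem q (Finset.mem_univ _)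
    exact_mod_cast this
  set p := Nat.find hex with hp
  have h1 : T^(4*r) < ((∏ j, sm (p+1) (q j) : ℕ):ℝ) := Nat.find_spec hex
  have h2 : ((∏ j, sm p (q j) : ℕ):ℝ) ≤ T^(4*r) := by
    by_cases hp0 : p = 0
    · rw [hp0]
      have : ∏ j, sm 0 (q j) = 1 := by
        apply Finset.prod_eq_one
        intro j _
        unfold sm
        simp
      rw [this]
      push_cast
      exact one_le_pow₀ hT
    · have := Nat.find_min hex (m := p - 1) (by omega)
      rw [not_lt] at this
      rwa [show p - 1 + 1 = p by omega] at this
  have h3 : ∏ j, sm (p+1) (q j) = (∏ j, sm p (q j)) * ∏ j, p^((q j).factorization p) := by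
    rw [← Finset.prod_mul_distrib]
    exact Finset.prod_congr rfl fun j _ => sm_succ _ _
  have hpp : p.Prime := by
    by_contra hnp
    have : ∏ j, p^((q j).factorization p) = 1 := by
      apply Finset.prod_eq_one
      intro j _
      rw [Nat.factorization_eq_zero_of_not_prime _ hnp, pow_zero]
    rw [this, mul_one] at h3
    rw [h3] at h1
    linarith
  refine ⟨p, hpp, h2, ?_⟩
  intro hpT
  rw [h3] at h1
  push_cast at h1 ⊢
  have h4 : ∏ j, (p:ℝ)^((q j).factorization p) ≤ T^(2*r) := by
    calc _ ≤ ∏ j : Fin r, T^2 := Finset.prod_le_prod (fun j _ => by positivity) fun j _ => hB j p hpp hpT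
      _ = _ := by rw [Finset.prod_const, Finset.card_univ, Fintype.card_fin, ← pow_mul]
  by_contra hc
  push Not at hc
  have hh : 0 < T^(2*r) := by positivity
  have : (∏ j, (sm p (q j):ℝ)) * ∏ j, (p:ℝ)^((q j).factorization p) ≤ T^(2*r) * T^(2*r) := by
    gcongr
  rw [← pow_add, show 2*r+2*r = 4*r by ring] at this
  linarith

lemma exc0 {r : ℕ} {Qs : Fin r → Polynomial ℤ} {K P0 : ℕ} (D : PD r Qs K P0) (x y Z : ℝ) (hZ : 1 ≤ Z) :
    (((Iv x y).filter (fun n => ∃ j, (((Qs j).eval n).natAbs : ℝ) ≤ Z)).card : ℝ) ≤ 3*r*K*Z := by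
  set S : Fin r → Finset ℤ := fun j => (Iv x y).filter (fun n => (((Qs j).eval n).natAbs : ℝ) ≤ Z) with hS
  have h1 : (Iv x y).filter (fun n => ∃ j, (((Qs j).eval n).natAbs : ℝ) ≤ Z) ⊆ Finset.univ.biUnion S := by
    intro n hn
    obtain ⟨h1, j, h2⟩ := Finset.mem_filter.1 hn
    exact Finset.mem_biUnion.2 ⟨j, Finset.mem_univ _, Finset.mem_filter.2 ⟨h1, h2⟩⟩
  have h2 : ∀ j, (S j).card ≤ K * (2*⌊Z⌋₊+1) := by
    intro j
    have hmap : ∀ n ∈ S j, (Qs j).eval n ∈ Finset.Icc (-(⌊Z⌋₊:ℤ)) ⌊Z⌋₊ := by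
      intro n hn
      have h2 := (Finset.mem_filter.1 hn).2
      have h3 := Nat.le_floor h2
      rw [Finset.mem_Icc]
      omega
    have := Finset.card_le_mul_card_image_of_maps_to hmap K (by
      intro b _
      apply D.fib j b
      intro n hn
      exact (Finset.mem_filter.1 hn).2)
    refine this.trans (le_of_eq ?_)
    rw [Int.card_Icc]
    congr 1
    omega
  have h3 := Finset.card_le_card h1
  have h4 : (Finset.univ.biUnion S).card ≤ r * (K * (2*⌊Z⌋₊+1)) := by
    refine Finset.card_biUnion_le.trans ?_
    calc _ ≤ ∑ j : Fin r, K * (2*⌊Z⌋₊+1) := Finset.sum_le_sum fun j _ => h2 j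
      _ = _ := by simp
  have h5 : (⌊Z⌋₊:ℝ) ≤ Z := Nat.floor_le (by linarith)
  calc _ ≤ ((r * (K * (2*⌊Z⌋₊+1)) : ℕ) : ℝ) := by exact_mod_cast h3.trans h4
    _ = r * (K * (2*⌊Z⌋₊+1)) := by push_cast; ring
    _ ≤ r * (K * (2*Z+Z)) := by gcongr
    _ = _ := by ring

lemma excB {r : ℕ} {Qs : Fin r → Polynomial ℤ} {K P0 : ℕ} (D : PD r Qs K P0) (x y T : ℝ) (hT : 1 ≤ T) (hy : T^2 ≤ y) :
    (((Iv x y).filter (fun n => ∃ j, ∃ p : ℕ, p.Prime ∧ (p:ℝ) ≤ T ∧ ∃ w : ℕ, T^2 < (p:ℝ)^w ∧ ((p^w:ℕ):ℤ) ∣ (Qs j).eval n)).card : ℝ)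
      ≤ 2*r*K*(y/T) := by
  have hy0 : 0 ≤ y := le_trans (by positivity) hy
  have hw : ∀ p : ℕ, ∃ w : ℕ, p.Prime → T^2 < (p:ℝ)^w ∧ ∀ w' : ℕ, T^2 < (p:ℝ)^w' → w ≤ w' := by
    intro p
    by_cases hp : p.Prime
    · have hex : ∃ w : ℕ, T^2 < (p:ℝ)^w := pow_unbounded_of_one_lt _ (by exact_mod_cast hp.one_lt)
      exact ⟨Nat.find hex, fun _ => ⟨Nat.find_spec hex, fun w' hw' => Nat.find_min' hex hw'⟩⟩
    · exact ⟨0, fun h => absurd h hp⟩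
  choose w hw using hw
  set S : Fin r × ℕ → Finset ℤ := fun jp => (Iv x y).filter (fun n => ((jp.2^(w jp.2):ℕ):ℤ) ∣ (Qs jp.1).eval n) with hS
  have h1 : (Iv x y).filter (fun n => ∃ j, ∃ p : ℕ, p.Prime ∧ (p:ℝ) ≤ T ∧ ∃ w : ℕ, T^2 < (p:ℝ)^w ∧ ((p^w:ℕ):ℤ) ∣ (Qs j).eval n) ⊆
      (Finset.univ ×ˢ primesBelow T).biUnion S := by
    intro n hn
    obtain ⟨h1, j, p, hp, hpT, v, hv, hd⟩ := Finset.mem_filter.1 hn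
    refine Finset.mem_biUnion.2 ⟨(j,p), Finset.mem_product.2 ⟨Finset.mem_univ _, mem_primesBelow'.2 ⟨hp, hpT⟩⟩, Finset.mem_filter.2 ⟨h1, ?_⟩⟩
    refine dvd_trans ?_ hd
    exact_mod_cast pow_dvd_pow p ((hw p hp).2 v hv)
  have h2 : ∀ jp ∈ (Finset.univ ×ˢ primesBelow T : Finset (Fin r × ℕ)), ((S jp).card : ℝ) ≤ 2 * K * (y/T^2) := by
    rintro ⟨j, p⟩ hjp
    obtain ⟨hp, hpT⟩ := mem_primesBelow'.1 (Finset.mem_product.1 hjp).2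
    have hpw := (hw p hp).1
    have hpos : 0 < p^(w p) := pow_pos hp.pos _
    have h3 := card_per x hy0 (p^(w p)) hpos (fun n => ((p^(w p):ℕ):ℤ) ∣ (Qs j).eval n) (per_dvd (Qs j) _)
    rw [cnt_dvd] at h3
    have h4 := (abs_le.1 h3).2
    have h5 : (rho (Qs j) (p^(w p)) : ℝ) ≤ K := by exact_mod_cast D.rho_le j p (w p) hp
    have h6 : y * ((rho (Qs j) (p^(w p)) : ℝ)/((p^(w p):ℕ):ℝ)) ≤ y * (K/T^2) := by
      gcongr
      push_cast
      exact hpw.le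
    have h7 : (K:ℝ) ≤ y * (K/T^2) := by
      rw [mul_div_assoc', le_div_iff₀ (by positivity), mul_comm]
      gcongr
    have h8 : ((S (j,p)).card : ℝ) - y * ((rho (Qs j) (p^(w p)) : ℝ)/((p^(w p):ℕ):ℝ)) ≤ (rho (Qs j) (p^(w p)) : ℝ) := by
      refine le_trans (le_of_eq ?_) h4
      congr!
    calc ((S (j,p)).card : ℝ) ≤ y * (K/T^2) + y * (K/T^2) := by linarith
      _ = _ := by ring
  have h3 : (((Iv x y).filter (fun n => ∃ j, ∃ p : ℕ, p.Prime ∧ (p:ℝ) ≤ T ∧ ∃ w : ℕ, T^2 < (p:ℝ)^w ∧ ((p^w:ℕ):ℤ) ∣ (Qs j).eval n)).card : ℝ) ≤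
      (((Finset.univ ×ˢ primesBelow T).biUnion S).card : ℝ) := by exact_mod_cast Finset.card_le_card h1
  have h4 : (((Finset.univ ×ˢ primesBelow T).biUnion S).card : ℝ) ≤ ∑ jp ∈ (Finset.univ ×ˢ primesBelow T : Finset (Fin r × ℕ)), ((S jp).card : ℝ) := by
    exact_mod_cast Finset.card_biUnion_le
  have h5 : ((primesBelow T).card : ℝ) ≤ T := by
    have : primesBelow T ⊆ Finset.Icc 1 ⌊T⌋₊ := by
      intro p hp
      obtain ⟨hp, hpT⟩ := mem_primesBelow'.1 hp
      exact Finset.mem_Icc.2 ⟨hp.one_lt.le, Nat.le_floor hpT⟩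
    have h6 := Finset.card_le_card this
    rw [Nat.card_Icc] at h6
    have h7 : (⌊T⌋₊:ℝ) ≤ T := Nat.floor_le (by linarith)
    have h8 : ((primesBelow T).card : ℝ) ≤ (⌊T⌋₊:ℝ) := by exact_mod_cast h6
    linarith
  refine h3.trans (h4.trans ?_)
  calc _ ≤ ∑ jp ∈ (Finset.univ ×ˢ primesBelow T : Finset (Fin r × ℕ)), (2 * K * (y/T^2)) := Finset.sum_le_sum h2
    _ = r * (primesBelow T).card * (2 * K * (y/T^2)) := by
        rw [Finset.sum_const, Finset.card_product, Finset.card_univ, Fintype.card_fin, nsmul_eq_mul]; push_cast; ring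
    _ ≤ r * T * (2 * K * (y/T^2)) := by gcongr
    _ = _ := by
        have : T ≠ 0 := by linarith
        field_simp


/-- the sieve event at scale `ℓ` -/
def EvP {r : ℕ} (Qs : Fin r → Polynomial ℤ) (f : Fin r → ℕ → ℝ) (k : Fin r → ℝ) (ℓ s B Z : ℝ) (n : ℤ) : Prop :=
  ∃ a b : Fin r → ℕ, (∀ j, ((Qs j).eval n).natAbs = a j * b j ∧ Nat.Coprime (a j) (b j) ∧
        a j ≠ 0 ∧ 0 < b j ∧ (b j : ℝ) ≤ s ∧ (∀ p : ℕ, p.Prime → p ∣ b j → Real.exp ℓ < (p:ℝ)) ∧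
        (∀ p : ℕ, p.Prime → p ∣ a j → (p:ℝ) ≤ Real.exp (4*r*ℓ)) ∧ f j ((Qs j).eval n).natAbs = k j) ∧
        ((∏ j, a j : ℕ):ℝ) ≤ Z ∧ B ≤ ((∏ j, a j : ℕ):ℝ)

/-- the final event -/
def FinP {r : ℕ} (Qs : Fin r → Polynomial ℤ) (ℓ B Z : ℝ) (n : ℤ) : Prop :=
  ∃ a : Fin r → ℕ, (∀ j, (a j : ℤ) ∣ (Qs j).eval n ∧ a j ≠ 0 ∧
        (∀ p : ℕ, p.Prime → p ∣ a j → (p:ℝ) ≤ Real.exp (4*r*ℓ))) ∧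
        ((∏ j, a j : ℕ):ℝ) ≤ Z ∧ B ≤ ((∏ j, a j : ℕ):ℝ)

lemma covering {r : ℕ} (hr : 1 ≤ r) (Qs : Fin r → Polynomial ℤ) (f : Fin r → ℕ → ℝ) (k : Fin r → ℝ) (L s : ℝ) (hL : 0 < L)
    (I : ℕ) (n : ℤ) (hs : ∀ j, (((Qs j).eval n).natAbs : ℝ) ≤ s)
    (hk : ∀ j, f j ((Qs j).eval n).natAbs = k j)
    (h0 : ¬ ∃ j, (((Qs j).eval n).natAbs : ℝ) ≤ (Real.exp L)^(4*r))
    (hB : ¬ ∃ j, ∃ p : ℕ, p.Prime ∧ (p:ℝ) ≤ Real.exp L ∧ ∃ w : ℕ, (Real.exp L)^2 < (p:ℝ)^w ∧ ((p^w:ℕ):ℤ) ∣ (Qs j).eval n) :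
    (∃ i ∈ Finset.range (I+1), EvP Qs f k (L/2^i) s (if i = 0 then 1 else (Real.exp L)^(2*r)) ((Real.exp L)^(4*r)) n) ∨
      FinP Qs (L/2^I) ((Real.exp L)^(2*r)) ((Real.exp L)^(4*r)) n := by
  push Not at h0 hB
  set q : Fin r → ℕ := fun j => ((Qs j).eval n).natAbs with hq
  have hr' : (1:ℝ) ≤ r := by exact_mod_cast hr
  have hT : 1 ≤ Real.exp L := Real.one_le_exp hL.le
  have hqd : ∀ j (m : ℕ), (m:ℤ) ∣ (Qs j).eval n ↔ m ∣ q j := fun j m => Int.natCast_dvd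
  obtain ⟨p, hp, hpZ, hpB⟩ := classify hr q (Real.exp L) hT h0 (by
    intro j p hp hpT
    by_contra hc
    push Not at hc
    refine hB j p hp hpT _ hc ?_
    rw [hqd]
    exact Nat.ordProj_dvd _ _)
  have hq0 : ∀ j, q j ≠ 0 := by
    intro j hj
    have := h0 j
    rw [show ((Qs j).eval n).natAbs = q j from rfl, hj] at this
    have h2 : 0 ≤ (Real.exp L)^(4*r) := by positivity
    push_cast at this
    linarith
  have hev : ∀ (ℓ B : ℝ), Real.exp ℓ < p → (∀ j, ∀ s : ℕ, s.Prime → s ∣ sm p (q j) → (s:ℝ) ≤ Real.exp (4*r*ℓ)) →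
      B ≤ ((∏ j, sm p (q j) : ℕ):ℝ) → EvP Qs f k ℓ s B ((Real.exp L)^(4*r)) n := by
    intro ℓ B h1 h2 h3
    refine ⟨fun j => sm p (q j), fun j => co p (q j), ?_, hpZ, h3⟩
    intro j
    refine ⟨sm_mul_co _ _ (hq0 j), sm_co_coprime _ _, sm_ne_zero _ _ (hq0 j), Nat.pos_of_ne_zero (co_ne_zero _ _ (hq0 j)), ?_, ?_, h2 j, hk j⟩
    · refine le_trans ?_ (hs j)
      have : co p (q j) ≤ q j := Nat.le_of_dvd (Nat.pos_of_ne_zero (hq0 j)) (Dvd.intro_left _ (sm_mul_co _ _ (hq0 j)).symm)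
      exact_mod_cast this
    · intro s hs1 hs2
      refine lt_of_lt_of_le h1 ?_
      exact_mod_cast dvd_co hs1 hs2
  by_cases hpT : Real.exp L < p
  · left
    refine ⟨0, by simp, ?_⟩
    rw [if_pos rfl]
    simp only [pow_zero, div_one]
    apply hev L 1 hpT
    · intro j s hs1 hs2
      have h1 : s ∣ ∏ j, sm p (q j) := hs2.trans (Finset.dvd_prod_of_mem (fun j => sm p (q j)) (Finset.mem_univ j))
      have h2 : s ≤ ∏ j, sm p (q j) := Nat.le_of_dvd (Nat.pos_of_ne_zero (Finset.prod_ne_zero_iff.2 fun j _ => sm_ne_zero _ _ (hq0 j))) h1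
      calc (s:ℝ) ≤ ((∏ j, sm p (q j) : ℕ):ℝ) := by exact_mod_cast h2
        _ ≤ _ := hpZ
        _ = _ := by rw [← Real.exp_nat_mul]; push_cast; rfl
    · have : 0 < ∏ j, sm p (q j) := Nat.pos_of_ne_zero (Finset.prod_ne_zero_iff.2 fun j _ => sm_ne_zero _ _ (hq0 j))
      exact_mod_cast this
  · push Not at hpT
    by_cases hpI : (p:ℝ) ≤ Real.exp (L/2^I)
    · right
      refine ⟨fun j => sm p (q j), ?_, hpZ, hpB hpT⟩
      intro j
      refine ⟨?_, sm_ne_zero _ _ (hq0 j), ?_⟩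
      · rw [hqd]
        exact Dvd.intro _ (sm_mul_co p _ (hq0 j)).symm
      · intro s hs1 hs2
        have h1 : (s:ℝ) ≤ p := by exact_mod_cast (dvd_sm hs1 hs2).le
        refine h1.trans (hpI.trans (Real.exp_le_exp.2 ?_))
        have : 0 < L/2^I := by positivity
        nlinarith
    · push Not at hpI
      have hex : ∃ i : ℕ, Real.exp (L/2^i) < p := ⟨I, hpI⟩
      set i := Nat.find hex with hi
      have hi1 : Real.exp (L/2^i) < p := Nat.find_spec hex
      have hiI : i ≤ I := Nat.find_min' hex hpI
      have hi0 : i ≠ 0 := by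
        intro h
        rw [h] at hi1
        simp only [pow_zero, div_one] at hi1
        linarith
      have hi2 : (p:ℝ) ≤ Real.exp (L/2^(i-1)) := by
        have := Nat.find_min hex (m := i-1) (by omega)
        exact not_lt.1 this
      left
      refine ⟨i, by rw [Finset.mem_range]; omega, ?_⟩
      rw [if_neg hi0]
      apply hev _ _ hi1 _ (hpB hpT)
      intro j s hs1 hs2
      have h1 : (s:ℝ) ≤ p := by exact_mod_cast (dvd_sm hs1 hs2).le
      refine h1.trans (hi2.trans (Real.exp_le_exp.2 ?_))
      have h3 : L/2^(i-1) = 2 * (L/2^i) := by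
        conv_rhs => rw [show i = (i-1)+1 by omega, pow_succ]
        field_simp
      have : 0 < L/2^i := by positivity
      rw [h3]
      nlinarith

lemma Rr_le {r : ℕ} {Qs : Fin r → Polynomial ℤ} {K P0 : ℕ} (D : PD r Qs K P0) (j : Fin r) (t x : ℝ) (hx : 2 ≤ x) (htx : t ≤ x) :
    Rr (Qs j) t ≤ K * (10 + 8 * Real.log (1 + Real.log x)) := by
  have h1 := sum_inv_loglog hx
  calc Rr (Qs j) t ≤ ∑ p ∈ primesBelow t, (K:ℝ) * (1/p) := by
        apply Finset.sum_le_sum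
        intro p hp
        have hrho : (rho (Qs j) p : ℝ) ≤ K := by exact_mod_cast rho_prime_le' D j (mem_primesBelow'.1 hp).1
        rw [mul_one_div]
        gcongr
    _ ≤ ∑ p ∈ primesBelow x, (K:ℝ) * (1/p) := by
        apply Finset.sum_le_sum_of_subset_of_nonneg (primesBelow_mono htx)
        intros; positivity
    _ = K * ∑ p ∈ primesBelow x, (1:ℝ)/p := by rw [Finset.mul_sum]
    _ ≤ _ := by gcongr

lemma exp_loglog (N : ℕ) (x : ℝ) (hx : 2 ≤ x) :
    Real.exp (N * (10 + 8 * Real.log (1 + Real.log x))) = Real.exp (10*N) * (1 + Real.log x)^(8*N) := by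
  have : 0 < 1 + Real.log x := by have := Real.log_nonneg (show 1 ≤ x by linarith); linarith
  rw [mul_add, Real.exp_add, mul_comm (N:ℝ) 10]
  congr 1
  rw [show (N:ℝ) * (8 * Real.log (1+Real.log x)) = ((8*N:ℕ):ℝ) * Real.log (1+Real.log x) by push_cast; ring,
    Real.exp_nat_mul, Real.exp_log this]

lemma prodE_le {r : ℕ} {Qs : Fin r → Polynomial ℤ} {K P0 : ℕ} (D : PD r Qs K P0) (f : Fin r → ℕ → ℝ) (x : ℝ) (hx : 2 ≤ x) :
    ∏ j, Real.sqrt (Ef (f j) x (fun p => (rho (Qs j) p : ℝ))) ≤ Real.exp (10*(r*K:ℕ)) * (1 + Real.log x)^(8*(r*K)) := by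
  rw [← exp_loglog (r*K) x hx]
  have : Real.exp ((r*K:ℕ) * (10 + 8 * Real.log (1 + Real.log x))) = ∏ j : Fin r, Real.exp (K * (10 + 8 * Real.log (1 + Real.log x))) := by
    rw [Finset.prod_const, Finset.card_univ, Fintype.card_fin, ← Real.exp_nat_mul]
    push_cast
    ring_nf
  rw [this]
  apply Finset.prod_le_prod (fun j _ => Real.sqrt_nonneg _)
  intro j _
  have h1 := Ef_ge_one (f j) x (Qs j)
  have h2 : Ef (f j) x (fun p => (rho (Qs j) p : ℝ)) ≤ 1 + Rr (Qs j) x := by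
    unfold Ef Rr
    gcongr 1 + ?_
    apply Finset.sum_le_sum_of_subset_of_nonneg (Finset.filter_subset _ _)
    intros; positivity
  have h3 := Rr_le D j x x hx le_rfl
  have h4 := Real.add_one_le_exp (K * (10 + 8 * Real.log (1 + Real.log x)))
  calc _ ≤ Ef (f j) x (fun p => (rho (Qs j) p : ℝ)) := by
        rw [Real.sqrt_le_left (by linarith)]
        nlinarith
    _ ≤ _ := by linarith

lemma expRr_le {r : ℕ} {Qs : Fin r → Polynomial ℤ} {K P0 : ℕ} (D : PD r Qs K P0) (t x : ℝ) (hx : 2 ≤ x) (htx : t ≤ x) :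
    Real.exp (∑ j, Rr (Qs j) t) ≤ Real.exp (10*(r*K:ℕ)) * (1 + Real.log x)^(8*(r*K)) := by
  rw [← exp_loglog (r*K) x hx]
  apply Real.exp_le_exp.2
  calc _ ≤ ∑ j : Fin r, K * (10 + 8 * Real.log (1 + Real.log x)) := Finset.sum_le_sum fun j _ => Rr_le D j t x hx htx
    _ = _ := by rw [Finset.sum_const, Finset.card_univ, Fintype.card_fin, nsmul_eq_mul]; push_cast; ring

lemma polyexp (N : ℕ) (β lam : ℝ) (hβ : 0 < β) (hl : 0 < lam) :
    ∃ C : ℝ, 0 < C ∧ ∀ v : ℝ, 1 ≤ v → (1+v)^N ≤ C * Real.exp (β * v^lam) := by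
  obtain ⟨M, hM⟩ := exists_nat_ge ((N:ℝ)/lam)
  refine ⟨2^N * (M.factorial / β^M), by positivity, ?_⟩
  intro v hv
  have hv0 : 0 < v := by linarith
  have h1 : (1+v)^N ≤ (2*v)^N := by gcongr; linarith
  have h2 : v^N ≤ (v^lam)^M := by
    rw [← Real.rpow_natCast, ← Real.rpow_natCast, ← Real.rpow_mul hv0.le]
    apply Real.rpow_le_rpow_of_exponent_le hv
    rw [div_le_iff₀ hl] at hM
    linarith
  have h3 := Real.pow_div_factorial_le_exp (β * v^lam) (by positivity) M
  rw [div_le_iff₀ (by positivity), mul_pow] at h3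
  calc (1+v)^N ≤ (2*v)^N := h1
    _ = 2^N * v^N := by rw [mul_pow]
    _ ≤ 2^N * (v^lam)^M := by gcongr
    _ = 2^N * (1/β^M * (β^M * (v^lam)^M)) := by field_simp
    _ ≤ 2^N * (1/β^M * (Real.exp (β * v^lam) * M.factorial)) := by gcongr
    _ = _ := by ring


lemma size_le {r : ℕ} {Qs : Fin r → Polynomial ℤ} {K P0 : ℕ} (D : PD r Qs K P0) (x y : ℝ) (hx : 2 ≤ x) (hyx : y ≤ x)
    (n : ℤ) (hn : n ∈ Iv x y) (j : Fin r) : (((Qs j).eval n).natAbs : ℝ) ≤ Real.exp (3*K*Real.log x) := by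
  obtain ⟨h1, h2⟩ := mem_Iv.1 hn
  have hn1 : 1 ≤ n := by
    have : (1:ℝ) < n := by linarith
    exact_mod_cast this.le
  have h3 := D.size j n hn1
  have h4 : (((Qs j).eval n).natAbs : ℝ) ≤ K * (n:ℝ)^K := by
    rw [Nat.cast_natAbs]
    exact_mod_cast h3
  have h5 : (n:ℝ) ≤ x^2 := by nlinarith
  have h6 : (K:ℝ) ≤ x^K := by
    have : (K:ℝ) ≤ 2^K := by exact_mod_cast (Nat.lt_two_pow_self (n := K)).le
    refine this.trans ?_
    gcongr
  have hn0 : (0:ℝ) ≤ n := by linarith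
  calc _ ≤ K * (n:ℝ)^K := h4
    _ ≤ x^K * (x^2)^K := by gcongr
    _ = x^(3*K) := by rw [← pow_mul, ← pow_add]; ring_nf
    _ = _ := by
        rw [show (3*(K:ℝ)*Real.log x) = ((3*K:ℕ):ℝ) * Real.log x by push_cast; ring, Real.exp_nat_mul, Real.exp_log (by linarith)]

set_option maxHeartbeats 4000000 in
lemma main_large {r : ℕ} {Qs : Fin r → Polynomial ℤ} {K P0 : ℕ} (D : PD r Qs K P0) (V : ℕ) (hV : 1 ≤ V) (ε lam : ℝ)
    (hε : 0 < ε) (hlam : 0 < lam) (hlam1 : lam < 1) :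
    ∃ C X0 : ℝ, 0 < C ∧ 1 ≤ X0 ∧ ∀ (x y : ℝ) (f : Fin r → ℕ → ℝ) (k : Fin r → ℝ),
        2 ≤ x → X0 ≤ Real.log x → x ^ ε < y → y ≤ x →
        (∀ j, ∀ m n : ℕ, Nat.Coprime m n → f j (m * n) = f j m + f j n) →
        (∀ j, ∀ t u : ℝ, Real.exp ((Real.log x) ^ (1 - lam)) ≤ t → 1 ≤ u →
          (({v : ℝ | ∃ n : ℕ, 0 < n ∧ (n : ℝ) ≤ t ^ u ∧
              (∀ p : ℕ, p.Prime → p ∣ n → t < (p : ℝ)) ∧ f j n = v}).ncard : ℝ) ≤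
            (V : ℝ) ^ u) →
        (((Iv x y).filter (fun n => ∀ j, extZ (f j) ((Qs j).eval n) = k j)).card : ℝ) ≤
          C * y / ∏ j, Real.sqrt (Ef (f j) x (fun p => (rho (Qs j) p : ℝ))) := by
  have hr := D.hr
  have hK := D.hK
  have hr' : (1:ℝ) ≤ r := by exact_mod_cast hr
  have hK' : (1:ℝ) ≤ K := by exact_mod_cast hK
  have hV' : (1:ℝ) ≤ V := by exact_mod_cast hV
  have hlogV : 0 ≤ Real.log V := Real.log_nonneg hV'
  obtain ⟨m0, hm0⟩ : ∃ m : ℕ, m = 4*r+4+4*(r*K) := ⟨_, rfl⟩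
  have hm0' : (8:ℝ) ≤ m0 := by
    have : 8 ≤ m0 := by omega
    exact_mod_cast this
  obtain ⟨cu, hcu⟩ : ∃ cu : ℝ, cu = 3*K*m0/ε := ⟨_, rfl⟩
  obtain ⟨κ, hκ⟩ : ∃ κ : ℝ, κ = 2*K*m0/ε := ⟨_, rfl⟩
  have hcu0 : 0 ≤ cu := by rw [hcu]; positivity
  have hκ0 : 0 ≤ κ := by rw [hκ]; positivity
  obtain ⟨c, hc⟩ : ∃ c : ℝ, c = cu * Real.log V + κ + 1 := ⟨_, rfl⟩
  have hc1 : 1 ≤ c := by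
    have : 0 ≤ cu * Real.log V := by positivity
    linarith
  have hc0 : 0 ≤ c := by linarith
  obtain ⟨C1, hC1, hev⟩ := event D c hc0
  obtain ⟨C2, hC2, hfin⟩ := event_final D c hc0
  obtain ⟨C3, hC3, hpe3⟩ := polyexp (16*(r*K)) (r*c*(ε/m0)) lam (by positivity) hlam
  obtain ⟨C4, hC4, hpe4⟩ := polyexp (8*(r*K)) (ε/m0) 1 (by positivity) one_pos
  obtain ⟨g10, hg10⟩ : ∃ g : ℝ, g = Real.exp (10*(r*K:ℕ)) := ⟨_, rfl⟩
  have hg0 : 0 < g10 := by rw [hg10]; positivity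
  refine ⟨5*r*K*g10*C4 + C1*Real.exp (2*r*c)*2 + C2*g10^2*C3,
    max 1 (max ((m0/ε)^(1/lam)) ((4*r*c)^(1/(1-lam)))), by positivity, le_max_left _ _, ?_⟩
  intro x y f k hx hX hxy hyx hf hval
  have hX1 : 1 ≤ Real.log x := (le_max_left _ _).trans hX
  have hX2 : (m0/ε)^(1/lam) ≤ Real.log x := (le_max_left _ _).trans ((le_max_right _ _).trans hX)
  have hX3 : (4*r*c)^(1/(1-lam)) ≤ Real.log x := (le_max_right _ _).trans ((le_max_right _ _).trans hX)
  set lx := Real.log x with hlx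
  have hlx0 : 0 < lx := by linarith
  have hx0 : 0 < x := by linarith
  have hX2' : m0/ε ≤ lx^lam := by
    calc m0/ε = ((m0/ε)^(1/lam))^lam := by
          rw [← Real.rpow_mul (by positivity), one_div_mul_cancel hlam.ne', Real.rpow_one]
      _ ≤ _ := by gcongr
  obtain ⟨ζ, hζ⟩ : ∃ ζ : ℝ, ζ = lx^(1-lam) := ⟨_, rfl⟩
  have hX3' : 4*r*c ≤ ζ := by
    have h1 : 0 < 1 - lam := by linarith
    calc 4*r*c = ((4*r*c)^(1/(1-lam)))^(1-lam) := by
          rw [← Real.rpow_mul (by positivity), one_div_mul_cancel h1.ne', Real.rpow_one]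
      _ ≤ _ := by rw [hζ]; gcongr
  have hζ0 : 0 < ζ := by rw [hζ]; positivity
  have hζl : ζ * lx^lam = lx := by
    rw [hζ, ← Real.rpow_add hlx0]; simp
  have hy0 : 0 < y := lt_trans (by positivity) hxy
  -- L and T
  obtain ⟨L, hL⟩ : ∃ L : ℝ, L = Real.log y / m0 := ⟨_, rfl⟩
  have hly1 : ε * lx < Real.log y := by
    have := Real.log_lt_log (by positivity) hxy
    rwa [Real.log_rpow hx0] at this
  have hly2 : Real.log y ≤ lx := Real.log_le_log hy0 hyx
  have hL1 : ε/m0 * lx ≤ L := by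
    rw [hL, div_mul_eq_mul_div]
    gcongr
  have hL0 : 0 < L := lt_of_lt_of_le (by positivity) hL1
  have hL2 : L ≤ lx := by
    rw [hL, div_le_iff₀ (by linarith)]
    exact hly2.trans (le_mul_of_one_le_right hlx0.le (by linarith))
  have hlxL : lx / L ≤ m0/ε := by
    rw [div_le_div_iff₀ hL0 hε]
    have : ε/m0 * lx * m0 ≤ L * m0 := by gcongr
    have h2 : ε/m0 * lx * m0 = lx * ε := by field_simp
    linarith
  obtain ⟨T, hT⟩ : ∃ T : ℝ, T = Real.exp L := ⟨_, rfl⟩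
  have hT1 : 1 ≤ T := by rw [hT]; exact Real.one_le_exp hL0.le
  have hT0 : 0 < T := by linarith
  have hTy : T^m0 = y := by
    rw [hT, ← Real.exp_nat_mul, hL, mul_div_cancel₀ _ (by linarith : (m0:ℝ) ≠ 0), Real.exp_log hy0]
  have hTZ : T^(4+4*(r*K)) * T^(4*r) = y := by
    rw [← pow_add, ← hTy, hm0]; congr 1; ring
  have hZ1 : 1 ≤ T^(4*r) := one_le_pow₀ hT1
  have hZy : T^(4*r) ≤ y/T := by
    rw [le_div_iff₀ hT0, ← hTZ, mul_comm]
    gcongr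
    exact le_self_pow₀ hT1 (by omega)
  have hZy' : T^(4*r) ≤ y := hZy.trans (div_le_self hy0.le hT1)
  -- choice of I
  have hLζ : 1 ≤ L/ζ := by
    rw [le_div_iff₀ hζ0, one_mul]
    calc ζ = ε/m0 * (m0/ε * ζ) := by field_simp
      _ ≤ ε/m0 * (lx^lam * ζ) := by gcongr
      _ = ε/m0 * lx := by rw [mul_comm (lx^lam), hζl]
      _ ≤ L := hL1
  obtain ⟨I, hI1, hI2⟩ := exists_nat_pow_near hLζ (one_lt_two)
  have hIζ : ∀ i ≤ I, ζ ≤ L/2^i := by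
    intro i hi
    rw [le_div_iff₀ (by positivity)]
    rw [le_div_iff₀ hζ0] at hI1
    have : (2:ℝ)^i ≤ 2^I := pow_le_pow_right₀ (by norm_num) hi
    calc ζ * 2^i ≤ ζ * 2^I := mul_le_mul_of_nonneg_left this hζ0.le
      _ = 2^I * ζ := mul_comm _ _
      _ ≤ L := hI1
  have hIlow : ε/m0 * lx^lam ≤ 2 * 2^I := by
    rw [div_lt_iff₀ hζ0, pow_succ] at hI2
    have h1 : ε/m0 * (ζ * lx^lam) ≤ 2^I * 2 * ζ := by rw [hζl]; linarith
    have h2 : (ε/m0 * lx^lam) * ζ ≤ (2 * 2^I) * ζ := by linarith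
    exact le_of_mul_le_mul_right h2 hζ0
  have hσ : ∀ i ≤ I, c/(L/2^i) ≤ 1/(4*r) := by
    intro i hi
    have h1 := hIζ i hi
    have h2 : 0 < L/2^i := by positivity
    rw [div_le_div_iff₀ h2 (by positivity)]
    linarith
  -- the product
  set P := ∏ j, Real.sqrt (Ef (f j) x (fun p => (rho (Qs j) p : ℝ))) with hP
  have hP0 : 0 < P := Finset.prod_pos fun j _ => Real.sqrt_pos.2 (by have := Ef_ge_one (f j) x (Qs j); linarith)
  have hPle : P ≤ g10 * (1 + lx)^(8*(r*K)) := by rw [hg10]; exact prodE_le D f x hx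
  set S := (Iv x y).filter (fun n => ∀ j, extZ (f j) ((Qs j).eval n) = k j) with hS
  obtain ⟨s, hs⟩ : ∃ s : ℝ, s = Real.exp (3*K*lx) := ⟨_, rfl⟩
  set Bi : ℕ → ℝ := fun i => if i = 0 then 1 else T^(2*r) with hBi
  set E0 := (Iv x y).filter (fun n => ∃ j, (((Qs j).eval n).natAbs : ℝ) ≤ T^(4*r)) with hE0
  set EB := (Iv x y).filter (fun n => ∃ j, ∃ p : ℕ, p.Prime ∧ (p:ℝ) ≤ T ∧ ∃ w : ℕ, T^2 < (p:ℝ)^w ∧ ((p^w:ℕ):ℤ) ∣ (Qs j).eval n) with hEB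
  set Ei : ℕ → Finset ℤ := fun i => (Iv x y).filter (fun n => EvP Qs f k (L/2^i) s (Bi i) (T^(4*r)) n) with hEi
  set Fi := (Iv x y).filter (fun n => FinP Qs (L/2^I) (T^(2*r)) (T^(4*r)) n) with hFi
  have hcov : S ⊆ (E0 ∪ EB) ∪ ((Finset.range (I+1)).biUnion Ei ∪ Fi) := by
    intro n hn
    obtain ⟨hn1, hn2⟩ := Finset.mem_filter.1 hn
    simp only [Finset.mem_union]
    by_cases h0 : n ∈ E0
    · exact Or.inl (Or.inl h0)
    by_cases hB : n ∈ EB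
    · exact Or.inl (Or.inr hB)
    right
    have h0' : ¬ ∃ j, (((Qs j).eval n).natAbs : ℝ) ≤ T^(4*r) := fun h => h0 (Finset.mem_filter.2 ⟨hn1, h⟩)
    have hB' : ¬ ∃ j, ∃ p : ℕ, p.Prime ∧ (p:ℝ) ≤ T ∧ ∃ w : ℕ, T^2 < (p:ℝ)^w ∧ ((p^w:ℕ):ℤ) ∣ (Qs j).eval n :=
      fun h => hB (Finset.mem_filter.2 ⟨hn1, h⟩)
    have hk : ∀ j, f j ((Qs j).eval n).natAbs = k j := by
      intro j
      have h1 := hn2 j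
      unfold extZ at h1
      rwa [if_neg] at h1
      intro h2
      apply h0'
      refine ⟨j, ?_⟩
      rw [h2]
      simp only [Int.natAbs_zero, Nat.cast_zero]
      positivity
    rw [hT] at h0' hB'
    rcases covering hr Qs f k L s hL0 I n (fun j => by rw [hs]; exact size_le D x y hx hyx n hn1 j) hk h0' hB' with ⟨i, hi, h⟩ | h
    · left
      refine Finset.mem_biUnion.2 ⟨i, hi, Finset.mem_filter.2 ⟨hn1, ?_⟩⟩
      simp only [hBi, hT]
      exact h
    · right
      refine Finset.mem_filter.2 ⟨hn1, ?_⟩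
      rw [hT]
      exact h
  have hcard : (S.card : ℝ) ≤ (E0.card + EB.card) + (∑ i ∈ Finset.range (I+1), ((Ei i).card : ℝ) + Fi.card) := by
    have h1 := Finset.card_le_card hcov
    have h2 : ((E0 ∪ EB) ∪ ((Finset.range (I+1)).biUnion Ei ∪ Fi)).card ≤ (E0.card + EB.card) + (∑ i ∈ Finset.range (I+1), (Ei i).card + Fi.card) := by
      refine (Finset.card_union_le _ _).trans (add_le_add (Finset.card_union_le _ _) ((Finset.card_union_le _ _).trans ?_))
      gcongr
      exact Finset.card_biUnion_le
    exact_mod_cast h1.trans h2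
  -- exceptional sets
  have hexc : (E0.card + EB.card : ℝ) ≤ 5*r*K*g10*C4 * y / P := by
    have h1 : (E0.card : ℝ) ≤ 3*r*K*T^(4*r) := exc0 D x y _ hZ1
    have h2 : (EB.card : ℝ) ≤ 2*r*K*(y/T) := excB D x y T hT1 (by rw [← hTy]; exact pow_le_pow_right₀ hT1 (by omega))
    have h3 : (E0.card + EB.card : ℝ) ≤ 5*r*K*(y/T) := by
      have : 3*r*K*T^(4*r) ≤ 3*r*K*(y/T) := by gcongr
      linarith
    have h4 : P ≤ g10 * C4 * T := by
      calc P ≤ g10 * (1 + lx)^(8*(r*K)) := hPle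
        _ ≤ g10 * (C4 * Real.exp (ε/m0 * lx^(1:ℝ))) := by gcongr; exact hpe4 lx hX1
        _ ≤ g10 * (C4 * T) := by rw [Real.rpow_one, hT]; gcongr
        _ = _ := by ring
    rw [le_div_iff₀ hP0]
    calc _ ≤ 5*r*K*(y/T) * (g10*C4*T) := by gcongr
      _ = _ := by field_simp
  -- final event
  have hfinal : (Fi.card : ℝ) ≤ C2*g10^2*C3 * y / P := by
    have hℓ : 0 < L/2^I := by positivity
    have h1 := hfin (L/2^I) x y (T^(2*r)) Fi hℓ (hσ I le_rfl) (by positivity) hy0.le (Finset.filter_subset _ _) (by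
      intro n hn
      obtain ⟨a, h1, h2, h3⟩ := (Finset.mem_filter.1 hn).2
      exact ⟨a, h1, h2.trans hZy', h3⟩)
    have hBt : (T^(2*r))^(-(c/(L/2^I))) = Real.exp (-(2*r*c*2^I)) := by
      rw [hT, ← Real.exp_nat_mul, ← Real.exp_mul]
      congr 1
      push_cast
      field_simp
    have hR : Real.exp (∑ j, Rr (Qs j) (Real.exp (L/2^I))) ≤ g10 * (1 + lx)^(8*(r*K)) := by
      rw [hg10]
      apply expRr_le D _ _ hx
      calc _ ≤ Real.exp lx := by
            apply Real.exp_le_exp.2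
            exact (div_le_self hL0.le (one_le_pow₀ (by norm_num))).trans hL2
        _ = x := Real.exp_log hx0
    have h3 : Real.exp (-(2*r*c*2^I)) * (1+lx)^(16*(r*K)) ≤ C3 := by
      have := hpe3 lx hX1
      have h4 : r*c*(ε/m0) * lx^lam ≤ 2*r*c*2^I := by
        calc r*c*(ε/m0) * lx^lam = r*c*(ε/m0 * lx^lam) := by ring
          _ ≤ r*c*(2*2^I) := by gcongr
          _ = _ := by ring
      calc _ ≤ Real.exp (-(2*r*c*2^I)) * (C3 * Real.exp (2*r*c*2^I)) := by
            gcongr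
            refine this.trans ?_
            gcongr
        _ = C3 * (Real.exp (-(2*r*c*2^I)) * Real.exp (2*r*c*2^I)) := by ring
        _ = C3 := by rw [← Real.exp_add]; simp
    rw [hBt] at h1
    rw [le_div_iff₀ hP0]
    calc _ ≤ C2 * y * Real.exp (-(2*r*c*2^I)) * (g10 * (1 + lx)^(8*(r*K))) * (g10 * (1 + lx)^(8*(r*K))) := by
          gcongr
          refine h1.trans ?_
          gcongr
      _ = C2 * g10^2 * (Real.exp (-(2*r*c*2^I)) * (1+lx)^(16*(r*K))) * y := by
          rw [show 16*(r*K) = 8*(r*K) + 8*(r*K) by ring, pow_add]; ring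
      _ ≤ _ := by gcongr
  -- events
  have hevent : ∀ i ∈ Finset.range (I+1), ((Ei i).card : ℝ) ≤ (C1*Real.exp (2*r*c) * y / P) * (1/2)^i := by
    intro i hi
    have hiI : i ≤ I := by rw [Finset.mem_range] at hi; omega
    obtain ⟨ℓ, hℓd⟩ : ∃ ℓ : ℝ, ℓ = L/2^i := ⟨_, rfl⟩
    have h2i : (1:ℝ) ≤ 2^i := one_le_pow₀ (by norm_num)
    have hℓ : 0 < ℓ := by rw [hℓd]; positivity
    have hℓL : ℓ ≤ L := by rw [hℓd]; exact div_le_self hL0.le h2i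
    obtain ⟨u, hu⟩ : ∃ u : ℝ, u = 3*K*lx/ℓ := ⟨_, rfl⟩
    have hu1 : 1 ≤ u := by
      rw [hu, le_div_iff₀ hℓ]
      have q1 : lx ≤ 3*K*lx := le_mul_of_one_le_left hlx0.le (by linarith)
      linarith
    have hs' : s = (Real.exp ℓ)^u := by
      rw [hs, ← Real.exp_mul, hu]; congr 1; field_simp
    have hB0 : 0 < Bi i := by
      simp only [hBi]; split_ifs <;> positivity
    have h1 := hev ℓ x y s (Bi i) ((V:ℝ)^u) (T^(4*r)) f k (Ei i) hℓ (by rw [hℓd]; exact hσ i hiI) hB0 (by positivity) hy0.le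
      (by
        rw [← hTZ]
        gcongr
        rw [hT]
        exact Real.exp_le_exp.2 hℓL) (Finset.filter_subset _ _) hf
      (by
        intro j
        rw [hs']
        apply hval j (Real.exp ℓ) u _ hu1
        rw [← hζ, hℓd]
        exact Real.exp_le_exp.2 (hIζ i hiI))
      (by
        intro n hn
        have := (Finset.mem_filter.1 hn).2
        rw [← hℓd] at this
        exact this)
    -- bound of the B factor
    have hBt : (Bi i)^(-(c/ℓ)) ≤ Real.exp (2*r*c) * Real.exp (-(2*r*c*2^i)) := by
      simp only [hBi]
      split_ifs with h0
      · rw [h0, Real.one_rpow, ← Real.exp_add]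
        simp
      · have : (T^(2*r))^(-(c/ℓ)) = Real.exp (-(2*r*c*2^i)) := by
          rw [hT, ← Real.exp_nat_mul, ← Real.exp_mul, hℓd]
          congr 1
          push_cast
          field_simp
        rw [this]
        apply le_mul_of_one_le_left (by positivity)
        exact Real.one_le_exp (by positivity)
    have hlxℓ : lx/ℓ ≤ m0/ε * 2^i := by
      have : lx/ℓ = lx/L * 2^i := by rw [hℓd]; field_simp
      rw [this]
      gcongr
    have hVu : ((V:ℝ)^u)^r ≤ Real.exp (r*(cu*Real.log V*2^i)) := by
      rw [Real.exp_nat_mul]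
      gcongr
      rw [Real.rpow_def_of_pos (by linarith)]
      apply Real.exp_le_exp.2
      have : u ≤ cu * 2^i := by
        calc u = 3*K*(lx/ℓ) := by rw [hu]; ring
          _ ≤ 3*K*(m0/ε*2^i) := by gcongr
          _ = _ := by rw [hcu]; ring
      calc Real.log V * u ≤ Real.log V * (cu*2^i) := by gcongr
        _ = _ := by ring
    obtain ⟨P', hP'⟩ : ∃ P' : ℝ, P' = ∏ j, Real.sqrt (Ef (f j) (Real.exp ℓ) (fun p => (rho (Qs j) p : ℝ))) := ⟨_, rfl⟩
    have hP'0 : 0 < P' := by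
      rw [hP']
      exact Finset.prod_pos fun j _ => Real.sqrt_pos.2 (by have := Ef_ge_one (f j) (Real.exp ℓ) (Qs j); linarith)
    have hPP : P ≤ Real.exp (r*(κ*2^i)) * P' := by
      have e1 : Real.exp (r*(κ*2^i)) * P' = ∏ j, (Real.exp (κ*2^i) * Real.sqrt (Ef (f j) (Real.exp ℓ) (fun p => (rho (Qs j) p : ℝ)))) := by
        rw [Finset.prod_mul_distrib, Finset.prod_const, Finset.card_univ, Fintype.card_fin, Real.exp_nat_mul, hP']
      rw [e1, hP]
      apply Finset.prod_le_prod (fun j _ => Real.sqrt_nonneg _)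
      intro j _
      have e2 := Ef_cmp D j (f j) (Real.exp ℓ) x (Real.one_lt_exp_iff.2 hℓ) (by linarith)
      rw [Real.log_exp, ← hlx] at e2
      have e3 := Ef_ge_one (f j) (Real.exp ℓ) (Qs j)
      have e4 : 1 + 2*K*(lx/ℓ) ≤ Real.exp (κ*2^i) := by
        have := Real.add_one_le_exp (κ*2^i)
        have e5 : 2*K*(lx/ℓ) ≤ κ*2^i := by
          calc 2*K*(lx/ℓ) ≤ 2*K*(m0/ε*2^i) := by gcongr
            _ = _ := by rw [hκ]; ring
        linarith
      have e6 : 1 ≤ Real.exp (κ*2^i) := Real.one_le_exp (by positivity)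
      apply Real.sqrt_le_iff.2
      refine ⟨by positivity, ?_⟩
      rw [mul_pow, Real.sq_sqrt (by linarith)]
      refine e2.trans ?_
      gcongr
      exact e4.trans (le_self_pow₀ e6 two_ne_zero)
    rw [← hP'] at h1
    have hexp2 : Real.exp (-(2*r*c*2^i)) * Real.exp (r*(cu*Real.log V*2^i)) * Real.exp (r*(κ*2^i)) ≤ (1/2)^i := by
      rw [← Real.exp_add, ← Real.exp_add]
      have e1 : -(2*r*c*2^i) + r*(cu*Real.log V*2^i) + r*(κ*2^i) ≤ -(2:ℝ)^i := by
        have : -(2*r*c*2^i) + r*(cu*Real.log V*2^i) + r*(κ*2^i) = -(r*(c+1)*2^i) := by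
          rw [hc]; ring
        rw [this]
        have h5 : 1 ≤ r*(c+1) := one_le_mul_of_one_le_of_one_le hr' (by linarith)
        have : 1 * (2:ℝ)^i ≤ r*(c+1)*2^i := by gcongr
        linarith
      have e2 := Real.add_one_le_exp ((2:ℝ)^i)
      calc _ ≤ Real.exp (-(2:ℝ)^i) := Real.exp_le_exp.2 e1
        _ = 1/Real.exp ((2:ℝ)^i) := by rw [Real.exp_neg, one_div]
        _ ≤ 1/2^i := by gcongr; linarith
        _ = _ := by rw [one_div_pow]
    have h6 : ((Ei i).card : ℝ) * P' ≤ C1 * y * (Bi i)^(-(c/ℓ)) * ((V:ℝ)^u)^r := by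
      rwa [le_div_iff₀ hP'0] at h1
    rw [div_mul_eq_mul_div, le_div_iff₀ hP0]
    calc ((Ei i).card : ℝ) * P ≤ ((Ei i).card : ℝ) * (Real.exp (r*(κ*2^i)) * P') := mul_le_mul_of_nonneg_left hPP (Nat.cast_nonneg _)
      _ = (((Ei i).card : ℝ) * P') * Real.exp (r*(κ*2^i)) := by ring
      _ ≤ (C1 * y * (Bi i)^(-(c/ℓ)) * ((V:ℝ)^u)^r) * Real.exp (r*(κ*2^i)) := by gcongr
      _ ≤ (C1 * y * (Real.exp (2*r*c) * Real.exp (-(2*r*c*2^i))) * Real.exp (r*(cu*Real.log V*2^i))) * Real.exp (r*(κ*2^i)) := by gcongr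
      _ = C1 * Real.exp (2*r*c) * y * (Real.exp (-(2*r*c*2^i)) * Real.exp (r*(cu*Real.log V*2^i)) * Real.exp (r*(κ*2^i))) := by ring
      _ ≤ _ := by gcongr
  have hsum : ∑ i ∈ Finset.range (I+1), ((Ei i).card : ℝ) ≤ C1*Real.exp (2*r*c)*2 * y / P := by
    refine (Finset.sum_le_sum hevent).trans ?_
    rw [← Finset.mul_sum]
    have h1 := sum_geometric_two_le (I+1)
    calc _ ≤ (C1*Real.exp (2*r*c) * y / P) * 2 := by gcongr
      _ = _ := by ring
  calc (S.card : ℝ) ≤ _ := hcard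
    _ ≤ 5*r*K*g10*C4 * y / P + (C1*Real.exp (2*r*c)*2 * y / P + C2*g10^2*C3 * y / P) := by gcongr
    _ = _ := by ring

theorem statement13 (r V : ℕ) (ε lam : ℝ) (Qs : Fin r → Polynomial ℤ)
    (hr : 1 ≤ r) (hV : 1 ≤ V)
    (hε : 0 < ε) (hε1 : ε < 1) (hlam : 0 < lam) (hlam1 : lam < 1)
    (hirr : ∀ j, Irreducible (Qs j))
    (hcop : ∀ i j, i ≠ j → IsRelPrime (Qs i) (Qs j))
    (hnofix : ∀ p : ℕ, p.Prime → rho (∏ j, Qs j) p < p) :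
    ∃ C : ℝ, 0 < C ∧
      ∀ (x y : ℝ) (f : Fin r → ℕ → ℝ) (k : Fin r → ℝ),
        2 ≤ x → x ^ ε < y → y ≤ x →
        (∀ j, ∀ m n : ℕ, Nat.Coprime m n → f j (m * n) = f j m + f j n) →
        (∀ j, ∀ t u : ℝ, Real.exp ((Real.log x) ^ (1 - lam)) ≤ t → 1 ≤ u →
          (({v : ℝ | ∃ n : ℕ, 0 < n ∧ (n : ℝ) ≤ t ^ u ∧
              (∀ p : ℕ, p.Prime → p ∣ n → t < (p : ℝ)) ∧ f j n = v}).ncard : ℝ) ≤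
            (V : ℝ) ^ u) →
        (({n : ℤ | x < (n : ℝ) ∧ (n : ℝ) ≤ x + y ∧
            ∀ j, extZ (f j) ((Qs j).eval n) = k j}).ncard : ℝ) ≤
          C * y / ∏ j, Real.sqrt (Ef (f j) x (fun p => (rho (Qs j) p : ℝ))) := by
  obtain ⟨K, P0, D⟩ := exists_PD r Qs hr hirr hcop hnofix
  obtain ⟨C, X0, hC, hX0, hmain⟩ := main_large D V hV ε lam hε hlam hlam1
  set C' : ℝ := 2 * (Real.exp (10*(r*K:ℕ)) * (1 + X0)^(8*(r*K))) with hC'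
  have hC'0 : 0 < C' := by positivity
  refine ⟨C + C', by positivity, ?_⟩
  intro x y f k hx hxy hyx hf hval
  have hset : {n : ℤ | x < (n : ℝ) ∧ (n : ℝ) ≤ x + y ∧ ∀ j, extZ (f j) ((Qs j).eval n) = k j} =
      (((Iv x y).filter (fun n => ∀ j, extZ (f j) ((Qs j).eval n) = k j) : Finset ℤ) : Set ℤ) := by
    ext n
    simp only [Finset.coe_filter, mem_Iv, Set.mem_ofPred_eq, and_assoc]
  rw [hset, Set.ncard_coe_finset]
  have hy1 : 1 ≤ y := le_trans (Real.one_le_rpow (by linarith) hε.le) hxy.le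
  set P := ∏ j, Real.sqrt (Ef (f j) x (fun p => (rho (Qs j) p : ℝ))) with hP
  have hP0 : 0 < P := Finset.prod_pos fun j _ => Real.sqrt_pos.2 (by have := Ef_ge_one (f j) x (Qs j); linarith)
  by_cases hX : X0 ≤ Real.log x
  · refine (hmain x y f k hx hX hxy hyx hf hval).trans ?_
    gcongr
    linarith
  · push Not at hX
    have h1 : (((Iv x y).filter (fun n => ∀ j, extZ (f j) ((Qs j).eval n) = k j)).card : ℝ) ≤ (Iv x y).card := by
      exact_mod_cast Finset.card_le_card (Finset.filter_subset _ _)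
    have h2 := (abs_le.1 (card_Iv (x := x) (y := y) (by linarith))).2
    have hl : 0 ≤ Real.log x := Real.log_nonneg (by linarith)
    have h3 : P ≤ Real.exp (10*(r*K:ℕ)) * (1 + X0)^(8*(r*K)) := by
      refine (prodE_le D f x hx).trans ?_
      gcongr
    rw [le_div_iff₀ hP0]
    calc _ ≤ (2*y) * (Real.exp (10*(r*K:ℕ)) * (1 + X0)^(8*(r*K))) := by
          gcongr
          linarith
      _ = C' * y := by rw [hC']; ring
      _ ≤ _ := by gcongr; linarith
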